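/- Let d ≥ 2, 2 ≤ r < ∞, and r(d+1)/(d−1) < p < ∞. Then there is a constant C such that for all j ≥ 1 and all f ∈ L^p(ℝ^d), ‖ (Σ_{k∈ℤ} ‖𝒜_j^k f(x,·)‖_{L^r(ℝ)}^r)^{1/r} ‖_{L^p(dx)} ≤ C 2^{−jd/p} ‖f‖_{L^p(ℝ^d)}. -/

import Mathlib

open MeasureTheory Metric Set
open scoped ENNReal NNReal FourierTransform

noncomputable section

/-- Euclidean `d`-space. -/
abbrev Euc (d : ℕ) : Type := EuclideanSpace ℝ (Fin d)

/-- The normalized surface measure `σ` on the unit sphere `S^{d-1} ⊆ ℝ^d`. -/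
def sphereMeasure (d : ℕ) : Measure (Euc d) :=
  (((volume : Measure (Euc d)).toSphere Set.univ)⁻¹ : ℝ≥0∞) •
    ((volume : Measure (Euc d)).toSphere.map Subtype.val)

/-- The spherical average `A_t f(x) = ∫_{S^{d-1}} f(x - t y) dσ(y)`. -/
def sphAvg {d : ℕ} (f : Euc d → ℂ) (t : ℝ) (x : Euc d) : ℂ :=
  ∫ y, f (x - t • y) ∂(sphereMeasure d)

/-- The dyadic symbols `β_j` built from the bump `β₀`:
`β_j(s) = β₀(2^{-j} s) - β₀(2^{1-j} s)` for `j ≥ 1`. -/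
def betaJ (β₀ : ℝ → ℝ) : ℕ → ℝ → ℝ
  | 0 => β₀
  | (j + 1) => fun s => β₀ ((2 : ℝ) ^ (-(j + 1 : ℤ)) * s) - β₀ ((2 : ℝ) ^ (-(j : ℤ)) * s)

/-- The frequency localization `L_j` with symbol `β_j(|ξ|)`. -/
def freqLoc (d : ℕ) (β₀ : ℝ → ℝ) (j : ℕ) (f : Euc d → ℂ) : Euc d → ℂ :=
  𝓕⁻ (fun ξ => (betaJ β₀ j ‖ξ‖ : ℂ) * 𝓕 f ξ)

/-- `χ` is an admissible time cutoff: smooth, `χ = 1` on a neighborhood of `[1,2]`,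
supported in `[1/2,4]`. -/
def IsCutoff (χ : ℝ → ℝ) : Prop :=
  ContDiff ℝ (⊤ : ℕ∞) χ ∧ (∃ U : Set ℝ, IsOpen U ∧ Set.Icc 1 2 ⊆ U ∧ Set.EqOn χ 1 U) ∧
    Function.support χ ⊆ Set.Icc (1 / 2 : ℝ) 4

/-- `β₀` is an admissible frequency bump: smooth, `β₀(s) = 1` for `|s| < 1/2` and
`β₀(s) = 0` for `|s| > 1`. -/
def IsBump (β₀ : ℝ → ℝ) : Prop :=
  ContDiff ℝ (⊤ : ℕ∞) β₀ ∧ (∀ s : ℝ, |s| < 1 / 2 → β₀ s = 1) ∧ ∀ s : ℝ, 1 < |s| → β₀ s = 0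

/-- The frequency-localized operator `𝒜_j f(x,t) = χ(t) A_t L_j f(x)`. -/
def Aj (d : ℕ) (χ β₀ : ℝ → ℝ) (j : ℕ) (f : Euc d → ℂ) (x : Euc d) (t : ℝ) : ℂ :=
  (χ t : ℂ) * sphAvg (freqLoc d β₀ j f) t x

/-- `L^q` norm (with respect to `μ`) of an `ℝ≥0∞`-valued function, `1 ≤ q ≤ ∞`. -/
def lqNorm {α : Type*} [MeasurableSpace α] (q : ℝ≥0∞) (g : α → ℝ≥0∞)
    (μ : Measure α) : ℝ≥0∞ :=
  if q = ∞ then essSup g μ else (∫⁻ x, g x ^ q.toReal ∂μ) ^ (1 / q.toReal)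

/-- The homogeneous Littlewood–Paley projection `P_m`, with symbol
`β₀(2^{-m}|ξ|) - β₀(2^{1-m}|ξ|)`, localizing to frequencies `|ξ| ≈ 2^m`. -/
def homLP (d : ℕ) (β₀ : ℝ → ℝ) (m : ℤ) (f : Euc d → ℂ) : Euc d → ℂ :=
  𝓕⁻ (fun ξ =>
    ((β₀ ((2 : ℝ) ^ (-m) * ‖ξ‖) - β₀ ((2 : ℝ) ^ (1 - m) * ‖ξ‖) : ℝ) : ℂ) * 𝓕 f ξ)

/-- The rescaled frequency-localized operator
`𝒜_j^k f(x,t) = χ(t) A_{2^k t} P_{j-k} f(x)`. -/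
def Ajk (d : ℕ) (χ β₀ : ℝ → ℝ) (j : ℕ) (k : ℤ) (f : Euc d → ℂ) (x : Euc d)
    (t : ℝ) : ℂ :=
  (χ t : ℂ) * sphAvg (homLP d β₀ ((j : ℤ) - k) f) ((2 : ℝ) ^ k * t) x

section

open MeasureTheory Metric Set
open scoped ENNReal NNReal FourierTransform Pointwise

noncomputable section

/-- total mass of the surface measure -/
def cS (d : ℕ) : ℝ≥0∞ := (volume : Measure (Euc d)).toSphere Set.univ

lemma cS_ne_zero {d : ℕ} (hd : 2 ≤ d) : cS d ≠ 0 := by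
  have : Nonempty (Fin d) := ⟨⟨0, by omega⟩⟩
  unfold cS
  rw [Measure.measure_univ_ne_zero]
  exact Measure.toSphere_ne_zero _

lemma cS_ne_top (d : ℕ) : cS d ≠ ∞ := measure_ne_top _ _

lemma smul_sphereMeasure {d : ℕ} (hd : 2 ≤ d) :
    cS d • sphereMeasure d = ((volume : Measure (Euc d)).toSphere.map Subtype.val) := by
  rw [sphereMeasure, ← cS, smul_smul, ENNReal.mul_inv_cancel (cS_ne_zero hd) (cS_ne_top d), one_smul]

lemma sphereMeasure_prob {d : ℕ} (hd : 2 ≤ d) : IsProbabilityMeasure (sphereMeasure d) := by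
  constructor
  rw [sphereMeasure, Measure.smul_apply, Measure.map_apply measurable_subtype_coe MeasurableSet.univ,
    preimage_univ, smul_eq_mul]
  exact ENNReal.inv_mul_cancel (cS_ne_zero hd) (cS_ne_top d)

lemma ae_sphere (d : ℕ) : ∀ᵐ y ∂(sphereMeasure d), ‖y‖ = 1 := by
  rw [sphereMeasure]
  apply Measure.ae_smul_measure
  rw [ae_map_iff measurable_subtype_coe.aemeasurable (measurableSet_eq_fun measurable_norm measurable_const)]
  exact Filter.Eventually.of_forall fun y => by simp

lemma toSphere_map_apply {d : ℕ} {s : Set (Euc d)} (hs : MeasurableSet s) :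
    ((volume : Measure (Euc d)).toSphere.map Subtype.val) s
      = (d : ℝ≥0∞) * volume (Ioo (0:ℝ) 1 • (s ∩ sphere 0 1)) := by
  rw [Measure.map_apply measurable_subtype_coe hs,
    Measure.toSphere_apply' _ (measurable_subtype_coe hs), Subtype.image_preimage_coe]
  rw [inter_comm]
  simp

lemma sphereMeasure_map {d : ℕ} (L : Euc d ≃ₗᵢ[ℝ] Euc d) :
    (sphereMeasure d).map L = sphereMeasure d := by
  have hL : Measurable L := L.continuous.measurable
  rw [sphereMeasure, Measure.map_smul]
  congr 1
  ext s hs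
  rw [Measure.map_apply hL hs, toSphere_map_apply (hL hs), toSphere_map_apply hs]
  congr 1
  have : Ioo (0:ℝ) 1 • (L ⁻¹' s ∩ sphere 0 1) = L ⁻¹' (Ioo (0:ℝ) 1 • (s ∩ sphere 0 1)) := by
    ext x
    simp only [mem_smul, mem_inter_iff, mem_preimage, mem_sphere_zero_iff_norm]
    constructor
    · rintro ⟨a, ha, y, ⟨hy1, hy2⟩, rfl⟩
      exact ⟨a, ha, L y, ⟨hy1, by simpa using hy2⟩, by simp⟩
    · rintro ⟨a, ha, y, ⟨hy1, hy2⟩, h⟩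
      refine ⟨a, ha, L.symm y, ⟨by simpa using hy1, by simpa using hy2⟩, ?_⟩
      apply L.injective
      simp [← h]
  rw [this]
  exact L.measurePreserving.measure_preimage_equiv (f := L.toMeasurableEquiv) _

lemma integral_sphere_comp {d : ℕ} (L : Euc d ≃ₗᵢ[ℝ] Euc d) {F : Type*} [NormedAddCommGroup F]
    [NormedSpace ℝ F] (f : Euc d → F) :
    ∫ y, f (L y) ∂(sphereMeasure d) = ∫ y, f y ∂(sphereMeasure d) := by
  conv_rhs => rw [← sphereMeasure_map L]
  exact (integral_map_equiv L.toMeasurableEquiv f).symm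

/-- radial measure -/
def radM (d : ℕ) : Measure ℝ :=
  (volume.restrict (Ioi (0:ℝ))).withDensity fun r => ENNReal.ofReal (r ^ (d - 1))

instance (d : ℕ) : SFinite (radM d) := by unfold radM; infer_instance

lemma lintegral_polar' {d : ℕ} (hd : 2 ≤ d) {f : Euc d → ℝ≥0∞} (hf : Measurable f) :
    ∫⁻ x, f x = ∫⁻ p, f (p.2 • p.1) ∂(cS d • sphereMeasure d).prod (radM d) := by
  have : Nonempty (Fin d) := ⟨⟨0, by omega⟩⟩
  have := sphereMeasure_prob hd
  have hm : Measurable fun p : Euc d × ℝ => f (p.2 • p.1) := by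
    apply hf.comp; exact (measurable_snd.smul measurable_fst)
  have h1 : ∫⁻ x, f x = ∫⁻ x : ({0}ᶜ : Set (Euc d)), f x ∂(volume.comap Subtype.val) := by
    rw [lintegral_subtype_comap (measurableSet_singleton _).compl]
    rw [restrict_compl_singleton]
  have h2 := (Measure.measurePreserving_homeomorphUnitSphereProd (volume : Measure (Euc d))).lintegral_comp
    (f := fun p => f ((p.2 : ℝ) • (p.1 : Euc d))) (by
      apply hf.comp
      exact (measurable_subtype_coe.comp measurable_snd).smul (measurable_subtype_coe.comp measurable_fst))
  have h3 : ∀ x : ({0}ᶜ : Set (Euc d)), f (((homeomorphUnitSphereProd (Euc d) x).2 : ℝ) • ((homeomorphUnitSphereProd (Euc d) x).1 : Euc d)) = f x := by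
    intro x
    congr 1
    simp only [homeomorphUnitSphereProd_apply_snd_coe, homeomorphUnitSphereProd_apply_fst_coe]
    rw [smul_smul, mul_inv_cancel₀ (norm_ne_zero_iff.2 x.2), one_smul]
  rw [h1]
  simp only [h3] at h2
  rw [h2]
  have hfin : Module.finrank ℝ (Euc d) = d := by simp
  rw [hfin, lintegral_prod_symm _ (by
      apply Measurable.aemeasurable; apply hf.comp
      exact (measurable_subtype_coe.comp measurable_snd).smul (measurable_subtype_coe.comp measurable_fst)),
    lintegral_prod_symm _ hm.aemeasurable, smul_sphereMeasure hd]
  have h4 : ∀ r : ℝ, ∫⁻ x : Euc d, f (r • x) ∂((volume : Measure (Euc d)).toSphere.map Subtype.val)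
     = ∫⁻ x : sphere (0 : Euc d) 1, f (r • (x : Euc d)) ∂(volume : Measure (Euc d)).toSphere := by
    intro r
    rw [lintegral_map (f := fun x => f (r • x)) (hf.comp (measurable_const_smul r)) measurable_subtype_coe]
  simp only [h4]
  have hm2 : Measurable fun r : ℝ => ∫⁻ x : sphere (0 : Euc d) 1, f (r • (x : Euc d)) ∂(volume : Measure (Euc d)).toSphere := by
    apply Measurable.lintegral_prod_right' (f := fun p : ℝ × sphere (0 : Euc d) 1 => f (p.1 • (p.2 : Euc d)))
    exact hf.comp (measurable_fst.smul (measurable_subtype_coe.comp measurable_snd))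
  rw [radM, lintegral_withDensity_eq_lintegral_mul _ (by fun_prop) hm2, Measure.volumeIoiPow,
    lintegral_withDensity_eq_lintegral_mul _ (by fun_prop) (g := fun r : Ioi (0:ℝ) => ∫⁻ x : sphere (0 : Euc d) 1, f ((r:ℝ) • (x : Euc d)) ∂(volume : Measure (Euc d)).toSphere) (hm2.comp measurable_subtype_coe)]
  rw [← lintegral_subtype_comap measurableSet_Ioi]
  rfl

lemma volume_polar {d : ℕ} (hd : 2 ≤ d) :
    (volume : Measure (Euc d)) =
      ((cS d • sphereMeasure d).prod (radM d)).map (fun p => p.2 • p.1) := by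
  have hm : Measurable fun p : Euc d × ℝ => (p.2 • p.1) := (measurable_snd.smul measurable_fst)
  ext s hs
  rw [Measure.map_apply hm hs, ← lintegral_indicator_one hs, lintegral_polar' hd (measurable_one.indicator hs),
    ← lintegral_indicator_one (hm hs)]
  rfl

lemma lintegral_polar {d : ℕ} (hd : 2 ≤ d) {f : Euc d → ℝ≥0∞} (hf : Measurable f) :
    ∫⁻ x, f x = cS d * ∫⁻ r in Ioi (0:ℝ), ENNReal.ofReal (r ^ (d - 1)) * ∫⁻ y, f (r • y) ∂(sphereMeasure d) := by
  have := sphereMeasure_prob hd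
  have hm : Measurable fun p : Euc d × ℝ => f (p.2 • p.1) := hf.comp (measurable_snd.smul measurable_fst)
  have : SFinite (cS d • sphereMeasure d) := by rw [smul_sphereMeasure hd]; infer_instance
  rw [lintegral_polar' hd hf, lintegral_prod_symm _ hm.aemeasurable]
  have hm2 : Measurable fun r : ℝ => ∫⁻ y, f (r • y) ∂(sphereMeasure d) := by
    apply Measurable.lintegral_prod_right' (f := fun p : ℝ × Euc d => f (p.1 • p.2))
    exact hf.comp (measurable_fst.smul measurable_snd)
  simp only [lintegral_smul_measure, smul_eq_mul]
  rw [lintegral_const_mul _ hm2, radM, lintegral_withDensity_eq_lintegral_mul _ (by fun_prop) hm2]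
  rfl

lemma integral_polar {d : ℕ} (hd : 2 ≤ d) {f : Euc d → ℂ} (hf : Integrable f) :
    ∫ x, f x = (cS d).toReal • ∫ r in Ioi (0:ℝ), (r ^ (d - 1)) • ∫ y, f (r • y) ∂(sphereMeasure d) := by
  have := sphereMeasure_prob hd
  have : SFinite (cS d • sphereMeasure d) := by rw [smul_sphereMeasure hd]; infer_instance
  have hm : Measurable fun p : Euc d × ℝ => (p.2 • p.1) := (measurable_snd.smul measurable_fst)
  rw [volume_polar hd] at hf
  have hf' : Integrable (fun p : Euc d × ℝ => f (p.2 • p.1)) ((cS d • sphereMeasure d).prod (radM d)) :=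
    hf.comp_measurable hm
  rw [show (volume : Measure (Euc d)) = _ from volume_polar hd, integral_map hm.aemeasurable hf.1]
  rw [integral_prod_symm _ hf']
  simp only [integral_smul_measure]
  rw [integral_smul]
  congr 1
  rw [radM]
  have : ∀ r : ℝ, ENNReal.ofReal (r ^ (d-1)) = ((Real.toNNReal (r^(d-1)) : ℝ≥0) : ℝ≥0∞) := fun r => rfl
  simp only [this]
  rw [integral_withDensity_eq_integral_smul (by fun_prop)]
  apply setIntegral_congr_fun measurableSet_Ioi
  intro r hr
  simp only [NNReal.smul_def]
  rw [Real.coe_toNNReal _ (pow_nonneg (le_of_lt hr) _)]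
end
end

section

open MeasureTheory Metric Set
open scoped ENNReal NNReal FourierTransform

noncomputable section

lemma cont_int_sphere {d : ℕ} (hd : 2 ≤ d) {F : Type*} [NormedAddCommGroup F]
    {f : Euc d → F} (hf : Continuous f) : Integrable f (sphereMeasure d) := by
  have := sphereMeasure_prob hd
  obtain ⟨C, hC⟩ := (isCompact_sphere (0 : Euc d) 1).exists_bound_of_continuousOn hf.continuousOn
  refine Integrable.of_bound hf.aestronglyMeasurable C ?_
  filter_upwards [ae_sphere d] with y hy
  exact hC y (by simpa using hy)

lemma deriv_cos_sphere {d : ℕ} (hd : 2 ≤ d) {a b c : Euc d → ℝ} (ha : Continuous a)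
    (hb : Continuous b) (hc : Continuous c) (s : ℝ) :
    HasDerivAt (fun s => ∫ y, c y * Real.cos (a y + s * b y) ∂(sphereMeasure d))
      (-∫ y, c y * b y * Real.sin (a y + s * b y) ∂(sphereMeasure d)) s := by
  rw [← integral_neg]
  refine (hasDerivAt_integral_of_dominated_loc_of_deriv_le (s := univ)
    (F' := fun s y => -(c y * b y * Real.sin (a y + s * b y))) (bound := fun y => |c y * b y|)
    Filter.univ_mem ?_ ?_ ?_ ?_ ?_ ?_).2
  · refine Filter.Eventually.of_forall fun s => ?_
    exact (Continuous.aestronglyMeasurable (by fun_prop))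
  · exact cont_int_sphere hd (by fun_prop)
  · exact (Continuous.aestronglyMeasurable (by fun_prop))
  · refine Filter.Eventually.of_forall fun y s _ => ?_
    rw [norm_neg, norm_mul]
    exact mul_le_of_le_one_right (norm_nonneg _) (Real.abs_sin_le_one _)
  · exact cont_int_sphere hd (by fun_prop)
  · refine Filter.Eventually.of_forall fun y s _ => ?_
    have h1 : HasDerivAt (fun s : ℝ => a y + s * b y) (b y) s := by
      simpa using ((hasDerivAt_id s).mul_const (b y)).const_add (a y)
    have := (h1.cos).const_mul (c y)
    exact this.congr_deriv (by ring)

lemma deriv_sin_sphere {d : ℕ} (hd : 2 ≤ d) {a b c : Euc d → ℝ} (ha : Continuous a)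
    (hb : Continuous b) (hc : Continuous c) (s : ℝ) :
    HasDerivAt (fun s => ∫ y, c y * Real.sin (a y + s * b y) ∂(sphereMeasure d))
      (∫ y, c y * b y * Real.cos (a y + s * b y) ∂(sphereMeasure d)) s := by
  have := deriv_cos_sphere hd (a := fun y => a y - Real.pi / 2) (by fun_prop) hb hc s
  have e1 : ∀ s y, a y - Real.pi / 2 + s * b y = (a y + s * b y) - Real.pi / 2 := by intros; ring
  simp only [e1, Real.cos_sub_pi_div_two, Real.sin_sub_pi_div_two, mul_neg, integral_neg, neg_neg] at this
  exact this

lemma sphere_rot {d : ℕ} {F : Type*} [NormedAddCommGroup F]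
    [NormedSpace ℝ F] (f : ℝ → F) {x x' : Euc d} (h : ‖x‖ = ‖x'‖) :
    ∫ y, f (inner ℝ x y) ∂(sphereMeasure d) = ∫ y, f (inner ℝ x' y) ∂(sphereMeasure d) := by
  have := Submodule.reflection_sub h
  set L := (Submodule.span ℝ {x - x'})ᗮ.reflection
  rw [← integral_sphere_comp L (fun y => f (inner ℝ x' y))]
  congr 1
  ext y
  rw [← this, L.inner_map_map]

/-- the Fourier transform of the sphere measure as a function of the radius -/
def mm (d : ℕ) (hd : 2 ≤ d) (r : ℝ) : ℝ := ∫ y, Real.cos (r * y ⟨0, by omega⟩) ∂(sphereMeasure d)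
def mm1 (d : ℕ) (hd : 2 ≤ d) (r : ℝ) : ℝ :=
  -∫ y, y ⟨0, by omega⟩ * Real.sin (r * y ⟨0, by omega⟩) ∂(sphereMeasure d)

lemma mm_inner {d : ℕ} (hd : 2 ≤ d) (x : Euc d) :
    ∫ y, Real.cos (inner ℝ x y) ∂(sphereMeasure d) = mm d hd ‖x‖ := by
  rw [sphere_rot Real.cos (x' := EuclideanSpace.single (⟨0, by omega⟩ : Fin d) ‖x‖) (by simp)]
  simp [mm, EuclideanSpace.inner_single_left]

lemma mm_deriv {d : ℕ} (hd : 2 ≤ d) (r : ℝ) : HasDerivAt (mm d hd) (mm1 d hd r) r := by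
  have := deriv_cos_sphere hd (a := fun _ => 0) (b := fun y => y ⟨0, by omega⟩) (c := fun _ => 1) (by fun_prop) (by fun_prop) (by fun_prop) r
  simp only [zero_add, one_mul] at this
  exact this

lemma mm1_deriv' {d : ℕ} (hd : 2 ≤ d) (r : ℝ) : HasDerivAt (mm1 d hd)
    (-∫ y, (y ⟨0, by omega⟩)^2 * Real.cos (r * y ⟨0, by omega⟩) ∂(sphereMeasure d)) r := by
  have := (deriv_sin_sphere hd (a := fun _ => 0) (b := fun y => y ⟨0, by omega⟩) (c := fun y => y ⟨0, by omega⟩) (by fun_prop) (by fun_prop) (by fun_prop) r).neg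
  simp only [zero_add] at this
  simp only [pow_two]
  exact this

lemma mm_second {d : ℕ} (hd : 2 ≤ d) {r : ℝ} (hr : 0 < r) (i : Fin d) (hi : i ≠ ⟨0, by omega⟩) :
    ∫ y, (y i)^2 * Real.cos (r * y ⟨0, by omega⟩) ∂(sphereMeasure d) = - mm1 d hd r / r := by
  set o : Fin d := ⟨0, by omega⟩ with ho
  have key : ∀ s : ℝ, ∫ y : Euc d, Real.cos (r * y o + s * y i) ∂(sphereMeasure d) = mm d hd (√(r^2+s^2)) := by
    intro s
    have h := mm_inner hd (EuclideanSpace.single o r + EuclideanSpace.single i s)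
    have hn : ‖(EuclideanSpace.single o r + EuclideanSpace.single i s : Euc d)‖ = √(r^2+s^2) := by
      rw [EuclideanSpace.norm_eq]
      congr 1
      have : ∀ j : Fin d, ‖(EuclideanSpace.single o r + EuclideanSpace.single i s : Euc d) j‖^2
         = (if j = o then r^2 else 0) + (if j = i then s^2 else 0) := by
        intro j
        by_cases h1 : j = o
        · have : ¬ (o = i) := fun h => hi h.symm
          subst h1; simp [this]
        · by_cases h2 : j = i
          · subst h2; simp [h1]
          · simp [h1, h2]
      rw [Finset.sum_congr rfl (fun j _ => this j)]; simp [Finset.sum_add_distrib]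
    rw [hn] at h
    simpa [inner_add_left, EuclideanSpace.inner_single_left] using h
  have hpos : ∀ s : ℝ, 0 < r^2 + s^2 := fun s => by positivity
  have hsq : ∀ s : ℝ, HasDerivAt (fun s => √(r^2+s^2)) (s / √(r^2+s^2)) s := by
    intro s
    have h1 : HasDerivAt (fun s : ℝ => r^2+s^2) (2*s) s := by
      simpa using (hasDerivAt_pow 2 s).const_add (r^2)
    convert h1.sqrt (hpos s).ne' using 1
    field_simp
  have d1 : ∀ s : ℝ, ∫ y : Euc d, y i * Real.sin (r * y o + s * y i) ∂(sphereMeasure d)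
      = - (mm1 d hd (√(r^2+s^2)) * (s / √(r^2+s^2))) := by
    intro s
    have h1 := deriv_cos_sphere hd (a := fun y => r * y o) (b := fun y => y i) (c := fun _ => 1) (by fun_prop) (by fun_prop) (by fun_prop) s
    simp only [one_mul, key] at h1
    have h2 := (mm_deriv hd (√(r^2+s^2))).comp s (hsq s)
    have := h1.unique h2
    linarith
  have h3 := deriv_sin_sphere hd (a := fun y => r * y o) (b := fun y => y i) (c := fun y => y i) (by fun_prop) (by fun_prop) (by fun_prop) 0
  simp only [d1, zero_mul, add_zero] at h3
  have h4 : HasDerivAt (fun s => -(mm1 d hd (√(r^2+s^2)) * (s / √(r^2+s^2)))) (- mm1 d hd r / r) 0 := by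
    have e0 : √(r^2+0^2) = r := by simp [Real.sqrt_sq hr.le]
    have a1 := (mm1_deriv' hd (√(r^2+0^2))).comp 0 (hsq 0)
    have a2 := (hasDerivAt_id (0:ℝ)).div (hsq 0) (by rw [e0]; exact hr.ne')
    have a3 := (a1.mul a2).neg
    refine HasDerivAt.congr_deriv a3 ?_
    simp only [Function.comp, id, e0]
    field_simp
    ring
  have := h3.unique h4
  rw [← this]
  congr 1; ext y; ring

lemma mm1_deriv {d : ℕ} (hd : 2 ≤ d) {r : ℝ} (hr : 0 < r) : HasDerivAt (mm1 d hd)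
    (- ((d:ℝ) - 1) * mm1 d hd r / r - mm d hd r) r := by
  convert mm1_deriv' hd r using 1
  set o : Fin d := ⟨0, by omega⟩ with ho
  have h1 : mm d hd r = ∑ i : Fin d, ∫ y, (y i)^2 * Real.cos (r * y o) ∂(sphereMeasure d) := by
    rw [← integral_finsetSum _ (fun i _ => cont_int_sphere hd (by fun_prop)), mm]
    apply integral_congr_ae
    filter_upwards [ae_sphere d] with y hy
    rw [← Finset.sum_mul]
    have : ∑ i, (y i)^2 = 1 := by
      rw [EuclideanSpace.norm_eq, Real.sqrt_eq_one] at hy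
      simpa using hy
    rw [this, one_mul]
  rw [← Finset.add_sum_erase _ _ (Finset.mem_univ o)] at h1
  rw [Finset.sum_congr rfl (fun i hi => mm_second hd hr i (Finset.ne_of_mem_erase hi))] at h1
  simp only [Finset.sum_const, nsmul_eq_mul] at h1
  rw [h1, Finset.card_erase_of_mem (Finset.mem_univ o), Finset.card_univ, Fintype.card_fin]
  rw [Nat.cast_sub (by omega)]
  push_cast
  ring

lemma mm_le_one {d : ℕ} (hd : 2 ≤ d) (r : ℝ) : |mm d hd r| ≤ 1 := by
  have := sphereMeasure_prob hd
  have := norm_integral_le_of_norm_le_const (μ := sphereMeasure d) (f := fun y : Euc d => Real.cos (r * y ⟨0, by omega⟩)) (C := 1)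
    (Filter.Eventually.of_forall fun y => Real.abs_cos_le_one _)
  simpa [mm] using this

lemma mm_decay {d : ℕ} (hd : 2 ≤ d) : ∃ C : ℝ, 0 < C ∧ ∀ r : ℝ, 0 ≤ r → r ^ (d-1) * (mm d hd r)^2 ≤ C := by
  obtain ⟨n, rfl⟩ : ∃ n, d = n + 1 := ⟨d - 1, by omega⟩
  have hn : 1 ≤ n := by omega
  have hn' : (1:ℝ) ≤ n := by exact_mod_cast hn
  simp only [Nat.add_sub_cancel]
  set m := mm (n+1) hd
  set m1 := mm1 (n+1) hd
  set E : ℝ → ℝ := fun r => r^n * (m r^2 + m1 r^2 + n * (m r * m1 r) / r) with hE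
  have dE : ∀ r, 0 < r → HasDerivAt E (- n * r^n / r^2 * (m r * m1 r)) r := by
    intro r hr
    have h1 := mm_deriv hd r
    have h2 := mm1_deriv hd hr
    have h3 := (hasDerivAt_pow n r).mul ((((h1.pow 2).add (h2.pow 2))).add ((((h1.mul h2).const_mul (n:ℝ)).div (hasDerivAt_id r) hr.ne')))
    refine HasDerivAt.congr_deriv h3 ?_
    simp only [Pi.add_apply, Pi.mul_apply, Pi.pow_apply, id, Pi.div_apply, ]
    obtain ⟨k, rfl⟩ : ∃ k, n = k + 1 := ⟨n - 1, by omega⟩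
    simp only [Nat.add_sub_cancel]
    push_cast
    field_simp
    ring
  have lowE : ∀ r, (n:ℝ) ≤ r → r^n * |m r * m1 r| ≤ E r ∧ r^n * m r^2 ≤ 2 * E r := by
    intro r hr
    have hr0 : 0 < r := by linarith
    have hb : |n * (m r * m1 r) / r| ≤ (m r^2+m1 r^2)/2 := by
      rw [abs_div, abs_mul, abs_of_pos hr0, div_le_iff₀ hr0, Nat.abs_cast]
      have : |m r * m1 r| ≤ (m r^2+m1 r^2)/2 := by
        rw [abs_mul]; nlinarith [sq_nonneg (|m r| - |m1 r|), sq_abs (m r), sq_abs (m1 r)]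
      rw [mul_comm]
      apply mul_le_mul this hr (by positivity) (by positivity)
    have hb' := (abs_le.1 hb).1
    have : |m r * m1 r| ≤ (m r^2+m1 r^2)/2 := by
        rw [abs_mul]; nlinarith [sq_nonneg (|m r| - |m1 r|), sq_abs (m r), sq_abs (m1 r)]
    constructor
    · apply mul_le_mul_of_nonneg_left _ (by positivity)
      linarith
    · have : r^n * m r^2 ≤ r^n * (2 * (m r^2 + m1 r^2 + n * (m r * m1 r) / r)) := by
        apply mul_le_mul_of_nonneg_left _ (by positivity)
        nlinarith [sq_nonneg (m1 r)]
      simp only [hE]; linarith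
  have anti : AntitoneOn (fun r => E r * Real.exp (n / r)) (Ici (n:ℝ)) := by
    have dd : ∀ r, 0 < r → HasDerivAt (fun r => E r * Real.exp (n / r)) ((- n * r^n / r^2 * (m r * m1 r)) * Real.exp (n/r) + E r * (Real.exp (n/r) * (-n / r^2))) r := by
      intro r hr
      have h5 : HasDerivAt (fun r : ℝ => (n:ℝ) / r) (-n / r^2) r := by
        have := (hasDerivAt_const r (n:ℝ)).div (hasDerivAt_id r) hr.ne'
        exact this.congr_deriv (by simp)
      exact (dE r hr).mul h5.exp
    apply antitoneOn_of_deriv_nonpos (convex_Ici _)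
    · intro r hr
      have : 0 < r := by have : (n:ℝ) ≤ r := hr
                         linarith
      exact (dd r this).continuousAt.continuousWithinAt
    · intro r hr
      rw [interior_Ici] at hr
      have : 0 < r := by have : (n:ℝ) < r := hr
                         linarith
      exact (dd r this).differentiableAt.differentiableWithinAt
    · intro r hr
      rw [interior_Ici] at hr
      have hr' : (n:ℝ) < r := hr
      have hr0 : 0 < r := by linarith
      rw [(dd r hr0).deriv]
      have h1 := (lowE r hr'.le).1
      have h2 : -(r^n * (m r * m1 r)) ≤ E r := by
        have : -(r^n * (m r * m1 r)) ≤ r^n * |m r * m1 r| := by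
          rw [← mul_neg]; apply mul_le_mul_of_nonneg_left (neg_le_abs _) (by positivity)
        linarith
      have h3 : (- n * r^n / r^2 * (m r * m1 r)) * Real.exp (n/r) + E r * (Real.exp (n/r) * (-n / r^2)) =
        (n / r^2 * Real.exp (n/r)) * (-(r^n * (m r * m1 r)) - E r) := by ring
      rw [h3]
      apply mul_nonpos_of_nonneg_of_nonpos (by positivity)
      linarith
  refine ⟨max ((n:ℝ)^n) (2 * (E n * Real.exp 1)), lt_max_of_lt_left (by positivity), fun r hr => ?_⟩
  by_cases h : (n:ℝ) ≤ r
  · apply le_max_of_le_right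
    refine (lowE r h).2.trans ?_
    have h1 := anti (mem_Ici.2 le_rfl) h h
    simp only at h1
    rw [div_self (by positivity)] at h1
    have h2 : 0 ≤ E r := le_trans (by positivity) (lowE r h).1
    have h3 : 1 ≤ Real.exp (n / r) := Real.one_le_exp (by positivity)
    nlinarith
  · apply le_max_of_le_left
    have h1 : r^n ≤ (n:ℝ)^n := by gcongr; linarith
    have h2 : m r ^2 ≤ 1 := by
      rw [← sq_abs]; exact pow_le_one₀ (abs_nonneg _) (mm_le_one hd r)
    calc r^n * m r^2 ≤ (n:ℝ)^n * 1 := by gcongr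
      _ = _ := by ring

/-- Fourier transform of sphere measure -/
lemma sphere_fourier {d : ℕ} (hd : 2 ≤ d) (x : Euc d) (c : ℝ) :
    ∫ y, Complex.exp (((c * inner ℝ x y : ℝ) : ℂ) * Complex.I) ∂(sphereMeasure d) = mm d hd (|c| * ‖x‖) := by
  have h1 : ∀ y : Euc d, Complex.exp (((c * inner ℝ x y : ℝ) : ℂ) * Complex.I) = ((Real.cos (inner ℝ (c • x) y) : ℝ) : ℂ) + ((Real.sin (inner ℝ (c • x) y) : ℝ) : ℂ) * Complex.I := by
    intro y
    rw [Complex.exp_mul_I, inner_smul_left]; simp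
  simp only [h1]
  rw [integral_add (cont_int_sphere hd (by fun_prop)) (cont_int_sphere hd (by fun_prop)), integral_mul_const, integral_complex_ofReal, integral_complex_ofReal, mm_inner hd, norm_smul, Real.norm_eq_abs]
  have : ∫ y, Real.sin (inner ℝ (c • x) y) ∂(sphereMeasure d) = 0 := by
    have h2 := integral_sphere_comp (LinearIsometryEquiv.neg ℝ) (fun y : Euc d => Real.sin (inner ℝ (c • x) y))
    simp only [LinearIsometryEquiv.coe_neg, inner_neg_right, Real.sin_neg, integral_neg] at h2
    linarith
  rw [this]; simp
end
end

section

open MeasureTheory Metric Set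
open scoped ENNReal NNReal FourierTransform

noncomputable section

open scoped SchwartzMap in
lemma plancherel {d : ℕ} {h : Euc d → ℂ} (h1 : Integrable h) (h2 : MemLp h 2) :
    ∫⁻ x, ‖𝓕 h x‖ₑ^2 = ∫⁻ x, ‖h x‖ₑ^2 := by
  have hcont : Continuous (𝓕 h) := by
    exact VectorFourier.fourierIntegral_continuous Real.continuous_fourierChar (by exact continuous_inner) h1
  set H : Lp (α := Euc d) ℂ 2 volume := h2.toLp h with hH
  have hae : ∀ᵐ x, (𝓕 H : Lp (α := Euc d) ℂ 2 volume) x = 𝓕 h x := by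
    apply ae_eq_of_integral_contDiff_smul_eq
    · exact (Lp.memLp _).locallyIntegrable (by norm_num)
    · exact hcont.locallyIntegrable
    · intro g hg1 hg2
      have hg2' : HasCompactSupport (fun x => (g x : ℂ)) := hg2.comp_left (g := fun x : ℝ => (x : ℂ)) rfl
      set G : 𝓢(Euc d, ℂ) := hg2'.toSchwartzMap (Complex.ofRealCLM.contDiff.comp hg1) with hG
      have hGx : ∀ x, G x = (g x : ℂ) := fun x => rfl
      have e1 := DFunLike.congr_fun (Lp.fourier_toTemperedDistribution_eq H) G
      rw [TemperedDistribution.fourier_apply, Lp.toTemperedDistribution_apply, Lp.toTemperedDistribution_apply] at e1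
      have e2 : ∫ x, (𝓕 G) x • H x = ∫ x, (𝓕 G) x • h x := by
        apply integral_congr_ae
        filter_upwards [h2.coeFn_toLp] with x hx
        rw [hH, hx]
      rw [e2] at e1
      have e3 : ∫ x, (𝓕 G) x • h x = ∫ x, G x • 𝓕 h x := by
        have := VectorFourier.integral_fourierIntegral_smul_eq_flip (L := innerₗ (Euc d)) (μ := volume) (ν := volume) (f := G) (g := h)
          Real.continuous_fourierChar (by exact continuous_inner) G.integrable h1
        rw [flip_innerₗ] at this
        exact this
      rw [e3] at e1
      simp only [hGx] at e1
      simpa using e1.symm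
  have e5 : eLpNorm (𝓕 h) 2 volume = eLpNorm h 2 volume := by
    rw [← eLpNorm_congr_ae (f := (𝓕 H : Lp (α := Euc d) ℂ 2 volume)) hae, ← eLpNorm_congr_ae h2.coeFn_toLp]
    have := Lp.norm_fourier_eq H
    rw [Lp.norm_def, Lp.norm_def, ENNReal.toReal_eq_toReal_iff' (Lp.eLpNorm_ne_top _) (Lp.eLpNorm_ne_top _)] at this
    exact this
  rw [eLpNorm_eq_lintegral_rpow_enorm_toReal (by norm_num) (by norm_num),
    eLpNorm_eq_lintegral_rpow_enorm_toReal (by norm_num) (by norm_num)] at e5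
  have := ENNReal.rpow_left_injective (x := 1 / (2:ℝ≥0∞).toReal) (by norm_num) e5
  simpa using this

lemma fourier_continuous {d : ℕ} {h : Euc d → ℂ} (h1 : Integrable h) : Continuous (𝓕 h) :=
  VectorFourier.fourierIntegral_continuous Real.continuous_fourierChar (by exact continuous_inner) h1

lemma fourierInv_continuous {d : ℕ} {h : Euc d → ℂ} (h1 : Integrable h) : Continuous (𝓕⁻ h) := by
  have : 𝓕⁻ h = fun x => 𝓕 h (-x) := by
    ext x; exact Real.fourierInv_eq_fourier_neg h x
  rw [this]
  exact (fourier_continuous h1).comp continuous_neg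

lemma plancherel_inv {d : ℕ} {h : Euc d → ℂ} (h1 : Integrable h) (h2 : MemLp h 2) :
    ∫⁻ x, ‖𝓕⁻ h x‖ₑ^2 = ∫⁻ x, ‖h x‖ₑ^2 := by
  rw [← plancherel h1 h2]
  simp only [Real.fourierInv_eq_fourier_neg]
  exact lintegral_neg_eq_self (fun x => ‖𝓕 h x‖ₑ^2)

lemma enorm_fourier_le {d : ℕ} (h : Euc d → ℂ) (x : Euc d) : ‖𝓕 h x‖ₑ ≤ ∫⁻ y, ‖h y‖ₑ := by
  rw [Real.fourier_eq]
  refine (enorm_integral_le_lintegral_enorm _).trans (le_of_eq ?_)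
  congr 1; ext y; rw [← ofReal_norm, ← ofReal_norm, Circle.norm_smul]

lemma enorm_fourierInv_le {d : ℕ} (h : Euc d → ℂ) (x : Euc d) : ‖𝓕⁻ h x‖ₑ ≤ ∫⁻ y, ‖h y‖ₑ := by
  rw [Real.fourierInv_eq_fourier_neg]; exact enorm_fourier_le _ _
end
end

section

open MeasureTheory Metric Set
open scoped ENNReal NNReal FourierTransform

noncomputable section

lemma lintegral_smul_comp {d : ℕ} (f : Euc d → ℝ≥0∞) {R : ℝ} (hR : 0 < R) :
    ∫⁻ x, f (R • x) = ENNReal.ofReal ((R^d)⁻¹) * ∫⁻ x, f x := by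
  have h1 := Measure.map_addHaar_smul (volume : Measure (Euc d)) hR.ne'
  have h2 := (Homeomorph.smulOfNeZero R hR.ne').measurableEmbedding.lintegral_map (μ := (volume : Measure (Euc d))) f
  simp only [Homeomorph.smulOfNeZero_apply] at h2
  rw [← h2]
  rw [h1, lintegral_smul_measure]
  have h3 : Module.finrank ℝ (Euc d) = d := by simp
  rw [h3, abs_of_pos (by positivity)]; rfl

lemma fourierInv_scale {d : ℕ} (g : Euc d → ℂ) {R : ℝ} (hR : 0 < R) (x : Euc d) :
    𝓕⁻ (fun ξ => g (R⁻¹ • ξ)) x = ((R^d : ℝ) : ℂ) * 𝓕⁻ g (R • x) := by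
  rw [Real.fourierInv_eq', Real.fourierInv_eq']
  have := Measure.integral_comp_inv_smul_of_nonneg (volume : Measure (Euc d)) (fun v => Complex.exp (↑(2 * Real.pi * inner ℝ v (R • x)) * Complex.I) • g v) hR.le
  have h3 : Module.finrank ℝ (Euc d) = d := by simp
  rw [h3] at this
  rw [← Complex.real_smul, ← this]
  congr 1; ext v
  rw [inner_smul_left, inner_smul_right]
  congr 5
  simp
  field_simp

/-- facts about inverse Fourier transforms of test functions -/
lemma test_fourierInv {d : ℕ} {G : Euc d → ℂ} (hG : ContDiff ℝ (⊤ : ℕ∞) G) (hc : HasCompactSupport G) :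
    (∀ N : ℕ, ∃ C : ℝ, 0 < C ∧ ∀ x, ‖𝓕⁻ G x‖ ≤ C * ((1+‖x‖)^N)⁻¹) ∧ Integrable (𝓕⁻ G) ∧ 𝓕 (𝓕⁻ G) = G := by
  have e1 : 𝓕⁻ G = ⇑(𝓕⁻ (hc.toSchwartzMap hG) : SchwartzMap (Euc d) ℂ) := by
    rw [SchwartzMap.fourierInv_coe]; rfl
  refine ⟨?_, ?_, ?_⟩
  · intro N
    rw [e1]
    set S : SchwartzMap (Euc d) ℂ := 𝓕⁻ (hc.toSchwartzMap hG)
    have := SchwartzMap.one_add_le_sup_seminorm_apply (𝕜 := ℝ) (m := (N, 0)) (k := N) (n := 0) le_rfl le_rfl S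
    simp only [norm_iteratedFDeriv_zero] at this
    refine ⟨_, add_pos_of_nonneg_of_pos (le_trans (by positivity) (this 0)) one_pos, fun x => ?_⟩
    rw [← div_eq_mul_inv, le_div_iff₀ (by positivity)]
    linarith [this x, mul_comm ‖S x‖ ((1+‖x‖)^N)]
  · rw [e1]; exact SchwartzMap.integrable _
  · rw [e1, ← SchwartzMap.fourier_coe, FourierTransform.fourier_fourierInv_eq]; rfl

/-- decaying weight -/
def wt (d : ℕ) (u : ℝ) : ℝ≥0∞ := ENNReal.ofReal (((1+u)^(d+1))⁻¹)

lemma wt_meas (d : ℕ) : Measurable (wt d) := by unfold wt; fun_prop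

lemma wt_anti (d : ℕ) {u v : ℝ} (hu : 0 ≤ u) (h : u ≤ v) : wt d v ≤ wt d u := by
  unfold wt; gcongr

lemma wt_le_one (d : ℕ) {u : ℝ} (hu : 0 ≤ u) : wt d u ≤ 1 := by
  unfold wt
  rw [ENNReal.ofReal_le_one]
  exact inv_le_one_of_one_le₀ (one_le_pow₀ (by linarith))

lemma wt_mul (d : ℕ) {u v c : ℝ} (hc : 0 < c) (hv : 0 ≤ v) (hu : 0 ≤ u) (h : 1 + u ≤ c * (1 + v)) :
    wt d v ≤ ENNReal.ofReal (c^(d+1)) * wt d u := by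
  unfold wt
  rw [← ENNReal.ofReal_mul (by positivity)]
  apply ENNReal.ofReal_le_ofReal
  rw [inv_le_comm₀ (by positivity) (by positivity), mul_inv, inv_inv, ← div_eq_inv_mul, div_le_iff₀ (by positivity), ← mul_pow]
  gcongr
  linarith

lemma wt_int (d : ℕ) : ∫⁻ x : Euc d, wt d ‖x‖ < ∞ := by
  have := finite_integral_one_add_norm (μ := (volume : Measure (Euc d))) (r := (d:ℝ)+1) (by simp)
  convert this using 4
  rw [Real.rpow_neg (by positivity)]
  norm_cast

lemma wt_int_scale {d : ℕ} {R : ℝ} (hR : 0 < R) (ξ : Euc d) :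
    ∫⁻ x : Euc d, wt d (R * ‖ξ - x‖) = ENNReal.ofReal ((R^d)⁻¹) * ∫⁻ x : Euc d, wt d ‖x‖ := by
  rw [lintegral_sub_left_eq_self (fun x => wt d (R * ‖x‖)), ← lintegral_smul_comp _ hR]
  congr 1; ext x; rw [norm_smul, Real.norm_of_nonneg hR.le]

/-- thin-annulus bound -/
lemma sphere_wt_bound {d : ℕ} (hd : 2 ≤ d) : ∃ C : ℝ≥0∞, C ≠ ∞ ∧ ∀ R : ℝ, 1 ≤ R → ∀ ξ : Euc d,
    ENNReal.ofReal (R^d) * ∫⁻ ω, wt d (R * ‖ξ - ω‖) ∂(sphereMeasure d) ≤ C * ENNReal.ofReal R := by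
  refine ⟨(cS d)⁻¹ * (ENNReal.ofReal (2^(d+1)) * ∫⁻ x : Euc d, wt d ‖x‖), ?_, ?_⟩
  · exact ENNReal.mul_ne_top (ENNReal.inv_ne_top.2 (cS_ne_zero hd)) (ENNReal.mul_ne_top ENNReal.ofReal_ne_top (wt_int d).ne)
  intro R hR ξ
  have hR0 : 0 < R := by linarith
  have h1 := wt_int_scale hR0 ξ
  have hmeas : Measurable fun x : Euc d => wt d (R * ‖ξ - x‖) := (wt_meas d).comp (by fun_prop)
  rw [lintegral_polar hd hmeas] at h1
  set J := ∫⁻ ω, wt d (R * ‖ξ - ω‖) ∂(sphereMeasure d) with hJ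
  have h2 : ENNReal.ofReal (1/R) * J ≤ ENNReal.ofReal (2^(d+1)) * ∫⁻ r in Ioi (0:ℝ), ENNReal.ofReal (r ^ (d - 1)) * ∫⁻ y, wt d (R * ‖ξ - r • y‖) ∂(sphereMeasure d) := by
    rw [← lintegral_const_mul' (ENNReal.ofReal (2^(d+1))) _ ENNReal.ofReal_ne_top]
    calc ENNReal.ofReal (1/R) * J = ∫⁻ r in Ioo (1:ℝ) (1+1/R), J := by
          rw [setLIntegral_const, Real.volume_Ioo, mul_comm]; congr 2; ring
      _ ≤ ∫⁻ r in Ioo (1:ℝ) (1+1/R), ENNReal.ofReal (2^(d+1)) * (ENNReal.ofReal (r ^ (d - 1)) * ∫⁻ y, wt d (R * ‖ξ - r • y‖) ∂(sphereMeasure d)) := by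
          apply setLIntegral_mono' measurableSet_Ioo
          intro r hr
          have : J ≤ ENNReal.ofReal (2^(d+1)) * ∫⁻ y, wt d (R * ‖ξ - r • y‖) ∂(sphereMeasure d) := by
            rw [hJ, ← lintegral_const_mul' _ _ ENNReal.ofReal_ne_top]
            apply lintegral_mono_ae
            filter_upwards [ae_sphere d] with y hy
            apply wt_mul d two_pos (by positivity) (by positivity)
            have h3 : ‖ξ - r • y‖ ≤ ‖ξ - y‖ + 1/R := by
              have e : ξ - r • y = (ξ - y) + (1 - r) • y := by module
              rw [e]
              refine (norm_add_le _ _).trans ?_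
              gcongr
              rw [norm_smul, hy, mul_one, Real.norm_eq_abs, abs_sub_comm, abs_of_pos (by linarith [hr.1])]
              linarith [hr.2]
            have h4 : R * ‖ξ - r • y‖ ≤ R * ‖ξ - y‖ + 1 := by
              calc _ ≤ R * (‖ξ - y‖ + 1/R) := by gcongr
                _ = _ := by field_simp
            have : 0 ≤ R * ‖ξ - y‖ := by positivity
            linarith
          refine this.trans ?_
          gcongr
          apply le_mul_of_one_le_left'
          rw [ENNReal.one_le_ofReal]
          exact one_le_pow₀ hr.1.le
      _ ≤ _ := by
          apply lintegral_mono_set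
          intro r hr
          exact lt_trans one_pos hr.1
  have hcS := ENNReal.inv_mul_cancel (cS_ne_zero hd) (cS_ne_top d)
  set I := ∫⁻ r in Ioi (0:ℝ), ENNReal.ofReal (r ^ (d - 1)) * ∫⁻ y, wt d (R * ‖ξ - r • y‖) ∂(sphereMeasure d)
  set W := ∫⁻ x : Euc d, wt d ‖x‖
  have h5 : I = (cS d)⁻¹ * (ENNReal.ofReal ((R^d)⁻¹) * W) := by
    rw [← h1, ← mul_assoc, hcS, one_mul]
  rw [h5] at h2
  have e1 : ENNReal.ofReal R * ENNReal.ofReal (1/R) = 1 := by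
    rw [← ENNReal.ofReal_mul hR0.le, mul_one_div_cancel hR0.ne', ENNReal.ofReal_one]
  have e2 : ENNReal.ofReal (R^d) * ENNReal.ofReal ((R^d)⁻¹) = 1 := by
    rw [← ENNReal.ofReal_mul (by positivity), mul_inv_cancel₀ (by positivity), ENNReal.ofReal_one]
  calc ENNReal.ofReal (R^d) * J = (ENNReal.ofReal (R^d) * ENNReal.ofReal R) * (ENNReal.ofReal (1/R) * J) := by
        rw [mul_assoc, ← mul_assoc (ENNReal.ofReal R), e1, one_mul]
    _ ≤ (ENNReal.ofReal (R^d) * ENNReal.ofReal R) * (ENNReal.ofReal (2^(d+1)) * ((cS d)⁻¹ * (ENNReal.ofReal ((R^d)⁻¹) * W))) := by gcongr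
    _ = (ENNReal.ofReal (R^d) * ENNReal.ofReal ((R^d)⁻¹)) * ((cS d)⁻¹ * (ENNReal.ofReal (2^(d+1)) * W) * ENNReal.ofReal R) := by ring
    _ = _ := by rw [e2, one_mul]
end
end

section

open MeasureTheory Metric Set
open scoped ENNReal NNReal FourierTransform ComplexConjugate

noncomputable section

lemma fourier_sq_fubini {d : ℕ} {Ω : Type*} [MeasurableSpace Ω] {μ : Measure Ω} [SFinite μ] {κ : Ω → ℂ}
    (hκ : Integrable κ μ) {η : Ω → Euc d} (hη : Measurable η) {h : Euc d → ℂ} (hh : Integrable h) :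
    ∫ u, κ u * (𝓕 h (η u) * conj (𝓕 h (η u))) ∂μ =
      ∫ p : Euc d × Euc d, (h p.1 * conj (h p.2)) *
        ∫ u, κ u * Complex.exp (↑(-2 * Real.pi * inner ℝ (p.1 - p.2) (η u)) * Complex.I) ∂μ := by
  have hconj : Integrable (fun y => conj (h y)) :=
    (LinearIsometryEquiv.integrable_comp_iff (Complex.conjLIE)).2 hh
  have hH : Integrable (fun p : Euc d × Euc d => h p.1 * conj (h p.2)) (volume.prod volume) := hh.mul_prod hconj
  have h1 : ∀ u, 𝓕 h (η u) * conj (𝓕 h (η u)) = ∫ p : Euc d × Euc d, (h p.1 * conj (h p.2)) * Complex.exp (↑(-2 * Real.pi * inner ℝ (p.1 - p.2) (η u)) * Complex.I) := by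
    intro u
    rw [Real.fourier_eq', ← integral_conj, ← integral_prod_mul]
    congr 1; ext p
    simp only [smul_eq_mul, map_mul, ← Complex.exp_conj, Complex.conj_ofReal, Complex.conj_I]
    rw [show ∀ a b c e : ℂ, (a * b) * (c * e) = (b * e) * (a * c) by intros; ring, ← Complex.exp_add, inner_sub_left]
    congr 2
    push_cast; ring
  simp only [h1, ← integral_const_mul]
  rw [integral_integral_swap]
  · congr 1; ext p
    congr 1; ext u; ring
  · have h2 := hκ.mul_prod hH
    have h3 := h2.mul_bdd (c := 1) (g := fun z : Ω × (Euc d × Euc d) => Complex.exp (↑(-2 * Real.pi * inner ℝ (z.2.1 - z.2.2) (η z.1)) * Complex.I)) (by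
      apply Measurable.aestronglyMeasurable
      have : Measurable fun z : Ω × (Euc d × Euc d) => inner ℝ (z.2.1 - z.2.2) (η z.1) :=
        Measurable.inner (by fun_prop) (by fun_prop)
      fun_prop) (Filter.Eventually.of_forall fun z => by rw [Complex.norm_exp_ofReal_mul_I])
    refine h3.congr (Filter.Eventually.of_forall fun z => ?_)
    simp only [Function.uncurry]
    ring

lemma mul_conj_enorm (z : ℂ) : ‖z * conj z‖ₑ = ‖z‖ₑ^2 := by
  rw [enorm_mul, pow_two]; congr 1
  rw [← ofReal_norm, ← ofReal_norm, RCLike.norm_conj]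

lemma lintegral_sq_le {α : Type*} [MeasurableSpace α] {μ : Measure α} {f : α → ℝ≥0∞} (hf : AEMeasurable f μ)
    {A : Set α} (hA : MeasurableSet A) (h0 : ∀ x, x ∉ A → f x = 0) :
    (∫⁻ x, f x ∂μ)^2 ≤ μ A * ∫⁻ x, f x ^2 ∂μ := by
  have e : ∫⁻ x, f x ∂μ = ∫⁻ x, (A.indicator 1 x) * f x ∂μ := by
    congr 1; ext x
    by_cases hx : x ∈ A
    · simp [hx]
    · simp [hx, h0 x hx]
  have := ENNReal.lintegral_mul_le_Lp_mul_Lq μ (Real.HolderConjugate.two_two) (f := A.indicator 1) (g := f) (measurable_one.indicator hA).aemeasurable hf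
  rw [e]
  calc _ ≤ _ := pow_le_pow_left' this 2
    _ = _ := by
      rw [mul_pow, ← ENNReal.rpow_natCast, ← ENNReal.rpow_natCast, ← ENNReal.rpow_mul, ← ENNReal.rpow_mul]
      norm_num
      congr 1
      rw [← lintegral_indicator_one hA]
      congr 1; ext x
      by_cases hx : x ∈ A <;> simp [hx]

/-- the Tomas exponent function -/
def ph (d : ℕ) (u : ℝ≥0∞) : ℝ≥0∞ := min u (u ^ (2 / ((d:ℝ)+1)))

lemma gauss_piece {d : ℕ} (hd : 2 ≤ d) : ∃ C : ℝ≥0∞, C ≠ ∞ ∧ ∀ R : ℝ, 1 ≤ R → ∀ κ : Euc d → ℂ, Measurable κ →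
   ∀ c : ℝ≥0∞, c ≠ ∞ → (∀ x, ‖κ x‖ₑ ≤ c * (ENNReal.ofReal (R^d) * wt d (R * ‖x‖))) → ∀ G : Euc d → ℂ, Measurable G →
    ‖∫ u, κ u.1 * (G (u.1 + u.2) * conj (G (u.1 + u.2))) ∂((volume : Measure (Euc d)).prod (sphereMeasure d))‖ₑ
      ≤ C * c * ENNReal.ofReal R * ∫⁻ η, ‖G η‖ₑ^2 := by
  obtain ⟨C, hC, hb⟩ := sphere_wt_bound hd
  have := sphereMeasure_prob hd
  refine ⟨C, hC, fun R hR κ hκ c hc hcκ G hG => ?_⟩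
  refine (enorm_integral_le_lintegral_enorm _).trans ?_
  have e0 : ∀ u : Euc d × Euc d, ‖κ u.1 * (G (u.1 + u.2) * conj (G (u.1 + u.2)))‖ₑ = ‖κ u.1‖ₑ * ‖G (u.1 + u.2)‖ₑ^2 :=
    fun u => by rw [enorm_mul, mul_conj_enorm]
  simp only [e0]
  rw [lintegral_prod_symm _ (by fun_prop)]
  have e1 : ∀ ω : Euc d, ∫⁻ ξ, ‖κ ξ‖ₑ * ‖G (ξ + ω)‖ₑ^2 = ∫⁻ η, ‖κ (η - ω)‖ₑ * ‖G η‖ₑ^2 := by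
    intro ω
    rw [← lintegral_sub_right_eq_self _ ω]; simp
  simp only [e1]
  rw [lintegral_lintegral_swap (by fun_prop)]
  calc ∫⁻ η, ∫⁻ ω, ‖κ (η - ω)‖ₑ * ‖G η‖ₑ^2 ∂(sphereMeasure d) ≤ ∫⁻ η, (C * c * ENNReal.ofReal R) * ‖G η‖ₑ^2 := by
        apply lintegral_mono
        intro η
        simp only
        rw [lintegral_mul_const _ (by fun_prop)]
        gcongr
        calc _ ≤ ∫⁻ ω, c * ENNReal.ofReal (R^d) * wt d (R * ‖η - ω‖) ∂(sphereMeasure d) := by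
              apply lintegral_mono; intro ω; simp only [mul_assoc]; exact hcκ _
          _ = c * (ENNReal.ofReal (R^d) * ∫⁻ ω, wt d (R * ‖η - ω‖) ∂(sphereMeasure d)) := by
              rw [lintegral_const_mul' _ _ (ENNReal.mul_ne_top hc ENNReal.ofReal_ne_top), mul_assoc]
          _ ≤ c * (C * ENNReal.ofReal R) := mul_le_mul' le_rfl (hb R hR η)
          _ = _ := by ring
    _ = _ := lintegral_const_mul _ (by fun_prop)

lemma tomas_R {d : ℕ} (hd : 2 ≤ d) : ∃ C : ℝ, 0 < C ∧ ∀ R : ℝ, 1 ≤ R → ∀ h : Euc d → ℂ,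
    Integrable h → MemLp h 2 →
    ∫⁻ ω, ‖𝓕 h ω‖ₑ^2 ∂(sphereMeasure d) ≤ ENNReal.ofReal (C * R) * (∫⁻ x, ‖h x‖ₑ^2)
      + ENNReal.ofReal (C * √((R^(d-1))⁻¹)) * (∫⁻ x, ‖h x‖ₑ)^2 := by
  have := sphereMeasure_prob hd
  obtain ⟨C1, hC1, hgp⟩ := gauss_piece hd
  obtain ⟨C2, hC2, hdec⟩ := mm_decay hd
  let ψ : ContDiffBump (0 : Euc d) := ⟨1, 2, one_pos, by norm_num⟩
  let ψc : Euc d → ℂ := fun x => (ψ x : ℂ)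
  have hψ : ContDiff ℝ (⊤ : ℕ∞) ψc := Complex.ofRealCLM.contDiff.comp ψ.contDiff
  have hψs : HasCompactSupport ψc := ψ.hasCompactSupport.comp_left (g := fun x : ℝ => (x : ℂ)) rfl
  obtain ⟨C3, hC3, hk⟩ := (test_fourierInv hψ hψs).1 (d+1)
  refine ⟨max (C1.toReal * C3) (√C2), lt_max_of_lt_right (Real.sqrt_pos.2 hC2), fun R hR h hh hh2 => ?_⟩
  set C := max (C1.toReal * C3) (√C2) with hCdef
  have hR0 : 0 < R := by linarith
  let ψR : Euc d → ℂ := fun ξ => ψc (R⁻¹ • ξ)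
  have hψR : ContDiff ℝ (⊤ : ℕ∞) ψR := hψ.comp (contDiff_const_smul _)
  have hψRs : HasCompactSupport ψR := hψs.comp_smul (inv_ne_zero hR0.ne')
  obtain ⟨-, hκi, hκF⟩ := test_fourierInv hψR hψRs
  set κ := 𝓕⁻ ψR with hκ
  have hκb : ∀ x, ‖κ x‖ₑ ≤ ENNReal.ofReal C3 * (ENNReal.ofReal (R^d) * wt d (R * ‖x‖)) := by
    intro x
    rw [hκ, show 𝓕⁻ ψR x = _ from fourierInv_scale ψc hR0 x, wt, ← ENNReal.ofReal_mul (by positivity), ← ENNReal.ofReal_mul (by positivity), ← ofReal_norm]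
    apply ENNReal.ofReal_le_ofReal
    rw [norm_mul, Complex.norm_real, Real.norm_of_nonneg (by positivity)]
    calc _ ≤ R^d * (C3 * ((1 + ‖R • x‖)^(d+1))⁻¹) := by gcongr; exact hk _
      _ = _ := by rw [norm_smul, Real.norm_of_nonneg hR0.le]; ring
  have hκc : Continuous κ := fourierInv_continuous (hψR.continuous.integrable_of_hasCompactSupport hψRs)
  have hFh := fourier_continuous hh
  have b2 := hgp R hR κ hκc.measurable (ENNReal.ofReal C3) ENNReal.ofReal_ne_top hκb (𝓕 h) hFh.measurable
  rw [plancherel hh hh2] at b2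
  have f1 := fourier_sq_fubini (μ := sphereMeasure d) (κ := fun _ => 1) (integrable_const _) (η := id) measurable_id hh
  have f2 := fourier_sq_fubini (μ := volume.prod (sphereMeasure d)) (κ := fun u => κ u.1) (by
    simpa using hκi.mul_prod (integrable_const (1:ℂ))) (η := fun u => u.1 + u.2) (by fun_prop) hh
  have i1 : ∀ z : Euc d, ∫ u, (1:ℂ) * Complex.exp (↑(-2 * Real.pi * inner ℝ z (id u)) * Complex.I) ∂(sphereMeasure d)
      = (mm d hd (2 * Real.pi * ‖z‖) : ℂ) := by
    intro z
    simp only [one_mul, id]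
    rw [sphere_fourier hd z (-2 * Real.pi), abs_mul, abs_neg, abs_two, abs_of_pos Real.pi_pos]
  have i2 : ∀ z : Euc d, ∫ u, κ u.1 * Complex.exp (↑(-2 * Real.pi * inner ℝ z (u.1 + u.2)) * Complex.I) ∂(volume.prod (sphereMeasure d))
      = ψR z * (mm d hd (2 * Real.pi * ‖z‖) : ℂ) := by
    intro z
    rw [← i1 z, ← hκF, Real.fourier_eq', ← integral_prod_mul]
    congr 1; ext u
    simp only [id, smul_eq_mul, one_mul]
    rw [inner_add_right, mul_add, Complex.ofReal_add, add_mul, Complex.exp_add, real_inner_comm]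
    ring
  simp only [i1] at f1
  simp only [i2] at f2
  have hconj : Integrable (fun y => conj (h y)) :=
    (LinearIsometryEquiv.integrable_comp_iff (Complex.conjLIE)).2 hh
  have hH : Integrable (fun p : Euc d × Euc d => h p.1 * conj (h p.2)) (volume.prod volume) := hh.mul_prod hconj
  have hmc : Continuous (mm d hd) := continuous_iff_continuousAt.2 fun r => (mm_deriv hd r).continuousAt
  have hψRc := hψR.continuous
  have g1 : Integrable (fun p : Euc d × Euc d => (h p.1 * conj (h p.2)) * (mm d hd (2 * Real.pi * ‖p.1-p.2‖) : ℂ)) (volume.prod volume) := by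
    refine hH.mul_bdd (c := 1) (Continuous.aestronglyMeasurable (by fun_prop)) (Filter.Eventually.of_forall fun p => ?_)
    rw [Complex.norm_real]; exact mm_le_one hd _
  have hψ1 : ∀ z, ‖ψR z‖ ≤ 1 := by
    intro z
    simp only [ψR, ψc]
    rw [Complex.norm_real, Real.norm_of_nonneg ψ.nonneg]; exact ψ.le_one
  have g2 : Integrable (fun p : Euc d × Euc d => (h p.1 * conj (h p.2)) * (ψR (p.1-p.2) * (mm d hd (2 * Real.pi * ‖p.1-p.2‖) : ℂ))) (volume.prod volume) := by
    refine hH.mul_bdd (c := 1) (Continuous.aestronglyMeasurable (by fun_prop)) (Filter.Eventually.of_forall fun p => ?_)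
    rw [norm_mul]; refine mul_le_one₀ (hψ1 _) (norm_nonneg _) ?_
    rw [Complex.norm_real]; exact mm_le_one hd _
  have hker : ∀ z : Euc d, ‖(mm d hd (2 * Real.pi * ‖z‖) : ℂ) - ψR z * (mm d hd (2 * Real.pi * ‖z‖) : ℂ)‖ ≤ √C2 * √((R^(d-1))⁻¹) := by
    intro z
    by_cases hz : ‖z‖ ≤ R
    · have : ψR z = 1 := by
        simp only [ψR, ψc]
        rw [ψ.one_of_mem_closedBall]; · simp
        simp only [mem_closedBall, dist_zero_right, norm_smul, norm_inv, Real.norm_of_nonneg hR0.le]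
        rw [inv_mul_le_iff₀ hR0]; simpa [ψ] using hz
      rw [this]; simp; positivity
    · push Not at hz
      rw [← one_sub_mul, norm_mul]
      have a1 : ‖1 - ψR z‖ ≤ 1 := by
        have : 1 - ψR z = ((1 - ψ (R⁻¹ • z) : ℝ) : ℂ) := by simp [ψR, ψc]
        rw [this, Complex.norm_real, Real.norm_of_nonneg (by linarith [ψ.le_one (x := R⁻¹ • z)])]
        linarith [ψ.nonneg' (R⁻¹ • z)]
      have a2 : ‖(mm d hd (2 * Real.pi * ‖z‖) : ℂ)‖ ≤ √C2 * √((R^(d-1))⁻¹) := by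
        rw [Complex.norm_real, ← Real.sqrt_mul hC2.le]
        apply Real.abs_le_sqrt
        rw [← div_eq_mul_inv, le_div_iff₀ (by positivity)]
        have := hdec (2 * Real.pi * ‖z‖) (by positivity)
        have h5 : R^(d-1) ≤ (2 * Real.pi * ‖z‖)^(d-1) := by
          gcongr
          nlinarith [Real.pi_gt_three]
        calc _ ≤ (mm d hd (2 * Real.pi * ‖z‖))^2 * (2 * Real.pi * ‖z‖)^(d-1) := by gcongr
          _ ≤ _ := by linarith
      calc _ ≤ 1 * (√C2 * √((R^(d-1))⁻¹)) := by gcongr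
        _ = _ := one_mul _
  have key : ∫ u, (1:ℂ) * (𝓕 h (id u) * conj (𝓕 h (id u))) ∂(sphereMeasure d) =
      (∫ u, κ u.1 * (𝓕 h (u.1 + u.2) * conj (𝓕 h (u.1 + u.2))) ∂((volume : Measure (Euc d)).prod (sphereMeasure d))) +
      ∫ p : Euc d × Euc d, (h p.1 * conj (h p.2)) * ((mm d hd (2 * Real.pi * ‖p.1-p.2‖) : ℂ) - ψR (p.1-p.2) * (mm d hd (2 * Real.pi * ‖p.1-p.2‖) : ℂ)) := by
    rw [f1, f2]
    simp only [mul_sub, Measure.volume_eq_prod (Euc d) (Euc d)]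
    rw [integral_sub g1 g2]; ring
  have lhs : ‖∫ u, (1:ℂ) * (𝓕 h (id u) * conj (𝓕 h (id u))) ∂(sphereMeasure d)‖ₑ = ∫⁻ ω, ‖𝓕 h ω‖ₑ^2 ∂(sphereMeasure d) := by
    have e : ∀ u, (1:ℂ) * (𝓕 h (id u) * conj (𝓕 h (id u))) = ((‖𝓕 h u‖^2 : ℝ) : ℂ) := by
      intro u; rw [one_mul, id, Complex.mul_conj, Complex.normSq_eq_norm_sq]
    simp only [e]
    rw [integral_complex_ofReal, ← ofReal_norm, Complex.norm_real, Real.norm_of_nonneg (integral_nonneg fun x => by positivity),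
      ofReal_integral_eq_lintegral_ofReal (cont_int_sphere hd (by fun_prop)) (Filter.Eventually.of_forall fun x => by positivity)]
    congr 1; ext x
    rw [ENNReal.ofReal_pow (norm_nonneg _), ofReal_norm]
  rw [← lhs, key]
  refine (enorm_add_le _ _).trans (add_le_add (b2.trans ?_) ?_)
  · gcongr
    conv_lhs => rw [← ENNReal.ofReal_toReal hC1, ← ENNReal.ofReal_mul (by positivity), ← ENNReal.ofReal_mul (by positivity)]
    apply ENNReal.ofReal_le_ofReal
    gcongr; exact le_max_left _ _
  · refine (enorm_integral_le_lintegral_enorm _).trans ?_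
    calc _ ≤ ∫⁻ p : Euc d × Euc d, ENNReal.ofReal (C * √((R^(d-1))⁻¹)) * (‖h p.1‖ₑ * ‖h p.2‖ₑ) := by
          apply lintegral_mono
          intro p
          simp only
          rw [enorm_mul, enorm_mul, mul_comm]
          have : ‖conj (h p.2)‖ₑ = ‖h p.2‖ₑ := by rw [← ofReal_norm, ← ofReal_norm, RCLike.norm_conj]
          rw [this]
          gcongr
          rw [← ofReal_norm]
          apply ENNReal.ofReal_le_ofReal
          refine (hker _).trans ?_
          gcongr; exact le_max_right _ _
      _ = _ := by
          rw [lintegral_const_mul' _ _ ENNReal.ofReal_ne_top]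
          congr 1
          rw [pow_two]
          exact lintegral_prod_mul hh.1.enorm hh.1.enorm
end
end

section

open MeasureTheory Metric Set
open scoped ENNReal NNReal FourierTransform ComplexConjugate

noncomputable section

lemma memLp_enorm_sq {d : ℕ} {h : Euc d → ℂ} (hh : MemLp h 2) : ∫⁻ x, ‖h x‖ₑ^2 < ∞ := by
  have := hh.2
  rw [eLpNorm_lt_top_iff_lintegral_rpow_enorm_lt_top (by norm_num) (by norm_num)] at this
  simpa using this

lemma tomas {d : ℕ} (hd : 2 ≤ d) : ∃ C : ℝ≥0∞, C ≠ ∞ ∧ ∀ A : Set (Euc d), MeasurableSet A → volume A ≠ ∞ →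
    ∀ h : Euc d → ℂ, MemLp h 2 → (∀ x, x ∉ A → h x = 0) →
    ∫⁻ ω, ‖𝓕 h ω‖ₑ^2 ∂(sphereMeasure d) ≤ C * ph d (volume A) * ∫⁻ x, ‖h x‖ₑ^2 := by
  have := sphereMeasure_prob hd
  obtain ⟨C, hC, ht⟩ := tomas_R hd
  refine ⟨ENNReal.ofReal (C + C) + 1, by finiteness, fun A hA hA2 h hh h0 => ?_⟩
  have hsq : (∫⁻ x, ‖h x‖ₑ)^2 ≤ volume A * ∫⁻ x, ‖h x‖ₑ^2 :=
    lintegral_sq_le hh.1.enorm hA (fun x hx => by simp [h0 x hx])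
  have hfin := memLp_enorm_sq hh
  have hint : Integrable h := by
    refine ⟨hh.1, ?_⟩
    have : (∫⁻ x, ‖h x‖ₑ)^2 < ∞ := lt_of_le_of_lt hsq (ENNReal.mul_lt_top hA2.lt_top hfin)
    exact (ENNReal.pow_lt_top_iff.1 this).resolve_right (by norm_num)
  have triv : ∫⁻ ω, ‖𝓕 h ω‖ₑ^2 ∂(sphereMeasure d) ≤ volume A * ∫⁻ x, ‖h x‖ₑ^2 := by
    refine le_trans ?_ hsq
    calc _ ≤ ∫⁻ ω, (∫⁻ x, ‖h x‖ₑ)^2 ∂(sphereMeasure d) := by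
          apply lintegral_mono; intro ω; simp only; gcongr; exact enorm_fourier_le h ω
      _ = _ := by simp
  have hmain : ∫⁻ ω, ‖𝓕 h ω‖ₑ^2 ∂(sphereMeasure d) ≤ (ENNReal.ofReal (C + C) + 1) * (volume A) ^ (2 / ((d:ℝ)+1)) * ∫⁻ x, ‖h x‖ₑ^2 := by
    by_cases hv : volume A ≤ 1
    · refine triv.trans ?_
      gcongr
      calc volume A = 1 * volume A ^ (1:ℝ) := by simp
        _ ≤ _ := by
          refine mul_le_mul' (by simp) (ENNReal.rpow_le_rpow_of_exponent_ge hv ?_)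
          rw [div_le_one (by positivity)]
          have : (2:ℝ) ≤ d := by exact_mod_cast hd
          linarith
    · push Not at hv
      set a := (volume A).toReal with ha
      have haA : volume A = ENNReal.ofReal a := (ENNReal.ofReal_toReal hA2).symm
      have ha1 : 1 < a := by
        rw [haA, ENNReal.one_lt_ofReal] at hv; exact hv
      have ha0 : 0 < a := by linarith
      set R := a ^ (2 / ((d:ℝ)+1)) with hRdef
      have hR : 1 ≤ R := Real.one_le_rpow ha1.le (by positivity)
      have hR0 : 0 < R := by linarith
      have h1 := ht R hR h hint hh
      have h2 : √((R^(d-1))⁻¹) * a = R := by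
        have : √((R^(d-1))⁻¹) = a ^ (-(((d:ℝ)-1)/((d:ℝ)+1))) := by
          rw [Real.sqrt_eq_rpow, ← Real.rpow_natCast R, ← Real.rpow_neg hR0.le, hRdef, ← Real.rpow_mul ha0.le, ← Real.rpow_mul ha0.le, Nat.cast_sub (by omega)]
          congr 1
          field_simp
          push_cast; ring
        rw [this, hRdef]
        nth_rewrite 2 [← Real.rpow_one a]
        rw [← Real.rpow_add ha0]
        congr 1
        field_simp
        ring
      refine h1.trans ?_
      calc _ ≤ ENNReal.ofReal (C * R) * (∫⁻ x, ‖h x‖ₑ^2) + ENNReal.ofReal (C * √((R^(d-1))⁻¹)) * (ENNReal.ofReal a * ∫⁻ x, ‖h x‖ₑ^2) := by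
            gcongr; rw [← haA]; exact hsq
        _ = ENNReal.ofReal ((C+C) * R) * ∫⁻ x, ‖h x‖ₑ^2 := by
            rw [← mul_assoc, ← ENNReal.ofReal_mul (by positivity), ← add_mul, ← ENNReal.ofReal_add (by positivity) (by positivity), mul_assoc C, h2]
            congr 2; ring
        _ ≤ _ := by
            gcongr
            rw [haA, ENNReal.ofReal_mul (by positivity), hRdef, ENNReal.ofReal_rpow_of_pos ha0]
            gcongr
            simp
  unfold ph
  rcases min_choice (volume A) (volume A ^ (2 / ((d:ℝ)+1))) with h3 | h3 <;> rw [h3]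
  · refine triv.trans ?_
    gcongr
    apply le_mul_of_one_le_left'
    simp
  · exact hmain

/-- extension operator -/
def extOp {d : ℕ} (φ : Euc d → ℂ) (x : Euc d) : ℂ :=
  ∫ ω, Complex.exp (↑(2 * Real.pi * inner ℝ x ω) * Complex.I) * φ ω ∂(sphereMeasure d)

lemma ext_continuous {d : ℕ} (hd : 2 ≤ d) {φ : Euc d → ℂ} (hφ : Continuous φ) : Continuous (extOp φ) := by
  unfold extOp
  refine continuous_of_dominated (bound := fun ω => ‖φ ω‖) ?_ ?_ ?_ ?_
  · intro x; exact Continuous.aestronglyMeasurable (by fun_prop)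
  · intro x; refine Filter.Eventually.of_forall fun ω => ?_
    rw [norm_mul, Complex.norm_exp_ofReal_mul_I, one_mul]
  · exact cont_int_sphere hd (by fun_prop)
  · refine Filter.Eventually.of_forall fun ω => by fun_prop

lemma ext_bound {d : ℕ} (φ : Euc d → ℂ) (x : Euc d) : ‖extOp φ x‖ ≤ ∫ ω, ‖φ ω‖ ∂(sphereMeasure d) := by
  unfold extOp
  refine (norm_integral_le_integral_norm _).trans (le_of_eq ?_)
  congr 1; ext ω; rw [norm_mul, Complex.norm_exp_ofReal_mul_I, one_mul]

lemma ext_local {d : ℕ} (hd : 2 ≤ d) : ∃ C : ℝ≥0∞, C ≠ ∞ ∧ ∀ A : Set (Euc d), MeasurableSet A → volume A ≠ ∞ →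
    ∀ φ : Euc d → ℂ, Continuous φ →
    ∫⁻ x in A, ‖extOp φ x‖ₑ^2 ≤ C * ph d (volume A) * ∫⁻ ω, ‖φ ω‖ₑ^2 ∂(sphereMeasure d) := by
  have := sphereMeasure_prob hd
  obtain ⟨C, hC, ht⟩ := tomas hd
  refine ⟨C, hC, fun A hA hA2 φ hφ => ?_⟩
  set h : Euc d → ℂ := A.indicator (extOp φ) with hh
  have hec := ext_continuous hd hφ
  set B := ∫ ω, ‖φ ω‖ ∂(sphereMeasure d)
  have hfinA : IsFiniteMeasure (volume.restrict A) := ⟨by simpa using hA2.lt_top⟩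
  have hp : ∀ p : ℝ≥0∞, MemLp h p := by
    intro p
    rw [hh, memLp_indicator_iff_restrict hA]
    exact MemLp.of_bound hec.aestronglyMeasurable B (Filter.Eventually.of_forall (ext_bound φ))
  have hi : Integrable h := memLp_one_iff_integrable.1 (hp 1)
  have e1 : ∫⁻ x in A, ‖extOp φ x‖ₑ^2 = ∫⁻ x, ‖h x‖ₑ^2 := by
    rw [← lintegral_indicator hA]
    congr 1; ext x
    by_cases hx : x ∈ A <;> simp [hh, hx]
  set S := ∫⁻ x, ‖h x‖ₑ^2 with hS
  have hSf : S < ∞ := memLp_enorm_sq (hp 2)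
  have hconj : Integrable (fun y => conj (h y)) :=
    (LinearIsometryEquiv.integrable_comp_iff (Complex.conjLIE)).2 hi
  have dual : ∫ x, conj (h x) * h x = ∫ ω, conj (𝓕 h ω) * φ ω ∂(sphereMeasure d) := by
    have l1 : ∀ x, conj (h x) * h x = ∫ ω, conj (h x) * (Complex.exp (↑(2 * Real.pi * inner ℝ x ω) * Complex.I) * φ ω) ∂(sphereMeasure d) := by
      intro x
      rw [integral_const_mul]
      change _ = _ * extOp φ x
      by_cases hx : x ∈ A <;> simp [hh, hx]
    have l2 : ∀ ω, conj (𝓕 h ω) * φ ω = ∫ x, conj (h x) * (Complex.exp (↑(2 * Real.pi * inner ℝ x ω) * Complex.I) * φ ω) := by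
      intro ω
      rw [Real.fourier_eq', ← integral_conj, ← integral_mul_const]
      congr 1; ext x
      simp only [smul_eq_mul, map_mul, ← Complex.exp_conj, Complex.conj_ofReal, Complex.conj_I]
      rw [mul_comm (Complex.exp _), mul_assoc]
      congr 3
      push_cast; ring
    simp only [l1, l2]
    rw [integral_integral_swap]
    have h2 := hconj.mul_prod (cont_int_sphere hd hφ)
    have h3 := h2.mul_bdd (c := 1) (g := fun z : Euc d × (Euc d) => Complex.exp (↑(2 * Real.pi * inner ℝ z.1 z.2) * Complex.I)) (by
      exact Continuous.aestronglyMeasurable (by fun_prop)) (Filter.Eventually.of_forall fun z => by rw [Complex.norm_exp_ofReal_mul_I])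
    refine h3.congr (Filter.Eventually.of_forall fun z => ?_)
    simp only [Function.uncurry]
    ring
  have lhs : ‖∫ x, conj (h x) * h x‖ₑ = S := by
    have e : ∀ u, conj (h u) * h u = ((‖h u‖^2 : ℝ) : ℂ) := by
      intro u; rw [mul_comm, Complex.mul_conj, Complex.normSq_eq_norm_sq]
    simp only [e]
    rw [integral_complex_ofReal, ← ofReal_norm, Complex.norm_real, Real.norm_of_nonneg (integral_nonneg fun x => by positivity),
      ofReal_integral_eq_lintegral_ofReal ((hp 2).integrable_norm_pow (by norm_num)) (Filter.Eventually.of_forall fun x => by positivity)]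
    rw [hS]
    congr 1; ext x
    rw [ENNReal.ofReal_pow (norm_nonneg _), ofReal_norm]
  have hFc := fourier_continuous hi
  have rhs : S ^ 2 ≤ (∫⁻ ω, ‖𝓕 h ω‖ₑ^2 ∂(sphereMeasure d)) * ∫⁻ ω, ‖φ ω‖ₑ^2 ∂(sphereMeasure d) := by
    rw [← lhs, dual]
    have h1 : ‖∫ ω, conj (𝓕 h ω) * φ ω ∂(sphereMeasure d)‖ₑ ≤ ∫⁻ ω, ‖𝓕 h ω‖ₑ * ‖φ ω‖ₑ ∂(sphereMeasure d) := by
      refine (enorm_integral_le_lintegral_enorm _).trans (le_of_eq ?_)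
      congr 1; ext ω
      rw [enorm_mul, ← ofReal_norm (conj _), ← ofReal_norm (𝓕 h ω), RCLike.norm_conj]
    have h2 := ENNReal.lintegral_mul_le_Lp_mul_Lq (sphereMeasure d) (Real.HolderConjugate.two_two) (f := fun ω => ‖𝓕 h ω‖ₑ) (g := fun ω => ‖φ ω‖ₑ) (by fun_prop) (by fun_prop)
    calc _ ≤ _ := pow_le_pow_left' (h1.trans h2) 2
      _ = _ := by
        rw [mul_pow, ← ENNReal.rpow_natCast, ← ENNReal.rpow_natCast, ← ENNReal.rpow_mul, ← ENNReal.rpow_mul]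
        norm_num
  have rhs2 : S * S ≤ S * (C * ph d (volume A) * ∫⁻ ω, ‖φ ω‖ₑ^2 ∂(sphereMeasure d)) := by
    rw [← pow_two]
    refine rhs.trans ?_
    calc _ ≤ (C * ph d (volume A) * S) * ∫⁻ ω, ‖φ ω‖ₑ^2 ∂(sphereMeasure d) := by
          gcongr; exact ht A hA hA2 h (hp 2) (fun x hx => by simp [hh, hx])
      _ = _ := by ring
  rw [e1]
  by_cases hS0 : S = 0
  · rw [hS0]; exact zero_le
  · exact (ENNReal.mul_le_mul_iff_right hS0 hSf.ne).1 rhs2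

lemma ext_local_scaled {d : ℕ} (hd : 2 ≤ d) : ∃ C : ℝ≥0∞, C ≠ ∞ ∧ ∀ A : Set (Euc d), MeasurableSet A → volume A ≠ ∞ →
    ∀ φ : Euc d → ℂ, Continuous φ → ∀ ρ : ℝ, 0 < ρ →
    ∫⁻ x in A, ‖extOp φ (ρ • x)‖ₑ^2 ≤ C * ENNReal.ofReal ((ρ^d)⁻¹) * ph d (ENNReal.ofReal (ρ^d) * volume A) * ∫⁻ ω, ‖φ ω‖ₑ^2 ∂(sphereMeasure d) := by
  obtain ⟨C, hC, ht⟩ := ext_local hd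
  refine ⟨C, hC, fun A hA hA2 φ hφ ρ hρ => ?_⟩
  set T : Set (Euc d) := (fun x => ρ⁻¹ • x) ⁻¹' A
  have hT : MeasurableSet T := (measurable_const_smul _) hA
  have hvT : volume T = ENNReal.ofReal (ρ^d) * volume A := by
    rw [Measure.addHaar_preimage_smul _ (inv_ne_zero hρ.ne')]
    rw [inv_pow, inv_inv, abs_of_pos (by positivity)]; simp
  have h1 : ∫⁻ x in A, ‖extOp φ (ρ • x)‖ₑ^2 = ENNReal.ofReal ((ρ^d)⁻¹) * ∫⁻ x in T, ‖extOp φ x‖ₑ^2 := by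
    rw [← lintegral_indicator hA, ← lintegral_indicator hT, ← lintegral_smul_comp _ hρ]
    congr 1; ext x
    have : (ρ • x ∈ T) ↔ x ∈ A := by
      simp only [T, mem_preimage, smul_smul, inv_mul_cancel₀ hρ.ne', one_smul]
    by_cases hx : x ∈ A
    · simp [indicator, hx, this]
    · simp [indicator, hx, this]
  rw [h1, ← hvT]
  calc _ ≤ ENNReal.ofReal ((ρ^d)⁻¹) * (C * ph d (volume T) * ∫⁻ ω, ‖φ ω‖ₑ^2 ∂(sphereMeasure d)) := by
        gcongr; exact ht T hT (by rw [hvT]; exact ENNReal.mul_ne_top ENNReal.ofReal_ne_top hA2) φ hφ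
    _ = _ := by ring
end
end

section

open MeasureTheory Metric Set
open scoped ENNReal NNReal FourierTransform

noncomputable section

lemma ph_mono (d : ℕ) {u v : ℝ≥0∞} (h : u ≤ v) : ph d u ≤ ph d v := by
  unfold ph
  exact min_le_min h (ENNReal.rpow_le_rpow h (by positivity))

/-- radialised symbol -/
def wrad {d : ℕ} (W : Euc d → ℂ) (x : Euc d) (ρ : ℝ) : ℂ := extOp (fun ω => W (ρ • ω)) (ρ • x)

/-- radial extension of `wrad` -/
def wfun {d : ℕ} (W : Euc d → ℂ) (x : Euc d) : Euc d → ℂ := fun ξ => wrad W x ‖ξ‖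

lemma wrad_cont {d : ℕ} (hd : 2 ≤ d) {W : Euc d → ℂ} (hW : Continuous W) {M : ℝ} (hM : ∀ ξ, ‖W ξ‖ ≤ M) :
    Continuous (fun z : Euc d × ℝ => wrad W z.1 z.2) := by
  have := sphereMeasure_prob hd
  unfold wrad extOp
  refine continuous_of_dominated (bound := fun ω => M) ?_ ?_ ?_ ?_
  · intro x; exact Continuous.aestronglyMeasurable (by fun_prop)
  · intro x; refine Filter.Eventually.of_forall fun ω => ?_
    rw [norm_mul, Complex.norm_exp_ofReal_mul_I, one_mul]; exact hM _
  · exact integrable_const _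
  · refine Filter.Eventually.of_forall fun ω => by fun_prop

lemma cont_supp_bdd {d : ℕ} {W : Euc d → ℂ} {b : ℝ} (hb : ∀ ξ, W ξ ≠ 0 → ‖ξ‖ ≤ b) :
    HasCompactSupport W := by
  refine HasCompactSupport.intro (isCompact_closedBall 0 b) (fun x hx => ?_)
  by_contra h
  exact hx (by simpa using hb x h)

lemma wrad_supp {d : ℕ} (hd : 2 ≤ d) {W : Euc d → ℂ} {a b : ℝ} (hb : ∀ ξ, W ξ ≠ 0 → a ≤ ‖ξ‖ ∧ ‖ξ‖ ≤ b) (x : Euc d) {ρ : ℝ} (hρ : 0 ≤ ρ)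
    (h : ¬ (a ≤ ρ ∧ ρ ≤ b)) : wrad W x ρ = 0 := by
  unfold wrad extOp
  rw [integral_eq_zero_of_ae]
  filter_upwards [ae_sphere d] with ω hω
  have : W (ρ • ω) = 0 := by
    by_contra h2
    apply h
    have := hb _ h2
    rw [norm_smul, Real.norm_of_nonneg hρ] at this
    simpa [hω] using this
  simp [this]

lemma wfun_cs {d : ℕ} (hd : 2 ≤ d) {W : Euc d → ℂ} {a b : ℝ} (hb : ∀ ξ, W ξ ≠ 0 → a ≤ ‖ξ‖ ∧ ‖ξ‖ ≤ b) (x : Euc d) :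
    HasCompactSupport (wfun W x) := by
  refine cont_supp_bdd (b := b) (fun ξ h => ?_)
  by_contra h2
  apply h
  have := wrad_supp hd hb x (ρ := ‖ξ‖) (norm_nonneg ξ) (fun h3 => h2 h3.2)
  rw [wfun, this]

lemma wfun_cont {d : ℕ} (hd : 2 ≤ d) {W : Euc d → ℂ} (hW : Continuous W) {M : ℝ} (hM : ∀ ξ, ‖W ξ‖ ≤ M) (x : Euc d) :
    Continuous (wfun W x) := by
  have h1 := wrad_cont hd hW hM
  have h2 : Continuous fun ξ : Euc d => (x, ‖ξ‖) := by fun_prop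
  have h3 := h1.comp h2
  have h4 : wfun W x = (fun z : Euc d × ℝ => wrad W z.1 z.2) ∘ (fun ξ : Euc d => (x, ‖ξ‖)) := by
    funext ξ; simp only [wfun, Function.comp]
  rw [h4]; exact h3

lemma wfun_smul {d : ℕ} (W : Euc d → ℂ) (x : Euc d) {ω : Euc d} (hω : ‖ω‖ = 1) {τ : ℝ} (hτ : 0 < τ) : wfun W x (τ • ω) = wrad W x τ := by
  rw [wfun, norm_smul, hω, Real.norm_of_nonneg hτ.le, mul_one]

lemma norm_exp_I (x : ℝ) : ‖Complex.exp ((x:ℂ) * Complex.I)‖ = 1 := Complex.norm_exp_ofReal_mul_I x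

lemma sphAvg_eq {d : ℕ} (hd : 2 ≤ d) {W : Euc d → ℂ} (hW : Continuous W) {a b : ℝ} (hb : ∀ ξ, W ξ ≠ 0 → a ≤ ‖ξ‖ ∧ ‖ξ‖ ≤ b)
    (x : Euc d) (τ : ℝ) (y : Euc d) (hy : ‖y‖ = |τ|) : sphAvg (𝓕⁻ W) τ x = 𝓕⁻ (wfun W x) y := by
  have := sphereMeasure_prob hd
  have hcs : HasCompactSupport W := cont_supp_bdd (fun ξ h => (hb ξ h).2)
  have hWi : Integrable W := hW.integrable_of_hasCompactSupport hcs
  obtain ⟨M, hM⟩ := hW.bounded_above_of_compact_support hcs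
  have hwc := wrad_cont hd hW hM
  have hwc' : Continuous (wfun W x) := wfun_cont hd hW hM x
  have hwcs : HasCompactSupport (wfun W x) := wfun_cs hd hb x
  have hwi : Integrable (wfun W x) := hwc'.integrable_of_hasCompactSupport hwcs
  have sw : sphAvg (𝓕⁻ W) τ x = ∫ ξ, Complex.exp (↑(2 * Real.pi * inner ℝ x ξ) * Complex.I) * W ξ * (mm d hd (2 * Real.pi * |τ| * ‖ξ‖) : ℂ) := by
    unfold sphAvg
    simp only [Real.fourierInv_eq']
    rw [integral_integral_swap]
    · congr 1; ext ξ
      have h1 := sphere_fourier hd ξ (-(2 * Real.pi * τ))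
      rw [show |-(2*Real.pi*τ)| = 2 * Real.pi * |τ| by rw [abs_neg, abs_mul, abs_of_pos (by positivity)]] at h1
      rw [← h1, ← integral_const_mul]
      congr 1; ext ω
      simp only [smul_eq_mul]
      rw [mul_right_comm (Complex.exp _), ← Complex.exp_add]
      congr 2
      rw [inner_sub_right, inner_smul_right, real_inner_comm ξ x]
      push_cast; ring
    · have h2 : Integrable (fun z : Euc d × Euc d => (1:ℂ) * W z.2) ((sphereMeasure d).prod volume) := 
        (integrable_const (1:ℂ)).mul_prod hWi
      have h3 := h2.mul_bdd (c := 1) (g := fun z : Euc d × (Euc d) => Complex.exp (↑(2 * Real.pi * inner ℝ z.2 (x - τ • z.1)) * Complex.I)) (by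
        exact Continuous.aestronglyMeasurable (by fun_prop)) (Filter.Eventually.of_forall fun z => by rw [Complex.norm_exp_ofReal_mul_I])
      refine h3.congr (Filter.Eventually.of_forall fun z => ?_)
      simp only [Function.uncurry, smul_eq_mul]
      ring
  have mmc : Continuous (fun ξ : Euc d => (mm d hd (2 * Real.pi * |τ| * ‖ξ‖) : ℂ)) := by
    have : Continuous (mm d hd) := by
      refine Differentiable.continuous (𝕜 := ℝ) fun r => (mm_deriv hd r).differentiableAt
    fun_prop
  have hmb : ∀ r, ‖(mm d hd r : ℂ)‖ ≤ 1 := fun r => by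
    rw [Complex.norm_real]; exact mm_le_one hd r
  have i1 : Integrable (fun ξ => Complex.exp (↑(2 * Real.pi * inner ℝ x ξ) * Complex.I) * W ξ * (mm d hd (2 * Real.pi * |τ| * ‖ξ‖) : ℂ)) := by
    refine (hWi.norm).mono' (Continuous.aestronglyMeasurable (by fun_prop)) (Filter.Eventually.of_forall fun ξ => ?_)
    rw [norm_mul, norm_mul, norm_exp_I, one_mul]
    exact mul_le_of_le_one_right (norm_nonneg _) (hmb _)
  have i2 : Integrable (fun ξ => Complex.exp (↑(2 * Real.pi * inner ℝ ξ y) * Complex.I) • wfun W x ξ) := by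
    refine (hwi.norm).mono' (Continuous.aestronglyMeasurable (by fun_prop)) (Filter.Eventually.of_forall fun ξ => ?_)
    rw [norm_smul, norm_exp_I, one_mul]
  rw [sw, Real.fourierInv_eq', integral_polar hd i1, integral_polar hd i2]
  congr 1
  refine setIntegral_congr_fun measurableSet_Ioi (fun ρ hρ => ?_)
  have hρ0 : (0:ℝ) < ρ := hρ
  congr 1
  calc _ = ∫ ω, Complex.exp (↑(2 * Real.pi * inner ℝ (ρ • x) ω) * Complex.I) * W (ρ • ω) * (mm d hd (2 * Real.pi * |τ| * ρ) : ℂ) ∂(sphereMeasure d) := by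
        refine integral_congr_ae ?_
        filter_upwards [ae_sphere d] with ω hω
        rw [norm_smul, hω, Real.norm_of_nonneg hρ0.le, mul_one, inner_smul_left, inner_smul_right]
        simp
    _ = wrad W x ρ * (mm d hd (2 * Real.pi * |τ| * ρ) : ℂ) := by
        rw [integral_mul_const]; rfl
    _ = ∫ ω, Complex.exp (↑((2 * Real.pi * ρ) * inner ℝ y ω) * Complex.I) * wrad W x ρ ∂(sphereMeasure d) := by
        rw [integral_mul_const, sphere_fourier hd y, hy, mul_comm (wrad W x ρ), abs_of_pos (show 0 < 2 * Real.pi * ρ by positivity)]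
        congr 3; ring
    _ = _ := by
        refine integral_congr_ae ?_
        filter_upwards [ae_sphere d] with ω hω
        rw [wfun_smul W x hω hρ0, inner_smul_left, real_inner_comm, smul_eq_mul]
        simp [mul_assoc]

lemma star {d : ℕ} (hd : 2 ≤ d) : ∃ C : ℝ≥0∞, C ≠ ∞ ∧ ∀ A : Set (Euc d), MeasurableSet A → volume A ≠ ∞ →
    ∀ W : Euc d → ℂ, Continuous W → ∀ a b : ℝ, 0 < a → (∀ ξ, W ξ ≠ 0 → a ≤ ‖ξ‖ ∧ ‖ξ‖ ≤ b) →
    ∫⁻ x in A, ∫⁻ τ in Ioi (0:ℝ), ENNReal.ofReal (τ^(d-1)) * ‖sphAvg (𝓕⁻ W) τ x‖ₑ^2 ≤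
      C * ENNReal.ofReal ((a^d)⁻¹) * ph d (ENNReal.ofReal (b^d) * volume A) * ∫⁻ ξ, ‖W ξ‖ₑ^2 := by
  have := sphereMeasure_prob hd
  obtain ⟨C, hC, ht⟩ := ext_local_scaled hd
  refine ⟨C * (cS d)⁻¹, ENNReal.mul_ne_top hC (ENNReal.inv_ne_top.2 (cS_ne_zero hd)), fun A hA hA2 W hW a b ha hb => ?_⟩
  have hcs : HasCompactSupport W := cont_supp_bdd (fun ξ h => (hb ξ h).2)
  have hWi : Integrable W := hW.integrable_of_hasCompactSupport hcs
  obtain ⟨M, hM⟩ := hW.bounded_above_of_compact_support hcs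
  have hwc := wrad_cont hd hW hM
  have key : ∀ x, ∫⁻ τ in Ioi (0:ℝ), ENNReal.ofReal (τ^(d-1)) * ‖sphAvg (𝓕⁻ W) τ x‖ₑ^2 = ∫⁻ ρ in Ioi (0:ℝ), ENNReal.ofReal (ρ^(d-1)) * ‖wrad W x ρ‖ₑ^2 := by
    intro x
    have hwc' : Continuous (wfun W x) := wfun_cont hd hW hM x
    have hwcs : HasCompactSupport (wfun W x) := wfun_cs hd hb x
    have hwi : Integrable (wfun W x) := hwc'.integrable_of_hasCompactSupport hwcs
    have hp := plancherel_inv hwi (hwc'.memLp_of_hasCompactSupport hwcs)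
    have hfc := fourierInv_continuous hwi
    rw [lintegral_polar hd (by fun_prop), lintegral_polar hd (by fun_prop)] at hp
    have hp2 := (ENNReal.mul_right_inj (cS_ne_zero hd) (cS_ne_top d)).1 hp
    have c1 : ∫⁻ τ in Ioi (0:ℝ), ENNReal.ofReal (τ^(d-1)) * ‖sphAvg (𝓕⁻ W) τ x‖ₑ^2 = ∫⁻ (r : ℝ) in Ioi 0, ENNReal.ofReal (r ^ (d - 1)) * ∫⁻ (y : Euc d), ‖𝓕⁻ (wfun W x) (r • y)‖ₑ ^ 2 ∂sphereMeasure d := by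
      refine setLIntegral_congr_fun measurableSet_Ioi (fun τ hτ => ?_)
      congr 1
      calc _ = ∫⁻ y, ‖sphAvg (𝓕⁻ W) τ x‖ₑ^2 ∂sphereMeasure d := by simp
        _ = _ := by
          refine lintegral_congr_ae ?_
          filter_upwards [ae_sphere d] with ω hω
          rw [sphAvg_eq hd hW hb x τ (τ • ω) (by rw [norm_smul, hω]; simp)]
    rw [c1, hp2]
    refine setLIntegral_congr_fun measurableSet_Ioi (fun τ hτ => ?_)
    congr 1
    calc _ = ∫⁻ y, ‖wrad W x τ‖ₑ^2 ∂sphereMeasure d := by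
          refine lintegral_congr_ae ?_
          filter_upwards [ae_sphere d] with ω hω
          rw [wfun_smul W x hω hτ]
      _ = _ := by simp
  simp only [key]
  have hm : Measurable (fun z : Euc d × ℝ => ENNReal.ofReal (z.2^(d-1)) * ‖wrad W z.1 z.2‖ₑ^2) := by
    have := hwc.measurable
    fun_prop
  rw [lintegral_lintegral_swap hm.aemeasurable]
  have hWp : ∫⁻ ξ, ‖W ξ‖ₑ^2 = _ := lintegral_polar hd (f := fun ξ => ‖W ξ‖ₑ^2) (by fun_prop)
  have hm2 : Measurable fun ρ : ℝ => ∫⁻ y, ‖W (ρ • y)‖ₑ^2 ∂sphereMeasure d := by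
    have : Measurable fun z : ℝ × Euc d => ‖W (z.1 • z.2)‖ₑ^2 := by
      refine Continuous.measurable ?_
      fun_prop
    exact this.lintegral_prod_right'
  have pt : ∀ ρ ∈ Ioi (0:ℝ), ∫⁻ x in A, ENNReal.ofReal (ρ^(d-1)) * ‖wrad W x ρ‖ₑ^2 ≤
      (C * ENNReal.ofReal ((a^d)⁻¹) * ph d (ENNReal.ofReal (b^d) * volume A)) * (ENNReal.ofReal (ρ^(d-1)) * ∫⁻ y, ‖W (ρ • y)‖ₑ^2 ∂sphereMeasure d) := by
    intro ρ hρ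
    have hρ0 : 0 < ρ := hρ
    by_cases h : a ≤ ρ ∧ ρ ≤ b
    · rw [lintegral_const_mul' _ _ ENNReal.ofReal_ne_top]
      calc _ ≤ ENNReal.ofReal (ρ^(d-1)) * (C * ENNReal.ofReal ((ρ^d)⁻¹) * ph d (ENNReal.ofReal (ρ^d) * volume A) * ∫⁻ ω, ‖W (ρ • ω)‖ₑ^2 ∂(sphereMeasure d)) :=
            mul_le_mul' le_rfl (ht A hA hA2 (fun ω => W (ρ • ω)) (by fun_prop) ρ hρ0)
        _ ≤ ENNReal.ofReal (ρ^(d-1)) * (C * ENNReal.ofReal ((a^d)⁻¹) * ph d (ENNReal.ofReal (b^d) * volume A) * ∫⁻ ω, ‖W (ρ • ω)‖ₑ^2 ∂(sphereMeasure d)) := by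
            refine mul_le_mul' le_rfl (mul_le_mul' (mul_le_mul' (mul_le_mul' le_rfl ?_) (ph_mono d (mul_le_mul' ?_ le_rfl))) le_rfl)
            · apply ENNReal.ofReal_le_ofReal
              exact inv_anti₀ (by positivity) (pow_le_pow_left₀ ha.le h.1 d)
            · exact ENNReal.ofReal_le_ofReal (pow_le_pow_left₀ hρ0.le h.2 d)
        _ = _ := by ring
    · simp [wrad_supp hd hb _ hρ0.le h]
  refine (setLIntegral_mono (by fun_prop) pt).trans (le_of_eq ?_)
  rw [lintegral_const_mul _ (by fun_prop), hWp]
  rw [show ∀ x y z w u : ℝ≥0∞, x * u * y * z * ((cS d) * w) = (cS d * u) * (x * y * z * w) by intros; ring,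
    ENNReal.mul_inv_cancel (cS_ne_zero hd) (cS_ne_top d), one_mul]
end
end

section

open MeasureTheory Metric Set
open scoped ENNReal NNReal FourierTransform

noncomputable section

/-- multiplier operator with dilated symbol -/
def symT {d : ℕ} (G : Euc d → ℂ) (R : ℝ) (f : Euc d → ℂ) : Euc d → ℂ := 𝓕⁻ (fun ξ => G (R⁻¹ • ξ) * 𝓕 f ξ)

section
variable {d : ℕ} {G : Euc d → ℂ} {R : ℝ} {f : Euc d → ℂ}

lemma dil_cs (hc : HasCompactSupport G) (hR : 0 < R) : HasCompactSupport (fun ξ => G (R⁻¹ • ξ)) :=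
  hc.comp_smul (inv_ne_zero hR.ne')

lemma sym_cs (hc : HasCompactSupport G) (hR : 0 < R) (f : Euc d → ℂ) : HasCompactSupport (fun ξ => G (R⁻¹ • ξ) * 𝓕 f ξ) :=
  (dil_cs hc hR).mul_right

lemma sym_cont (hG : Continuous G) (hf : Integrable f) : Continuous (fun ξ => G (R⁻¹ • ξ) * 𝓕 f ξ) := by
  have := fourier_continuous hf
  fun_prop

lemma symT_continuous (hG : Continuous G) (hc : HasCompactSupport G) (hR : 0 < R) (hf : Integrable f) : Continuous (symT G R f) :=
  fourierInv_continuous ((sym_cont hG hf).integrable_of_hasCompactSupport (sym_cs hc hR f))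

lemma symT_eq (hG : Continuous G) (hc : HasCompactSupport G) (hR : 0 < R) (hf : Integrable f) (x : Euc d) :
    symT G R f x = ∫ y, 𝓕⁻ (fun ξ => G (R⁻¹ • ξ)) (x - y) * f y := by
  have hGi : Integrable (fun ξ => G (R⁻¹ • ξ)) := (by fun_prop : Continuous (fun ξ => G (R⁻¹ • ξ))).integrable_of_hasCompactSupport (dil_cs hc hR)
  unfold symT
  rw [Real.fourierInv_eq']
  simp only [Real.fourier_eq', Real.fourierInv_eq', ← integral_mul_const, smul_eq_mul]
  simp only [← integral_const_mul]
  rw [integral_integral_swap]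
  · congr 1; ext y; congr 1; ext ξ
    have : Complex.exp (↑(2 * Real.pi * inner ℝ ξ (x - y)) * Complex.I) = Complex.exp (↑(2 * Real.pi * inner ℝ ξ x) * Complex.I) * Complex.exp (↑(-2 * Real.pi * inner ℝ y ξ) * Complex.I) := by
      rw [← Complex.exp_add]; congr 1
      rw [inner_sub_right, real_inner_comm ξ y]; push_cast; ring
    rw [this]; ring
  · have h2 := hGi.mul_prod hf
    have h3 := h2.mul_bdd (c := 1) (g := fun z : Euc d × (Euc d) => Complex.exp (↑(2 * Real.pi * inner ℝ z.1 x) * Complex.I) * Complex.exp (↑(-2 * Real.pi * inner ℝ z.2 z.1) * Complex.I)) (by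
      exact Continuous.aestronglyMeasurable (by fun_prop)) (Filter.Eventually.of_forall fun z => by rw [norm_mul, Complex.norm_exp_ofReal_mul_I, Complex.norm_exp_ofReal_mul_I, one_mul])
    refine h3.congr (Filter.Eventually.of_forall fun z => ?_)
    simp only [Function.uncurry]
    ring

lemma ker_int (hG : Continuous G) (hc : HasCompactSupport G) (hR : 0 < R) (hf : Integrable f) (x : Euc d) :
    Integrable (fun y => 𝓕⁻ (fun ξ => G (R⁻¹ • ξ)) (x - y) * f y) := by
  have hGi : Integrable (fun ξ => G (R⁻¹ • ξ)) := (by fun_prop : Continuous (fun ξ => G (R⁻¹ • ξ))).integrable_of_hasCompactSupport (dil_cs hc hR)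
  have hcont := fourierInv_continuous hGi
  refine hf.bdd_mul (c := ∫ y, ‖G (R⁻¹ • y)‖) (Continuous.aestronglyMeasurable (by fun_prop)) (Filter.Eventually.of_forall fun y => ?_)
  rw [Real.fourierInv_eq']
  refine (norm_integral_le_integral_norm _).trans (le_of_eq ?_)
  congr 1; ext z; rw [norm_smul, norm_exp_I, one_mul]

lemma symT_add (hG : Continuous G) (hc : HasCompactSupport G) (hR : 0 < R) {g : Euc d → ℂ} (hf : Integrable f) (hg : Integrable g) (x : Euc d) :
    symT G R (fun y => f y + g y) x = symT G R f x + symT G R g x := by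
  rw [symT_eq (f := fun y => f y + g y) hG hc hR (hf.add hg), symT_eq hG hc hR hf, symT_eq hG hc hR hg, ← integral_add (ker_int hG hc hR hf x) (ker_int hG hc hR hg x)]
  congr 1; ext y; ring

lemma symT_smul (hG : Continuous G) (hc : HasCompactSupport G) (hR : 0 < R) (c : ℂ) (hf : Integrable f) (x : Euc d) :
    symT G R (fun y => c * f y) x = c * symT G R f x := by
  rw [symT_eq hG hc hR (hf.const_mul c), symT_eq hG hc hR hf, ← integral_const_mul]
  congr 1; ext y; ring

lemma symT_bound (hG : ContDiff ℝ (⊤ : ℕ∞) G) (hc : HasCompactSupport G) : ∃ C : ℝ≥0∞, C ≠ ∞ ∧ ∀ R : ℝ, 0 < R → ∀ f : Euc d → ℂ, Integrable f →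
    ∀ x, ‖symT G R f x‖ₑ ≤ C * ∫⁻ y, ENNReal.ofReal (R^d) * wt d (R * ‖x - y‖)^2 * ‖f y‖ₑ := by
  obtain ⟨C, hC0, hC⟩ := (test_fourierInv hG hc).1 ((d+1)*2)
  refine ⟨ENNReal.ofReal C, ENNReal.ofReal_ne_top, fun R hR f hf x => ?_⟩
  rw [symT_eq hG.continuous hc hR hf]
  refine (enorm_integral_le_lintegral_enorm _).trans ?_
  rw [← lintegral_const_mul' _ _ ENNReal.ofReal_ne_top]
  refine lintegral_mono fun y => ?_
  rw [enorm_mul, fourierInv_scale _ hR, enorm_mul, ← mul_assoc]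
  refine mul_le_mul' ?_ le_rfl
  have h1 : ‖((R^d : ℝ) : ℂ)‖ₑ = ENNReal.ofReal (R^d) := by
    rw [← ofReal_norm, Complex.norm_real, Real.norm_of_nonneg (by positivity)]
  rw [h1, mul_left_comm]
  refine mul_le_mul' le_rfl ?_
  rw [← ofReal_norm, wt, ← ENNReal.ofReal_pow (by positivity), ← ENNReal.ofReal_mul hC0.le]
  apply ENNReal.ofReal_le_ofReal
  refine (hC _).trans (le_of_eq ?_)
  rw [norm_smul, Real.norm_of_nonneg hR.le, inv_pow, ← pow_mul]

lemma wt2_le (R : ℝ) (hR : 0 < R) (x y : Euc d) : wt d (R * ‖x - y‖)^2 ≤ wt d (R * ‖x - y‖) := by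
  rw [pow_two]
  exact mul_le_of_le_one_right' (wt_le_one d (by positivity))

lemma wt_int_one (hR : 0 < R) (x : Euc d) : ∫⁻ y, ENNReal.ofReal (R^d) * wt d (R * ‖x - y‖)  = ∫⁻ x : Euc d, wt d ‖x‖ := by
  rw [lintegral_const_mul' _ _ ENNReal.ofReal_ne_top, wt_int_scale hR, ← mul_assoc, ← ENNReal.ofReal_mul (by positivity), mul_inv_cancel₀ (by positivity)]
  simp

lemma symT_sup (hG : ContDiff ℝ (⊤ : ℕ∞) G) (hc : HasCompactSupport G) : ∃ C : ℝ≥0∞, C ≠ ∞ ∧ ∀ R : ℝ, 0 < R → ∀ f : Euc d → ℂ, Integrable f →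
    ∀ M : ℝ≥0∞, (∀ y, ‖f y‖ₑ ≤ M) → ∀ x, ‖symT G R f x‖ₑ ≤ C * M := by
  obtain ⟨C, hC, h⟩ := symT_bound hG hc
  refine ⟨C * ∫⁻ x : Euc d, wt d ‖x‖, ENNReal.mul_ne_top hC (wt_int d).ne, fun R hR f hf M hM x => (h R hR f hf x).trans ?_⟩
  rw [mul_assoc, ← wt_int_one hR x]
  refine mul_le_mul' le_rfl ?_
  have := wt_meas d
  rw [← lintegral_mul_const _ (by fun_prop)]
  refine lintegral_mono fun y => mul_le_mul' (mul_le_mul' le_rfl (wt2_le R hR x y)) (hM y)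

lemma symT_L1 (hG : ContDiff ℝ (⊤ : ℕ∞) G) (hc : HasCompactSupport G) : ∃ C : ℝ≥0∞, C ≠ ∞ ∧ ∀ R : ℝ, 0 < R → ∀ f : Euc d → ℂ, Integrable f →
    ∫⁻ x, ‖symT G R f x‖ₑ ≤ C * ∫⁻ x, ‖f x‖ₑ := by
  obtain ⟨C, hC, h⟩ := symT_bound hG hc
  refine ⟨C * ∫⁻ x : Euc d, wt d ‖x‖, ENNReal.mul_ne_top hC (wt_int d).ne, fun R hR f hf => (lintegral_mono (h R hR f hf)).trans ?_⟩
  rw [lintegral_const_mul' _ _ hC, mul_assoc]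
  refine mul_le_mul' le_rfl ?_
  have := wt_meas d
  have hfm := hf.1.enorm
  rw [lintegral_lintegral_swap (by
    have h1 : AEMeasurable (fun z : Euc d × Euc d => ‖f z.2‖ₑ) ((volume : Measure (Euc d)).prod (volume : Measure (Euc d))) := hfm.comp_snd
    have h2 : Measurable (fun z : Euc d × Euc d => ENNReal.ofReal (R^d) * wt d (R * ‖z.1 - z.2‖)^2) := by fun_prop
    exact h2.aemeasurable.mul h1)]
  rw [← lintegral_const_mul'' _ hfm]
  refine lintegral_mono fun y => ?_
  simp only
  rw [lintegral_mul_const _ (by fun_prop)]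
  refine mul_le_mul' ?_ le_rfl
  rw [← wt_int_one hR y]
  refine lintegral_mono fun x => mul_le_mul' le_rfl ?_
  rw [norm_sub_rev y x]; exact wt2_le R hR x y

lemma symT_integrable (hG : ContDiff ℝ (⊤ : ℕ∞) G) (hc : HasCompactSupport G) (hR : 0 < R) (hf : Integrable f) : Integrable (symT G R f) := by
  obtain ⟨C, hC, h⟩ := symT_L1 hG hc
  exact ⟨(symT_continuous hG.continuous hc hR hf).aestronglyMeasurable, (h R hR f hf).trans_lt (ENNReal.mul_lt_top hC.lt_top hf.2)⟩

lemma symT_fourier (hG : ContDiff ℝ (⊤ : ℕ∞) G) (hc : HasCompactSupport G) (hR : 0 < R) (hf : Integrable f) :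
    𝓕 (symT G R f) = fun ξ => G (R⁻¹ • ξ) * 𝓕 f ξ := by
  have h1 := sym_cont (R := R) hG.continuous hf
  have h2 := h1.integrable_of_hasCompactSupport (μ := volume) (sym_cs hc hR f)
  refine Continuous.fourier_fourierInv_eq h1 h2 ?_
  have h3 := (symT_integrable hG hc hR hf).comp_neg
  refine h3.congr (Filter.Eventually.of_forall fun x => ?_)
  simp only [symT]
  rw [Real.fourierInv_eq_fourier_neg, neg_neg]

lemma symT_plancherel (hG : Continuous G) (hc : HasCompactSupport G) (hR : 0 < R) (hf : Integrable f) :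
    ∫⁻ x, ‖symT G R f x‖ₑ^2 = ∫⁻ ξ, ‖G (R⁻¹ • ξ) * 𝓕 f ξ‖ₑ^2 := 
  plancherel_inv ((sym_cont hG hf).integrable_of_hasCompactSupport (sym_cs hc hR f)) ((sym_cont hG hf).memLp_of_hasCompactSupport (sym_cs hc hR f))

end

/-- base symbols -/
def bs0 (d : ℕ) (β₀ : ℝ → ℝ) (a b : ℝ) (ξ : Euc d) : ℂ := ((β₀ (a * ‖ξ‖) - β₀ (b * ‖ξ‖) : ℝ) : ℂ)

lemma rad_smooth {d : ℕ} {β₀ : ℝ → ℝ} (hβ : IsBump β₀) {c : ℝ} (hc : 0 < c) : ContDiff ℝ (⊤ : ℕ∞) (fun ξ : Euc d => β₀ (c * ‖ξ‖)) := by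
  rw [contDiff_iff_contDiffAt]
  intro ξ
  by_cases h : ξ = 0
  · have : (fun ξ : Euc d => β₀ (c * ‖ξ‖)) =ᶠ[nhds ξ] fun _ => 1 := by
      have hc : ContinuousAt (fun ξ : Euc d => |c * ‖ξ‖|) ξ := by fun_prop
      have := hc.eventually_lt (continuousAt_const (y := (1/2:ℝ))) (by simp [h])
      filter_upwards [this] with y hy
      exact hβ.2.1 _ hy
    exact contDiffAt_const.congr_of_eventuallyEq this
  · exact hβ.1.contDiffAt.comp ξ (contDiffAt_const.mul (contDiffAt_norm ℝ h))

lemma bs0_smooth {d : ℕ} {β₀ : ℝ → ℝ} (hβ : IsBump β₀) {a b : ℝ} (ha : 0 < a) (hb : 0 < b) : ContDiff ℝ (⊤ : ℕ∞) (bs0 d β₀ a b) := by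
  unfold bs0
  exact Complex.ofRealCLM.contDiff.comp ((rad_smooth hβ ha).sub (rad_smooth hβ hb))

lemma bs0_supp {d : ℕ} {β₀ : ℝ → ℝ} (hβ : IsBump β₀) {a b : ℝ} (ha : 0 < a) (hab : a < b) (ξ : Euc d) (h : bs0 d β₀ a b ξ ≠ 0) :
    1/2 ≤ b * ‖ξ‖ ∧ a * ‖ξ‖ ≤ 1 := by
  by_contra hcon
  apply h
  unfold bs0
  have hx := norm_nonneg ξ
  rw [not_and_or] at hcon
  have hle : a * ‖ξ‖ ≤ b * ‖ξ‖ := by gcongr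
  rcases hcon with h1 | h1
  · push Not at h1
    rw [hβ.2.1 _ (by rw [abs_of_nonneg (by positivity)]; linarith), hβ.2.1 _ (by rw [abs_of_nonneg (by nlinarith)]; linarith)]; simp
  · push Not at h1
    rw [hβ.2.2 _ (by rw [abs_of_nonneg (by positivity)]; linarith), hβ.2.2 _ (by rw [abs_of_nonneg (by nlinarith)]; linarith)]; simp

lemma bs0_cs {d : ℕ} {β₀ : ℝ → ℝ} (hβ : IsBump β₀) {a b : ℝ} (ha : 0 < a) (hab : a < b) : HasCompactSupport (bs0 d β₀ a b) :=
  cont_supp_bdd (b := a⁻¹) fun ξ h => by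
    have := (bs0_supp hβ ha hab ξ h).2
    rw [← mul_one a⁻¹]; rw [← div_eq_inv_mul, le_div_iff₀ ha]; linarith

lemma bs0_mul {d : ℕ} {β₀ : ℝ → ℝ} (hβ : IsBump β₀) (ξ : Euc d) : bs0 d β₀ (1/4) 8 ξ * bs0 d β₀ 1 2 ξ = bs0 d β₀ 1 2 ξ := by
  by_cases h : bs0 d β₀ 1 2 ξ = 0
  · simp [h]
  · have := bs0_supp hβ one_pos one_lt_two ξ h
    have e : bs0 d β₀ (1/4) 8 ξ = 1 := by
      unfold bs0
      rw [hβ.2.1 _ (by rw [abs_of_nonneg (by positivity)]; linarith), hβ.2.2 _ (by rw [abs_of_nonneg (by positivity)]; linarith)]; simp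
    rw [e, one_mul]

lemma homLP_eq {d : ℕ} (β₀ : ℝ → ℝ) (m : ℤ) (f : Euc d → ℂ) : homLP d β₀ m f = symT (bs0 d β₀ 1 2) ((2:ℝ)^m) f := by
  unfold homLP symT bs0
  congr 1; ext ξ
  rw [norm_smul, Real.norm_of_nonneg (by positivity), one_mul, ← mul_assoc, ← zpow_neg, sub_eq_add_neg 1 m, zpow_add₀ two_ne_zero, zpow_one]

lemma homLP_reproduce {d : ℕ} {β₀ : ℝ → ℝ} (hβ : IsBump β₀) (m : ℤ) {f : Euc d → ℂ} (hf : Integrable f) :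
    symT (bs0 d β₀ (1/4) 8) ((2:ℝ)^m) (homLP d β₀ m f) = homLP d β₀ m f := by
  rw [homLP_eq]
  nth_rewrite 1 [symT]
  rw [symT_fourier (bs0_smooth hβ one_pos two_pos) (bs0_cs hβ one_pos one_lt_two) (by positivity) hf]
  simp only [← mul_assoc, bs0_mul hβ]
  rfl
end
end

section

open MeasureTheory Metric Set
open scoped ENNReal NNReal FourierTransform

noncomputable section

lemma cs_w {α : Type*} [MeasurableSpace α] (μ : Measure α) {w f : α → ℝ≥0∞} (hw : AEMeasurable w μ) (hf : AEMeasurable f μ) :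
    (∫⁻ x, w x * f x ∂μ)^2 ≤ (∫⁻ x, w x ∂μ) * ∫⁻ x, f x^2 * w x ∂μ := by
  have h2 := ENNReal.lintegral_mul_le_Lp_mul_Lq μ (Real.HolderConjugate.two_two) (f := fun x => (w x)^(1/2:ℝ)) (g := fun x => (w x)^(1/2:ℝ) * f x) (by fun_prop) (by fun_prop)
  have e : ∀ x, (w x)^(1/2:ℝ) * (w x)^(1/2:ℝ) = w x := fun x => by
    rw [← ENNReal.rpow_add_of_nonneg _ _ (by norm_num) (by norm_num)]; norm_num
  have e2 : ∀ x, ((w x)^(1/2:ℝ))^(2:ℝ) = w x := fun x => by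
    rw [← ENNReal.rpow_mul]; norm_num
  simp only [Pi.mul_apply, ← mul_assoc, e, ENNReal.mul_rpow_of_nonneg _ _ (by norm_num : (0:ℝ) ≤ 2), e2] at h2
  calc _ ≤ _ := pow_le_pow_left' h2 2
    _ = _ := by
      rw [mul_pow, ← ENNReal.rpow_natCast, ← ENNReal.rpow_natCast, ← ENNReal.rpow_mul, ← ENNReal.rpow_mul]
      norm_num
      simp only [mul_comm]

lemma sphAvg_cont {d : ℕ} (hd : 2 ≤ d) {u : Euc d → ℂ} (hu : Continuous u) {M : ℝ} (hM : ∀ x, ‖u x‖ ≤ M) :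
    Continuous (fun z : Euc d × ℝ => sphAvg u z.2 z.1) := by
  have := sphereMeasure_prob hd
  unfold sphAvg
  refine continuous_of_dominated (bound := fun ω => M) ?_ ?_ ?_ ?_
  · intro x; exact Continuous.aestronglyMeasurable (by fun_prop)
  · intro x; exact Filter.Eventually.of_forall fun ω => hM _
  · exact integrable_const _
  · refine Filter.Eventually.of_forall fun ω => by fun_prop

lemma sphAvg_cont_t {d : ℕ} (hd : 2 ≤ d) {u : Euc d → ℂ} (hu : Continuous u) {M : ℝ} (hM : ∀ x, ‖u x‖ ≤ M) (x : Euc d) :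
    Continuous (fun t : ℝ => sphAvg u t x) := by
  have := sphereMeasure_prob hd
  unfold sphAvg
  refine continuous_of_dominated (bound := fun ω => M) ?_ ?_ ?_ ?_
  · intro x; exact Continuous.aestronglyMeasurable (by fun_prop)
  · intro x; exact Filter.Eventually.of_forall fun ω => hM _
  · exact integrable_const _
  · refine Filter.Eventually.of_forall fun ω => by fun_prop

lemma sphAvg_enorm_le {d : ℕ} (hd : 2 ≤ d) {u : Euc d → ℂ} {x : Euc d} {t : ℝ} {M : ℝ≥0∞} (hM : ∀ z, ‖z - x‖ ≤ |t| → ‖u z‖ₑ ≤ M) :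
    ‖sphAvg u t x‖ₑ ≤ M := by
  have := sphereMeasure_prob hd
  unfold sphAvg
  refine (enorm_integral_le_lintegral_enorm _).trans ?_
  calc _ ≤ ∫⁻ y, M ∂(sphereMeasure d) := by
        refine lintegral_mono_ae ?_
        filter_upwards [ae_sphere d] with ω hω
        refine hM _ ?_
        rw [show x - t • ω - x = -(t • ω) by abel, norm_neg, norm_smul, hω]; simp
    _ = M := by simp

lemma symT_bdd {d : ℕ} {G : Euc d → ℂ} {R : ℝ} {f : Euc d → ℂ} (hG : Continuous G) (hc : HasCompactSupport G) (hR : 0 < R) (hf : Integrable f) :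
    ∃ M : ℝ, ∀ x, ‖symT G R f x‖ ≤ M := by
  have hi := (sym_cont (R := R) hG hf).integrable_of_hasCompactSupport (μ := volume) (sym_cs hc hR f)
  refine ⟨(∫⁻ y, ‖G (R⁻¹ • y) * 𝓕 f y‖ₑ).toReal, fun x => ?_⟩
  have := enorm_fourierInv_le (fun ξ => G (R⁻¹ • ξ) * 𝓕 f ξ) x
  rw [← toReal_enorm]
  exact ENNReal.toReal_mono hi.2.ne this

lemma cutoff_bdd {χ : ℝ → ℝ} (hχ : IsCutoff χ) : ∃ M : ℝ≥0∞, M ≠ ∞ ∧ ∀ t, ‖(χ t : ℂ)‖ₑ ≤ M ∧ (t ∉ Icc (1/2:ℝ) 4 → (χ t : ℂ) = 0) := by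
  have h0 : ∀ t, t ∉ Icc (1/2:ℝ) 4 → χ t = 0 := fun t ht => by
    by_contra h; exact ht (hχ.2.2 h)
  have hcs : HasCompactSupport χ := HasCompactSupport.intro isCompact_Icc h0
  obtain ⟨M, hM⟩ := hχ.1.continuous.bounded_above_of_compact_support hcs
  refine ⟨ENNReal.ofReal M, ENNReal.ofReal_ne_top, fun t => ⟨?_, fun h => by simp [h0 t h]⟩⟩
  rw [← ofReal_norm, Complex.norm_real]
  exact ENNReal.ofReal_le_ofReal (hM t)

lemma lintegral_Ioi_scale {F : ℝ → ℝ≥0∞} (hF : Measurable F) {D : ℝ} (hD : 0 < D) :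
    ∫⁻ t in Ioi (0:ℝ), F (D * t) = ENNReal.ofReal D⁻¹ * ∫⁻ t in Ioi (0:ℝ), F t := by
  rw [← lintegral_indicator measurableSet_Ioi, ← lintegral_indicator measurableSet_Ioi]
  have h := Real.map_volume_mul_left hD.ne'
  have h2 : ∫⁻ t, (Ioi (0:ℝ)).indicator F t ∂(Measure.map (D * ·) volume) = ∫⁻ t, (Ioi (0:ℝ)).indicator F (D * t) := 
    lintegral_map (hF.indicator measurableSet_Ioi) (measurable_const_mul D)
  rw [h, lintegral_smul_measure, abs_of_pos (by positivity), smul_eq_mul] at h2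
  rw [h2]
  congr 1; ext t
  by_cases ht : 0 < t
  · simp [indicator, ht, mul_pos hD ht]
  · have : ¬ (0 < D * t) := fun h => ht (pos_of_mul_pos_right h hD.le)
    simp only [indicator, mem_Ioi, ht, this, if_false]

lemma time_int {d : ℕ} (hd : 2 ≤ d) {χ : ℝ → ℝ} (hχ : IsCutoff χ) : ∃ C : ℝ≥0∞, C ≠ ∞ ∧ ∀ D : ℝ, 0 < D → ∀ F : ℝ → ℝ≥0∞, Measurable F →
    ∫⁻ t, ‖(χ t : ℂ)‖ₑ^2 * F (D * t) ≤ C * ENNReal.ofReal ((D^d)⁻¹) * ∫⁻ τ in Ioi (0:ℝ), ENNReal.ofReal (τ^(d-1)) * F τ := by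
  obtain ⟨M, hM, hχM⟩ := cutoff_bdd hχ
  refine ⟨M^2 * ENNReal.ofReal (2^(d-1)), by finiteness, fun D hD F hF => ?_⟩
  have e1 : ∫⁻ t in Ioi (0:ℝ), ENNReal.ofReal ((D * t)^(d-1)) * F (D * t) = ENNReal.ofReal D⁻¹ * ∫⁻ τ in Ioi (0:ℝ), ENNReal.ofReal (τ^(d-1)) * F τ :=
    lintegral_Ioi_scale (F := fun τ => ENNReal.ofReal (τ^(d-1)) * F τ) (by fun_prop) hD
  have e2 : ENNReal.ofReal ((D^d)⁻¹) = ENNReal.ofReal ((D^(d-1))⁻¹) * ENNReal.ofReal D⁻¹ := by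
    rw [← ENNReal.ofReal_mul (by positivity), ← mul_inv, ← pow_succ, show d - 1 + 1 = d by omega]
  rw [e2, mul_assoc, mul_assoc, mul_assoc, ← mul_assoc (M^2), ← e1, ← lintegral_const_mul' _ _ ENNReal.ofReal_ne_top, ← lintegral_const_mul' _ _ (by finiteness),
    ← lintegral_indicator measurableSet_Ioi]
  refine lintegral_mono fun t => ?_
  by_cases ht : t ∈ Icc (1/2:ℝ) 4
  · have ht0 : 0 < t := by linarith [ht.1]
    rw [indicator_of_mem (by exact ht0)]
    rw [show ∀ a b c e f : ℝ≥0∞, a * b * (c * (e * f)) = a * (b * c * e) * f by intros; ring, ← ENNReal.ofReal_mul (by positivity), ← ENNReal.ofReal_mul (by positivity)]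
    refine mul_le_mul' ?_ le_rfl
    calc _ ≤ M^2 * 1 := by rw [mul_one]; exact pow_le_pow_left' (hχM t).1 2
      _ ≤ _ := by
        refine mul_le_mul' le_rfl ?_
        rw [ENNReal.one_le_ofReal]
        rw [mul_pow, ← mul_assoc, mul_assoc (2^(d-1)), inv_mul_cancel₀ (by positivity), mul_one, ← mul_pow]
        exact one_le_pow₀ (by linarith [ht.1])
  · rw [(hχM t).2 ht]; simp

lemma ph_exp_le {d : ℕ} (hd : 2 ≤ d) : 2 / ((d:ℝ)+1) ≤ 1 := by
  rw [div_le_one (by positivity)]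
  have : (2:ℝ) ≤ d := by exact_mod_cast hd
  linarith

lemma ph_const {d : ℕ} (hd : 2 ≤ d) {c : ℝ≥0∞} (hc : 1 ≤ c) (u : ℝ≥0∞) : ph d (c * u) ≤ c * ph d u := by
  unfold ph
  rcases min_choice u (u ^ (2 / ((d:ℝ)+1))) with h | h <;> rw [h]
  · exact min_le_left _ _
  · refine (min_le_right _ _).trans ?_
    rw [ENNReal.mul_rpow_of_nonneg _ _ (by positivity)]
    refine mul_le_mul' ?_ le_rfl
    calc _ ≤ c ^ (1:ℝ) := ENNReal.rpow_le_rpow_of_exponent_le hc (ph_exp_le hd)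
      _ = c := by simp

lemma ph_ge {d : ℕ} (hd : 2 ≤ d) {u J : ℝ≥0∞} (hJ : 1 ≤ J) (h : u ≤ J) : u * J⁻¹ ≤ ph d u := by
  unfold ph
  have h1 : J⁻¹ ≤ 1 := ENNReal.inv_le_one.2 hJ
  refine le_min (mul_le_of_le_one_right' h1) ?_
  by_cases hu : u ≤ 1
  · refine (mul_le_of_le_one_right' h1).trans ?_
    calc u = u ^ (1:ℝ) := by simp
      _ ≤ _ := ENNReal.rpow_le_rpow_of_exponent_ge hu (ph_exp_le hd)
  · push Not at hu
    calc u * J⁻¹ ≤ J * J⁻¹ := mul_le_mul' h le_rfl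
      _ ≤ 1 := ENNReal.mul_inv_le_one J
      _ ≤ _ := ENNReal.one_le_rpow hu.le (by positivity)

lemma exists_ne_top_of_bdd {d : ℕ} {G : Euc d → ℂ} (hG : Continuous G) (hc : HasCompactSupport G) : ∃ M : ℝ≥0∞, M ≠ ∞ ∧ ∀ ξ, ‖G ξ‖ₑ ≤ M := by
  obtain ⟨M, hM⟩ := hG.bounded_above_of_compact_support hc
  refine ⟨ENNReal.ofReal M, ENNReal.ofReal_ne_top, fun ξ => ?_⟩
  rw [← ofReal_norm]
  exact ENNReal.ofReal_le_ofReal (hM ξ)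

/-- the cube coefficient -/
def bQ {d : ℕ} (D : ℝ) (c : Euc d) (g : Euc d → ℂ) : ℝ≥0∞ := ∫⁻ y, ‖g y‖ₑ^2 * wt d (D⁻¹ * ‖y - c‖)

lemma near_est {d : ℕ} (hd : 2 ≤ d) {χ β₀ : ℝ → ℝ} (hχ : IsCutoff χ) (hβ : IsBump β₀) (ρ : ℝ) (hρ : 0 < ρ) : ∃ C : ℝ≥0∞, C ≠ ∞ ∧
    ∀ D R : ℝ, 0 < D → 0 < R → ∀ g : Euc d → ℂ, Integrable g → Continuous g → ∀ c : Euc d, ∀ A : Set (Euc d),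
    MeasurableSet A → volume A ≠ ∞ →
    ∫⁻ x in A, ∫⁻ t, ‖(χ t : ℂ) * sphAvg (symT (bs0 d β₀ (1/4) 8) R ((closedBall c (ρ * D)).indicator g)) (D * t) x‖ₑ^2 ≤
      C * ENNReal.ofReal (((D * R)^d)⁻¹) * ph d (ENNReal.ofReal (R^d) * volume A) * bQ D c g := by
  set G := bs0 d β₀ (1/4) 8 with hGdef
  have hGs : ContDiff ℝ (⊤ : ℕ∞) G := bs0_smooth hβ (by norm_num) (by norm_num)
  have hGc : HasCompactSupport G := bs0_cs hβ (by norm_num) (by norm_num)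
  obtain ⟨M, hM, hGM⟩ := exists_ne_top_of_bdd hGs.continuous hGc
  obtain ⟨C1, hC1, ht⟩ := time_int hd hχ
  obtain ⟨C2, hC2, hs⟩ := star hd
  have hwt0 : wt d ρ ≠ 0 := by
    unfold wt; simp only [ne_eq, ENNReal.ofReal_eq_zero, not_le]; positivity
  refine ⟨C1 * (C2 * ENNReal.ofReal (16^d) * ENNReal.ofReal (4^d) * (M^2 * (wt d ρ)⁻¹)), ?_, fun D R hD hR g hgi hgc c A hA hAf => ?_⟩
  · have : (wt d ρ)⁻¹ ≠ ∞ := ENNReal.inv_ne_top.2 hwt0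
    finiteness
  set B := closedBall c (ρ * D) with hB
  set g1 := B.indicator g with hg1
  have hBm : MeasurableSet B := measurableSet_closedBall
  have hg1i : Integrable g1 := hgi.indicator hBm
  have hg1L : MemLp g1 2 := by
    have hfinB : IsFiniteMeasure (volume.restrict B) := ⟨by simpa using (isCompact_closedBall c (ρ * D)).measure_lt_top⟩
    rw [hg1, memLp_indicator_iff_restrict hBm]
    obtain ⟨M', hM'⟩ := (isCompact_closedBall c (ρ * D)).exists_bound_of_continuousOn hgc.continuousOn
    refine MemLp.of_bound hgc.aestronglyMeasurable M' ?_
    exact (ae_restrict_iff' hBm).2 (Filter.Eventually.of_forall hM')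
  set W : Euc d → ℂ := fun ξ => G (R⁻¹ • ξ) * 𝓕 g1 ξ with hW
  have hWc : Continuous W := sym_cont hGs.continuous hg1i
  obtain ⟨M1, hM1⟩ := symT_bdd hGs.continuous hGc hR hg1i
  have hac := sphAvg_cont_t hd (symT_continuous hGs.continuous hGc hR hg1i) hM1
  have step1 : ∀ x, ∫⁻ t, ‖(χ t : ℂ) * sphAvg (symT G R g1) (D * t) x‖ₑ^2 ≤ C1 * ENNReal.ofReal ((D^d)⁻¹) * ∫⁻ τ in Ioi (0:ℝ), ENNReal.ofReal (τ^(d-1)) * ‖sphAvg (symT G R g1) τ x‖ₑ^2 := by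
    intro x
    have hm : Measurable (fun τ => ‖sphAvg (symT G R g1) τ x‖ₑ^2) := by
      exact (hac x).measurable.enorm.pow_const 2
    simpa only [enorm_mul, mul_pow] using ht D hD _ hm
  refine (lintegral_mono step1).trans ?_
  rw [lintegral_const_mul' _ _ (by finiteness)]
  have step2 := hs A hA hAf W hWc (R/16) (4*R) (by positivity) (fun ξ hξ => by
    have h1 : G (R⁻¹ • ξ) ≠ 0 := left_ne_zero_of_mul hξ
    have h2 := bs0_supp hβ (by norm_num) (by norm_num) _ h1
    rw [norm_smul, Real.norm_of_nonneg (by positivity)] at h2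
    have e : ‖ξ‖ = R * (R⁻¹ * ‖ξ‖) := by field_simp
    constructor
    · rw [e]; nlinarith [h2.1]
    · rw [e]; nlinarith [h2.2])
  have step3 : ∫⁻ ξ, ‖W ξ‖ₑ^2 ≤ M^2 * (wt d ρ)⁻¹ * bQ D c g := by
    calc _ ≤ ∫⁻ ξ, M^2 * ‖𝓕 g1 ξ‖ₑ^2 := by
          refine lintegral_mono fun ξ => ?_
          simp only [hW]
          rw [enorm_mul, mul_pow]
          exact mul_le_mul' (pow_le_pow_left' (hGM _) 2) le_rfl
      _ = M^2 * ∫⁻ y, ‖g1 y‖ₑ^2 := by rw [lintegral_const_mul' _ _ (by finiteness), plancherel hg1i hg1L]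
      _ ≤ M^2 * ((wt d ρ)⁻¹ * bQ D c g) := by
          refine mul_le_mul' le_rfl ?_
          unfold bQ
          rw [← lintegral_const_mul' _ _ (ENNReal.inv_ne_top.2 hwt0)]
          refine lintegral_mono fun y => ?_
          by_cases hy : y ∈ B
          · simp only [hg1, indicator_of_mem hy]
            have h1 : wt d ρ ≤ wt d (D⁻¹ * ‖y - c‖) := by
              refine wt_anti d (by positivity) ?_
              rw [inv_mul_le_iff₀ hD, mul_comm, ← dist_eq_norm]; exact hy
            calc _ = (wt d ρ)⁻¹ * (‖g y‖ₑ^2 * wt d ρ) := by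
                  rw [mul_comm, mul_assoc, ENNReal.mul_inv_cancel hwt0 (by unfold wt; finiteness), mul_one]
              _ ≤ _ := mul_le_mul' le_rfl (mul_le_mul' le_rfl h1)
          · simp [hg1, indicator_of_notMem hy]
      _ = _ := by ring
  calc _ ≤ C1 * ENNReal.ofReal ((D^d)⁻¹) * (C2 * ENNReal.ofReal (((R/16)^d)⁻¹) * ph d (ENNReal.ofReal ((4*R)^d) * volume A) * (M^2 * (wt d ρ)⁻¹ * bQ D c g)) :=
        mul_le_mul' le_rfl (step2.trans (mul_le_mul' le_rfl step3))
    _ ≤ C1 * ENNReal.ofReal ((D^d)⁻¹) * (C2 * (ENNReal.ofReal (16^d) * ENNReal.ofReal ((R^d)⁻¹)) * (ENNReal.ofReal (4^d) * ph d (ENNReal.ofReal (R^d) * volume A)) * (M^2 * (wt d ρ)⁻¹ * bQ D c g)) := by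
        refine mul_le_mul' le_rfl (mul_le_mul' (mul_le_mul' (mul_le_mul' le_rfl (le_of_eq ?_)) ?_) le_rfl)
        · rw [← ENNReal.ofReal_mul (by positivity), div_pow, inv_div, div_eq_mul_inv]
        · rw [mul_pow, ENNReal.ofReal_mul (by positivity), mul_assoc]
          exact ph_const hd (by rw [ENNReal.one_le_ofReal]; exact one_le_pow₀ (by norm_num)) _
    _ = _ := by
        rw [mul_pow, mul_inv, ENNReal.ofReal_mul (by positivity)]
        ring
end
end

section

open MeasureTheory Metric Set
open scoped ENNReal NNReal FourierTransform

noncomputable section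

lemma far_pt {d : ℕ} {β₀ : ℝ → ℝ} (hβ : IsBump β₀) : ∃ C : ℝ≥0∞, C ≠ ∞ ∧
    ∀ D R : ℝ, 0 < D → 0 < R → 1 ≤ D * R → ∀ g : Euc d → ℂ, Integrable g → Continuous g → ∀ c z : Euc d, ‖z - c‖ ≤ (d + 4) * D → 
    ‖symT (bs0 d β₀ (1/4) 8) R ((closedBall c ((2 * d + 9) * D))ᶜ.indicator g) z‖ₑ^2 ≤ 
      C * (ENNReal.ofReal (((D * R)^d)⁻¹)^2 * ENNReal.ofReal ((D^d)⁻¹) * bQ D c g) := by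
  set G := bs0 d β₀ (1/4) 8 with hGdef
  have hGs : ContDiff ℝ (⊤ : ℕ∞) G := bs0_smooth hβ (by norm_num) (by norm_num)
  have hGc : HasCompactSupport G := bs0_cs hβ (by norm_num) (by norm_num)
  obtain ⟨C, hC, hb⟩ := symT_bound hGs hGc
  set I := ∫⁻ x : Euc d, wt d ‖x‖ with hI
  have hIf : I ≠ ∞ := (wt_int d).ne
  refine ⟨C^2 * ENNReal.ofReal (2^(d+1))^4 * I, by finiteness, fun D R hD hR hDR g hgi hgc c z hz => ?_⟩
  set J := D * R with hJ
  have hJ0 : 0 < J := by positivity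
  have hwm := wt_meas d
  set B := closedBall c ((2 * d + 9) * D) with hB
  have hBm : MeasurableSet B := measurableSet_closedBall
  have h1 := hb R hR (Bᶜ.indicator g) (hgi.indicator hBm.compl) z
  have h2 : ∫⁻ y, ENNReal.ofReal (R^d) * wt d (R * ‖z - y‖)^2 * ‖Bᶜ.indicator g y‖ₑ ≤
      (ENNReal.ofReal (R^d) * ENNReal.ofReal (2^(d+1))^2 * ENNReal.ofReal ((J^d)⁻¹)^2) * ∫⁻ y, wt d (D⁻¹ * ‖y - c‖) * ‖g y‖ₑ := by
    rw [← lintegral_const_mul' _ _ (by finiteness)]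
    refine lintegral_mono fun y => ?_
    by_cases hy : y ∈ B
    · simp [indicator, hy]
    · rw [indicator_of_mem (by exact hy)]
      set v := D⁻¹ * ‖y - c‖ with hv
      have hv0 : 0 ≤ v := by positivity
      have hyv : ‖y - c‖ = D * v := by rw [hv]; field_simp
      have hv1 : 2 * d + 9 ≤ v := by
        have : (2 * d + 9) * D < ‖y - c‖ := by
          rw [← dist_eq_norm]; simpa [hB] using hy
        rw [hyv] at this
        nlinarith
      have hzy : D * (1 + v) / 2 ≤ ‖z - y‖ := by
        have : ‖y - c‖ ≤ ‖z - y‖ + ‖z - c‖ := by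
          calc ‖y - c‖ = ‖-(z - y) + (z - c)‖ := by congr 1; abel
            _ ≤ _ := by rw [← norm_neg (z - y)]; exact norm_add_le _ _
        rw [hyv] at this
        nlinarith
      have hw : wt d (R * ‖z - y‖) ≤ ENNReal.ofReal (2^(d+1)) * ENNReal.ofReal ((J^d)⁻¹) * wt d v := by
        unfold wt
        rw [← ENNReal.ofReal_mul (by positivity), ← ENNReal.ofReal_mul (by positivity)]
        apply ENNReal.ofReal_le_ofReal
        have h3 : J * (1 + v) / 2 ≤ 1 + R * ‖z - y‖ := by
          have := mul_le_mul_of_nonneg_left hzy hR.le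
          rw [hJ]; linarith
        calc ((1 + R * ‖z - y‖)^(d+1))⁻¹ ≤ ((J * (1 + v) / 2)^(d+1))⁻¹ := by
              apply inv_anti₀ (by positivity)
              exact pow_le_pow_left₀ (by positivity) h3 _
          _ = 2^(d+1) * (J^(d+1))⁻¹ * ((1+v)^(d+1))⁻¹ := by
              rw [div_pow, mul_pow, inv_div, div_eq_mul_inv, mul_inv]; ring
          _ ≤ _ := by
              have : (J^(d+1))⁻¹ ≤ (J^d)⁻¹ := inv_anti₀ (by positivity) (pow_le_pow_right₀ hDR (by omega))
              gcongr
      calc _ ≤ ENNReal.ofReal (R^d) * (ENNReal.ofReal (2^(d+1)) * ENNReal.ofReal ((J^d)⁻¹) * wt d v)^2 * ‖g y‖ₑ := 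
            mul_le_mul' (mul_le_mul' le_rfl (pow_le_pow_left' hw 2)) le_rfl
        _ = ENNReal.ofReal (R^d) * ‖g y‖ₑ * ENNReal.ofReal (2^(d+1))^2 * ENNReal.ofReal ((J^d)⁻¹)^2 * (wt d v * wt d v) := by ring
        _ ≤ ENNReal.ofReal (R^d) * ‖g y‖ₑ * ENNReal.ofReal (2^(d+1))^2 * ENNReal.ofReal ((J^d)⁻¹)^2 * wt d v := 
            mul_le_mul' le_rfl (mul_le_of_le_one_right' (wt_le_one d hv0))
        _ = _ := by ring
  have h3 := cs_w (volume : Measure (Euc d)) (w := fun y => wt d (D⁻¹ * ‖y - c‖)) (f := fun y => ‖g y‖ₑ) (by fun_prop) (by fun_prop)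
  have h4 : ∫⁻ y : Euc d, wt d (D⁻¹ * ‖y - c‖) = ENNReal.ofReal (D^d) * I := by
    have := wt_int_scale (inv_pos.2 hD) c
    simp only [norm_sub_rev c] at this
    rw [this, inv_pow, inv_inv]
  rw [h4] at h3
  calc _ ≤ (C * ((ENNReal.ofReal (R^d) * ENNReal.ofReal (2^(d+1))^2 * ENNReal.ofReal ((J^d)⁻¹)^2) * ∫⁻ y, wt d (D⁻¹ * ‖y - c‖) * ‖g y‖ₑ))^2 :=
        pow_le_pow_left' (h1.trans (mul_le_mul' le_rfl h2)) 2
    _ = C^2 * (ENNReal.ofReal (R^d) * ENNReal.ofReal (2^(d+1))^2 * ENNReal.ofReal ((J^d)⁻¹)^2)^2 * (∫⁻ y, wt d (D⁻¹ * ‖y - c‖) * ‖g y‖ₑ)^2 := by ring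
    _ ≤ C^2 * (ENNReal.ofReal (R^d) * ENNReal.ofReal (2^(d+1))^2 * ENNReal.ofReal ((J^d)⁻¹)^2)^2 * (ENNReal.ofReal (D^d) * I * bQ D c g) := 
        mul_le_mul' le_rfl h3
    _ = C^2 * ENNReal.ofReal (2^(d+1))^4 * I * (ENNReal.ofReal ((J^d)⁻¹)^2 * (ENNReal.ofReal (R^d)^2 * ENNReal.ofReal (D^d) * ENNReal.ofReal ((J^d)⁻¹)^2) * bQ D c g) := by ring
    _ = _ := by
      congr 4
      rw [← ENNReal.ofReal_pow (by positivity), ← ENNReal.ofReal_pow (by positivity), ← ENNReal.ofReal_mul (by positivity), ← ENNReal.ofReal_mul (by positivity)]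
      congr 1
      rw [hJ, mul_pow]; field_simp

lemma sphAvg_cont_D {d : ℕ} (hd : 2 ≤ d) {u : Euc d → ℂ} (hu : Continuous u) {M : ℝ} (hM : ∀ x, ‖u x‖ ≤ M) (D : ℝ) :
    Continuous (fun z : Euc d × ℝ => sphAvg u (D * z.2) z.1) := by
  have := sphereMeasure_prob hd
  unfold sphAvg
  refine continuous_of_dominated (bound := fun ω => M) ?_ ?_ ?_ ?_
  · intro x; exact Continuous.aestronglyMeasurable (by fun_prop)
  · intro x; exact Filter.Eventually.of_forall fun ω => hM _
  · exact integrable_const _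
  · refine Filter.Eventually.of_forall fun ω => by fun_prop

lemma sphAvg_cont_Dt {d : ℕ} (hd : 2 ≤ d) {u : Euc d → ℂ} (hu : Continuous u) {M : ℝ} (hM : ∀ x, ‖u x‖ ≤ M) (D : ℝ) (x : Euc d) :
    Continuous (fun t : ℝ => sphAvg u (D * t) x) := by
  have := sphereMeasure_prob hd
  unfold sphAvg
  refine continuous_of_dominated (bound := fun ω => M) ?_ ?_ ?_ ?_
  · intro x; exact Continuous.aestronglyMeasurable (by fun_prop)
  · intro x; exact Filter.Eventually.of_forall fun ω => hM _
  · exact integrable_const _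
  · refine Filter.Eventually.of_forall fun ω => by fun_prop

lemma add_sq_le_enn (a b : ℝ≥0∞) : (a + b)^2 ≤ 2 * (a^2 + b^2) := by
  have := ENNReal.rpow_add_le_mul_rpow_add_rpow a b (p := 2) (by norm_num)
  norm_num at this
  exact_mod_cast this

lemma local_est {d : ℕ} (hd : 2 ≤ d) {χ β₀ : ℝ → ℝ} (hχ : IsCutoff χ) (hβ : IsBump β₀) : ∃ C : ℝ≥0∞, C ≠ ∞ ∧
    ∀ D R : ℝ, 0 < D → 0 < R → 1 ≤ D * R → ∀ g : Euc d → ℂ, Integrable g → Continuous g → symT (bs0 d β₀ (1/4) 8) R g = g → ∀ c : Euc d, ∀ A : Set (Euc d),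
    MeasurableSet A → A ⊆ closedBall c (d * D) → volume A ≤ ENNReal.ofReal (D^d) →
    ∫⁻ x in A, ∫⁻ t, ‖(χ t : ℂ) * sphAvg g (D * t) x‖ₑ^2 ≤
      C * ENNReal.ofReal (((D * R)^d)⁻¹) * ph d (ENNReal.ofReal (R^d) * volume A) * bQ D c g := by
  obtain ⟨C1, hC1, hn⟩ := near_est hd hχ hβ (2 * d + 9) (by positivity)
  obtain ⟨C2, hC2, hf⟩ := far_pt (d := d) hβ
  obtain ⟨M, hM, hχM⟩ := cutoff_bdd hχ
  have hsp := sphereMeasure_prob hd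
  refine ⟨2 * C1 + 2 * (M^2 * ENNReal.ofReal 4 * C2), by finiteness, fun D R hD hR hDR g hgi hgc hrep c A hA hAc hAv => ?_⟩
  set G := bs0 d β₀ (1/4) 8 with hGdef
  have hGs : ContDiff ℝ (⊤ : ℕ∞) G := bs0_smooth hβ (by norm_num) (by norm_num)
  have hGc : HasCompactSupport G := bs0_cs hβ (by norm_num) (by norm_num)
  set B := closedBall c ((2 * d + 9) * D) with hB
  have hBm : MeasurableSet B := measurableSet_closedBall
  have i1 := hgi.indicator hBm
  have i2 := hgi.indicator hBm.compl
  set u1 := symT G R (B.indicator g) with hu1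
  set u2 := symT G R (Bᶜ.indicator g) with hu2
  have hsum : g = fun x => u1 x + u2 x := by
    conv_lhs => rw [← hrep]
    have : g = fun y => B.indicator g y + Bᶜ.indicator g y := by
      ext y; by_cases hy : y ∈ B <;> simp [hy]
    ext x
    rw [hu1, hu2, ← symT_add hGs.continuous hGc hR i1 i2, ← this]
  obtain ⟨M1, hM1⟩ := symT_bdd hGs.continuous hGc hR i1
  obtain ⟨M2, hM2⟩ := symT_bdd hGs.continuous hGc hR i2
  have c1 := symT_continuous hGs.continuous hGc hR i1
  have c2 := symT_continuous hGs.continuous hGc hR i2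
  have hAdd : ∀ τ x, sphAvg g τ x = sphAvg u1 τ x + sphAvg u2 τ x := by
    intro τ x
    rw [hsum]
    unfold sphAvg
    exact integral_add (cont_int_sphere hd (by fun_prop)) (cont_int_sphere hd (by fun_prop))
  have hm1 := sphAvg_cont hd c1 hM1
  have hm2 := sphAvg_cont hd c2 hM2
  set K := C2 * (ENNReal.ofReal (((D * R)^d)⁻¹)^2 * ENNReal.ofReal ((D^d)⁻¹) * bQ D c g) with hK
  have hcχ : Continuous χ := hχ.1.continuous
  have far : ∀ x ∈ A, ∫⁻ t, ‖(χ t : ℂ) * sphAvg u2 (D * t) x‖ₑ^2 ≤ M^2 * ENNReal.ofReal 4 * K := by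
    intro x hx
    calc _ ≤ ∫⁻ t, (Icc (1/2:ℝ) 4).indicator (fun _ => M^2 * K) t := by
          refine lintegral_mono fun t => ?_
          by_cases ht : t ∈ Icc (1/2:ℝ) 4
          · rw [indicator_of_mem ht, enorm_mul, mul_pow]
            refine mul_le_mul' (pow_le_pow_left' (hχM t).1 2) ?_
            have : ‖sphAvg u2 (D * t) x‖ₑ ≤ K^((2:ℝ)⁻¹) := by
              refine sphAvg_enorm_le hd (fun z hz => ?_)
              rw [ENNReal.le_rpow_inv_iff (by norm_num), ENNReal.rpow_two]
              refine hf D R hD hR hDR g hgi hgc c z ?_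
              have hx' : ‖x - c‖ ≤ d * D := by rw [← dist_eq_norm]; exact hAc hx
              have h4 : |D * t| ≤ 4 * D := by
                rw [abs_of_nonneg (by have := ht.1; positivity)]; nlinarith [ht.2]
              calc ‖z - c‖ = ‖(z - x) + (x - c)‖ := by congr 1; abel
                _ ≤ ‖z - x‖ + ‖x - c‖ := norm_add_le _ _
                _ ≤ _ := by linarith
            rw [ENNReal.le_rpow_inv_iff (by norm_num), ENNReal.rpow_two] at this
            exact this
          · simp [(hχM t).2 ht]
      _ = M^2 * K * ENNReal.ofReal (4 - 1/2) := by
          rw [lintegral_indicator measurableSet_Icc]; simp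
      _ ≤ M^2 * K * ENNReal.ofReal 4 := mul_le_mul' le_rfl (ENNReal.ofReal_le_ofReal (by norm_num))
      _ = _ := by ring
  have near := hn D R hD hR g hgi hgc c A hA (ne_top_of_le_ne_top ENNReal.ofReal_ne_top hAv)
  set P := ENNReal.ofReal (((D * R)^d)⁻¹) * ph d (ENNReal.ofReal (R^d) * volume A) * bQ D c g with hP
  have farA : ∫⁻ x in A, ∫⁻ t, ‖(χ t : ℂ) * sphAvg u2 (D * t) x‖ₑ^2 ≤ M^2 * ENNReal.ofReal 4 * C2 * P := by
    refine (setLIntegral_mono measurable_const far).trans ?_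
    rw [lintegral_const, Measure.restrict_apply_univ, hK, mul_assoc, mul_assoc (M^2 * ENNReal.ofReal 4)]
    refine mul_le_mul' le_rfl ?_
    rw [mul_assoc C2]
    refine mul_le_mul' le_rfl ?_
    have hμ : ENNReal.ofReal (R^d) * volume A ≤ ENNReal.ofReal ((D * R)^d) := by
      rw [mul_pow, mul_comm (D^d), ENNReal.ofReal_mul (by positivity)]
      exact mul_le_mul' le_rfl hAv
    have h1J : 1 ≤ ENNReal.ofReal ((D * R)^d) := by rw [ENNReal.one_le_ofReal]; exact one_le_pow₀ hDR
    have hge := ph_ge hd h1J hμ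
    rw [← ENNReal.ofReal_inv_of_pos (by positivity)] at hge
    have hone : ENNReal.ofReal (((D * R)^d)⁻¹) ≤ 1 := by
      rw [ENNReal.ofReal_le_one]; exact inv_le_one_of_one_le₀ (one_le_pow₀ hDR)
    have hDe : ENNReal.ofReal ((D^d)⁻¹) = ENNReal.ofReal (R^d) * ENNReal.ofReal (((D*R)^d)⁻¹) := by
      rw [← ENNReal.ofReal_mul (by positivity)]; congr 1; rw [mul_pow]; field_simp
    calc _ = ENNReal.ofReal (((D * R)^d)⁻¹) * (ENNReal.ofReal (R^d) * volume A * ENNReal.ofReal (((D*R)^d)⁻¹)) * bQ D c g * ENNReal.ofReal (((D * R)^d)⁻¹) := by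
          rw [hDe]; ring
      _ ≤ ENNReal.ofReal (((D * R)^d)⁻¹) * ph d (ENNReal.ofReal (R^d) * volume A) * bQ D c g * 1 := 
          mul_le_mul' (mul_le_mul' (mul_le_mul' le_rfl hge) le_rfl) hone
      _ = _ := by rw [mul_one]
  have mm1 : Measurable (fun z : Euc d × ℝ => ‖(χ z.2 : ℂ) * sphAvg u1 (D * z.2) z.1‖ₑ^2) := by
    have e := sphAvg_cont_D hd c1 hM1 D
    have e2 : Continuous (fun z : Euc d × ℝ => (χ z.2 : ℂ)) := by fun_prop
    exact ((e2.mul e).measurable.enorm).pow_const 2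
  have pt : ∀ x, ∫⁻ t, ‖(χ t : ℂ) * sphAvg g (D * t) x‖ₑ^2 ≤ 2 * (∫⁻ t, ‖(χ t : ℂ) * sphAvg u1 (D * t) x‖ₑ^2) + 2 * ∫⁻ t, ‖(χ t : ℂ) * sphAvg u2 (D * t) x‖ₑ^2 := by
    intro x
    have mt : Measurable (fun t : ℝ => ‖(χ t : ℂ) * sphAvg u1 (D * t) x‖ₑ^2) := by
      have e := sphAvg_cont_Dt hd c1 hM1 D x
      have e2 : Continuous (fun t : ℝ => (χ t : ℂ)) := by fun_prop
      exact ((e2.mul e).measurable.enorm).pow_const 2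
    rw [← lintegral_const_mul' _ _ (by norm_num), ← lintegral_const_mul' _ _ (by norm_num), ← lintegral_add_left (by fun_prop)]
    refine lintegral_mono fun t => ?_
    rw [hAdd, mul_add]
    calc _ ≤ (‖(χ t : ℂ) * sphAvg u1 (D * t) x‖ₑ + ‖(χ t : ℂ) * sphAvg u2 (D * t) x‖ₑ)^2 := pow_le_pow_left' (enorm_add_le _ _) 2
      _ ≤ _ := by
        refine (add_sq_le_enn _ _).trans (le_of_eq ?_)
        ring
  calc _ ≤ ∫⁻ x in A, (2 * (∫⁻ t, ‖(χ t : ℂ) * sphAvg u1 (D * t) x‖ₑ^2) + 2 * ∫⁻ t, ‖(χ t : ℂ) * sphAvg u2 (D * t) x‖ₑ^2) := lintegral_mono pt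
    _ = 2 * (∫⁻ x in A, ∫⁻ t, ‖(χ t : ℂ) * sphAvg u1 (D * t) x‖ₑ^2) + 2 * ∫⁻ x in A, ∫⁻ t, ‖(χ t : ℂ) * sphAvg u2 (D * t) x‖ₑ^2 := by
        rw [lintegral_add_left (mm1.lintegral_prod_right'.const_mul 2), lintegral_const_mul' _ _ (by norm_num), lintegral_const_mul' _ _ (by norm_num)]
    _ ≤ 2 * (C1 * P) + 2 * (M^2 * ENNReal.ofReal 4 * C2 * P) := by
        refine add_le_add (mul_le_mul' le_rfl (near.trans (le_of_eq ?_))) (mul_le_mul' le_rfl farA)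
        rw [hP]; ring
    _ = _ := by rw [hP]; ring
end
end

section
open MeasureTheory Metric Set
open scoped ENNReal NNReal FourierTransform
noncomputable section

/-- index of the dyadic cube of side `2^k` containing `x` -/
def cx {d : ℕ} (k : ℤ) (x : Euc d) : Fin d → ℤ := fun i => ⌊x i / (2:ℝ)^k⌋

def cube (d : ℕ) (k : ℤ) (n : Fin d → ℤ) : Set (Euc d) := {x | cx k x = n}

def corner (d : ℕ) (k : ℤ) (n : Fin d → ℤ) : Euc d := WithLp.toLp 2 (fun i => (2:ℝ)^k * n i)

def vk (d : ℕ) (k : ℤ) : ℝ≥0∞ := ENNReal.ofReal (((2:ℝ)^k)^d)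

lemma vk_ne_zero (d : ℕ) (k : ℤ) : vk d k ≠ 0 := by
  unfold vk; rw [ENNReal.ofReal_ne_zero_iff]; positivity

lemma vk_ne_top (d : ℕ) (k : ℤ) : vk d k ≠ ∞ := by unfold vk; finiteness

lemma cx_meas {d : ℕ} (k : ℤ) : Measurable (cx k : Euc d → (Fin d → ℤ)) := by
  unfold cx
  refine measurable_pi_lambda _ fun i => ?_
  exact Int.measurable_floor.comp (by fun_prop)

lemma cube_meas (d : ℕ) (k : ℤ) (n) : MeasurableSet (cube d k n) := 
  cx_meas k (measurableSet_singleton n)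

lemma cube_ball {d : ℕ} (k : ℤ) (n) : cube d k n ⊆ closedBall (corner d k n) (d * 2^k) := by
  intro x hx
  rw [mem_closedBall, dist_eq_norm]
  have h2 : (0:ℝ) < 2^k := by positivity
  have hc : ∀ i, |(x - corner d k n) i| ≤ 2^k := by
    intro i
    have h : ⌊x i / (2:ℝ)^k⌋ = n i := congrFun hx i
    have a := Int.floor_le (x i / (2:ℝ)^k)
    have b := Int.lt_floor_add_one (x i / (2:ℝ)^k)
    rw [h] at a b
    rw [le_div_iff₀ h2] at a
    rw [div_lt_iff₀ h2] at b
    simp only [corner, PiLp.sub_apply]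
    rw [abs_le]; constructor <;> nlinarith
  calc ‖x - corner d k n‖ = ‖∑ i, EuclideanSpace.single i ((x - corner d k n) i)‖ := by
        congr 1; ext i; simp [Finset.sum_apply, PiLp.single_apply]
    _ ≤ ∑ i, ‖EuclideanSpace.single i ((x - corner d k n) i)‖ := norm_sum_le _ _
    _ ≤ ∑ i : Fin d, (2:ℝ)^k := Finset.sum_le_sum fun i _ => by
        rw [PiLp.norm_single]; exact hc i
    _ = _ := by simp

lemma cube_vol (d : ℕ) (k : ℤ) (n) : volume (cube d k n) = vk d k := by
  have h2 : (0:ℝ) < 2^k := by positivity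
  have : cube d k n = (WithLp.ofLp : Euc d → (Fin d → ℝ)) ⁻¹' (Set.pi univ fun i => Ico ((2:ℝ)^k * n i) ((2:ℝ)^k * n i + 2^k)) := by
    ext x
    simp only [cube, cx, mem_ofPred_eq, funext_iff, mem_preimage, mem_pi, mem_univ, true_imp_iff]
    refine forall_congr' fun i => ?_
    rw [Int.floor_eq_iff, le_div_iff₀ h2, div_lt_iff₀ h2]
    simp only [mem_Ico]
    constructor <;> rintro ⟨a, b⟩ <;> constructor <;> nlinarith
  rw [this, (PiLp.volume_preserving_ofLp (Fin d)).measure_preimage (MeasurableSet.univ_pi fun _ => measurableSet_Ico).nullMeasurableSet, Real.volume_pi_Ico]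
  simp [vk, ENNReal.ofReal_pow h2.le]

lemma cx_nest {d : ℕ} {k l : ℤ} (h : k ≤ l) {x y : Euc d} (hxy : cx k x = cx k y) : cx l x = cx l y := by
  obtain ⟨m, rfl⟩ := Int.le.dest h
  have key : ∀ z : Euc d, cx (k + m) z = fun i => cx k z i / ((2^m : ℕ):ℤ) := by
    intro z; ext i
    unfold cx
    rw [← Int.floor_div_natCast]
    · congr 1
      rw [zpow_add₀ (by norm_num)]; push_cast; rw [zpow_natCast, div_div]
  rw [key, key, hxy]

lemma lintegral_cubes {d : ℕ} (k : ℤ) {h : Euc d → ℝ≥0∞} (S : Set (Euc d)) (hS : MeasurableSet S) :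
    ∫⁻ x in S, h x = ∑' n, ∫⁻ x in S ∩ cube d k n, h x := by
  rw [← lintegral_iUnion (fun n => hS.inter (cube_meas d k n))]
  · congr 1; congr 1; ext x; simp [cube]
  · intro a b hab
    refine Set.disjoint_left.2 fun x hx hy => hab ?_
    exact hx.2.symm.trans hy.2

/-- density of A at scale k -/
def dn {d : ℕ} (A : Set (Euc d)) (k : ℤ) (x : Euc d) : ℝ≥0∞ := (vk d k)⁻¹ * volume (A ∩ cube d k (cx k x))

lemma dn_meas {d : ℕ} (A : Set (Euc d)) (k : ℤ) : Measurable (dn A k) := by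
  have : dn A k = (fun n => (vk d k)⁻¹ * volume (A ∩ cube d k n)) ∘ cx k := rfl
  rw [this]
  exact (measurable_of_countable _).comp (cx_meas k)

lemma dn_congr {d : ℕ} (A : Set (Euc d)) {k l : ℤ} (h : k ≤ l) {x y : Euc d} (hxy : cx k x = cx k y) : dn A l x = dn A l y := by
  unfold dn; rw [cx_nest h hxy]

lemma dn_large {d : ℕ} (hd : 2 ≤ d) {A : Set (Euc d)} (hA : volume A ≠ ∞) {lam : ℝ≥0∞} (hl : lam ≠ 0) : ∃ K : ℤ, ∀ k, K < k → ∀ x, dn A k x ≤ lam := by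
  rcases eq_or_ne lam ∞ with rfl | hlt
  · exact ⟨0, fun _ _ _ => le_top⟩
  obtain ⟨K, hK⟩ := ENNReal.exists_nat_gt (r := lam⁻¹ * volume A) (ENNReal.mul_ne_top (ENNReal.inv_ne_top.2 hl) hA)
  refine ⟨K, fun k hk x => ?_⟩
  have h1 : (K:ℝ≥0∞) ≤ vk d k := by
    unfold vk
    rw [← ENNReal.ofReal_natCast]
    refine ENNReal.ofReal_le_ofReal ?_
    have : (K:ℝ) ≤ 2^k := by
      calc (K:ℝ) ≤ 2^K := by exact_mod_cast Nat.lt_two_pow_self.le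
        _ = (2:ℝ)^(K:ℤ) := by simp
        _ ≤ 2^k := zpow_le_zpow_right₀ (by norm_num) hk.le
    have o : (1:ℝ) ≤ 2^k := one_le_zpow₀ (by norm_num) (by omega)
    exact this.trans (le_self_pow₀ o (by omega))
  calc dn A k x ≤ (vk d k)⁻¹ * volume A := mul_le_mul' le_rfl (measure_mono inter_subset_left)
    _ ≤ lam := by
      rw [ENNReal.inv_mul_le_iff (vk_ne_zero d k) (vk_ne_top d k)]
      have : volume A = lam * (lam⁻¹ * volume A) := by rw [← mul_assoc, ENNReal.mul_inv_cancel hl hlt, one_mul]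
      rw [this, mul_comm]
      exact mul_le_mul' (hK.le.trans h1) le_rfl

lemma stopping {d : ℕ} (hd : 2 ≤ d) {h : ℤ → Euc d → ℝ≥0∞} {C : ℝ≥0∞}
    (Carl : ∀ N n, ∑' k : ℤ, (if k ≤ N then ∫⁻ x in cube d N n, h k x else 0) ≤ C * vk d N)
    {A : Set (Euc d)} (hA : MeasurableSet A) (hAf : volume A ≠ ∞) {lam : ℝ≥0∞} (hl : lam ≠ 0) (hlt : lam ≠ ∞) :
    ∑' k : ℤ, ∫⁻ x in {x | lam < dn A k x}, h k x ≤ C * (lam⁻¹ * volume A) := by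
  obtain ⟨K, hK⟩ := dn_large hd hAf hl
  set T : ℤ → Set (Euc d) := fun N => {x | lam < dn A N x ∧ ∀ N', N < N' → dn A N' x ≤ lam} with hT
  have hTm : ∀ N, MeasurableSet (T N) := by
    intro N
    have : T N = {x | lam < dn A N x} ∩ ⋂ N' : ℤ, ⋂ _ : N < N', {x | dn A N' x ≤ lam} := by
      ext x; simp [hT]
    rw [this]
    exact (measurableSet_lt measurable_const (dn_meas A N)).inter (MeasurableSet.iInter fun N' => MeasurableSet.iInter fun _ => measurableSet_le (dn_meas A N') measurable_const)
  have hTd : Pairwise (Function.onFun Disjoint T) := by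
    intro a b hab
    refine Set.disjoint_left.2 fun x hx hy => ?_
    rcases lt_or_gt_of_ne hab with h | h
    · exact absurd hy.1 (not_lt.2 (hx.2 _ h))
    · exact absurd hx.1 (not_lt.2 (hy.2 _ h))
  have hTcov : ∀ k x, lam < dn A k x → ∃ N, k ≤ N ∧ x ∈ T N := by
    intro k x hx
    obtain ⟨N, hN1, hN2⟩ := Int.exists_greatest_of_bdd (P := fun N => lam < dn A N x) ⟨K, fun z hz => by
      by_contra hh; exact absurd hz (not_lt.2 (hK z (not_le.1 hh) x))⟩ ⟨k, hx⟩
    exact ⟨N, hN2 k hx, hN1, fun N' hN' => not_lt.1 fun hh => absurd (hN2 N' hh) (by omega)⟩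
  have s1 : ∀ k, ∫⁻ x in {x | lam < dn A k x}, h k x ≤ ∑' N : ℤ, if k ≤ N then ∫⁻ x in T N, h k x else 0 := by
    intro k
    calc _ ≤ ∫⁻ x in ⋃ N : ℤ, (if k ≤ N then T N else ∅), h k x := by
          refine lintegral_mono_set fun x hx => ?_
          obtain ⟨N, h1, h2⟩ := hTcov k x hx
          exact mem_iUnion.2 ⟨N, by rw [if_pos h1]; exact h2⟩
      _ ≤ ∑' N : ℤ, ∫⁻ x in (if k ≤ N then T N else ∅), h k x := lintegral_iUnion_le _ _
      _ = _ := by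
          refine tsum_congr fun N => ?_
          split_ifs <;> simp
  have s2 : ∀ N, ∑' k : ℤ, (if k ≤ N then ∫⁻ x in T N, h k x else 0) ≤ C * (lam⁻¹ * volume (A ∩ T N)) := by
    intro N
    have e1 : ∀ n, T N ∩ cube d N n = ∅ ∨ (T N ∩ cube d N n = cube d N n ∧ vk d N ≤ lam⁻¹ * volume (A ∩ T N ∩ cube d N n)) := by
      intro n
      rcases Set.eq_empty_or_nonempty (T N ∩ cube d N n) with he | ⟨x, hx, hxn⟩
      · exact Or.inl he
      · right
        have : T N ∩ cube d N n = cube d N n := by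
          refine inter_eq_right.2 fun y hy => ?_
          have exy : cx N x = cx N y := hxn.trans hy.symm
          refine ⟨?_, fun N' hN' => ?_⟩
          · rw [← dn_congr A le_rfl exy]; exact hx.1
          · rw [← dn_congr A hN'.le exy]; exact hx.2 N' hN'
        refine ⟨this, ?_⟩
        rw [inter_assoc, this]
        have h1 := hx.1
        unfold dn at h1
        rw [show cx N x = n from hxn] at h1
        rw [← ENNReal.div_eq_inv_mul, ENNReal.le_div_iff_mul_le (Or.inl hl) (Or.inl hlt), mul_comm]
        have := h1.le
        rw [← ENNReal.div_eq_inv_mul, ENNReal.le_div_iff_mul_le (Or.inl (vk_ne_zero d N)) (Or.inl (vk_ne_top d N))] at this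
        exact this
    calc ∑' k : ℤ, (if k ≤ N then ∫⁻ x in T N, h k x else 0) 
        = ∑' k : ℤ, ∑' n, (if k ≤ N then ∫⁻ x in T N ∩ cube d N n, h k x else 0) := by
          refine tsum_congr fun k => ?_
          split_ifs
          · exact lintegral_cubes N _ (hTm N)
          · simp
      _ = ∑' n, ∑' k : ℤ, (if k ≤ N then ∫⁻ x in T N ∩ cube d N n, h k x else 0) := ENNReal.tsum_comm
      _ ≤ ∑' n, C * (lam⁻¹ * volume (A ∩ T N ∩ cube d N n)) := by
          refine ENNReal.tsum_le_tsum fun n => ?_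
          rcases e1 n with he | ⟨he, hv⟩
          · rw [he]; simp
          · rw [he]; exact (Carl N n).trans (mul_le_mul' le_rfl hv)
      _ = C * (lam⁻¹ * volume (A ∩ T N)) := by
          rw [ENNReal.tsum_mul_left, ENNReal.tsum_mul_left]
          congr 2
          have := lintegral_cubes (d := d) N (h := fun _ => 1) (A ∩ T N) (hA.inter (hTm N))
          simpa using this.symm
  calc _ ≤ ∑' k : ℤ, ∑' N : ℤ, (if k ≤ N then ∫⁻ x in T N, h k x else 0) := ENNReal.tsum_le_tsum s1
    _ = ∑' N : ℤ, ∑' k : ℤ, (if k ≤ N then ∫⁻ x in T N, h k x else 0) := ENNReal.tsum_comm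
    _ ≤ ∑' N : ℤ, C * (lam⁻¹ * volume (A ∩ T N)) := ENNReal.tsum_le_tsum s2
    _ = C * (lam⁻¹ * ∑' N : ℤ, volume (A ∩ T N)) := by rw [ENNReal.tsum_mul_left, ENNReal.tsum_mul_left]
    _ ≤ _ := by
      refine mul_le_mul' le_rfl (mul_le_mul' le_rfl ?_)
      rw [← measure_iUnion (fun a b hab => (hTd hab).mono inter_subset_right inter_subset_right) (fun N => hA.inter (hTm N))]
      exact measure_mono (iUnion_subset fun N => inter_subset_left)
end
end

section
open MeasureTheory Metric Set
open scoped ENNReal NNReal FourierTransform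
noncomputable section

def hk {d : ℕ} (D : ℝ) (g : Euc d → ℂ) (x : Euc d) : ℝ≥0∞ := 
  ∫⁻ y, ENNReal.ofReal ((D⁻¹)^d) * wt d (D⁻¹ * ‖x - y‖) * ‖g y‖ₑ^2

def tl (d : ℕ) (L : ℝ) : ℝ≥0∞ := ∫⁻ z : Euc d, {z : Euc d | L ≤ ‖z‖}.indicator (fun z => wt d ‖z‖) z

lemma hk_meas {d : ℕ} (D : ℝ) {g : Euc d → ℂ} (hg : Continuous g) : Measurable (hk D g) := by
  have := wt_meas d
  have hg' : Measurable (fun z : Euc d × Euc d => ‖g z.2‖ₑ^2) := ((hg.measurable.comp measurable_snd).enorm).pow_const 2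
  exact Measurable.lintegral_prod_right' (f := fun z : Euc d × Euc d => ENNReal.ofReal ((D⁻¹)^d) * wt d (D⁻¹ * ‖z.1 - z.2‖) * ‖g z.2‖ₑ^2) (by fun_prop)

lemma hk_int {d : ℕ} {D : ℝ} (hD : 0 < D) {g : Euc d → ℂ} (hg : Continuous g) : 
    ∫⁻ x, hk D g x = (∫⁻ x : Euc d, wt d ‖x‖) * ∫⁻ y, ‖g y‖ₑ^2 := by
  unfold hk
  have := wt_meas d
  rw [lintegral_lintegral_swap (by
    have hg' : Measurable (fun z : Euc d × Euc d => ‖g z.2‖ₑ^2) := ((hg.measurable.comp measurable_snd).enorm).pow_const 2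
    exact Measurable.aemeasurable (by fun_prop)), ← lintegral_const_mul _ (by fun_prop)]
  refine lintegral_congr fun y => ?_
  rw [lintegral_mul_const _ (by fun_prop)]
  congr 1
  rw [← wt_int_one (inv_pos.2 hD) y]
  simp only [norm_sub_rev]

lemma bQ_le_hk {d : ℕ} (k : ℤ) (n) (g : Euc d → ℂ) : 
    bQ ((2:ℝ)^k) (corner d k n) g ≤ ENNReal.ofReal ((1 + d)^(d+1)) * ∫⁻ x in cube d k n, hk ((2:ℝ)^k) g x := by
  set D := (2:ℝ)^k with hD
  have hD0 : 0 < D := by positivity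
  have hw := wt_meas d
  have pt : ∀ x ∈ cube d k n, (vk d k)⁻¹ * bQ D (corner d k n) g ≤ ENNReal.ofReal ((1 + d)^(d+1)) * hk D g x := by
    intro x hx
    have hx' : ‖x - corner d k n‖ ≤ d * D := by rw [← dist_eq_norm]; exact cube_ball k n hx
    unfold bQ hk
    rw [← lintegral_const_mul' _ _ (ENNReal.inv_ne_top.2 (vk_ne_zero d k)), ← lintegral_const_mul' _ _ (by finiteness)]
    refine lintegral_mono fun y => ?_
    have h1 := wt_mul d (u := D⁻¹ * ‖x - y‖) (v := D⁻¹ * ‖y - corner d k n‖) (c := 1 + d) (by positivity) (by positivity) (by positivity) (by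
      have : ‖x - y‖ ≤ ‖x - corner d k n‖ + ‖y - corner d k n‖ := by
        calc _ = ‖(x - corner d k n) - (y - corner d k n)‖ := by congr 1; abel
          _ ≤ _ := norm_sub_le _ _
      have h2 : D⁻¹ * ‖x - y‖ ≤ d + D⁻¹ * ‖y - corner d k n‖ := by
        calc _ ≤ D⁻¹ * (d * D + ‖y - corner d k n‖) := by gcongr; linarith
          _ = _ := by field_simp
      have h3 : 0 ≤ D⁻¹ * ‖y - corner d k n‖ := by positivity
      nlinarith [(Nat.cast_nonneg d : (0:ℝ) ≤ d)])
    have e : (vk d k)⁻¹ = ENNReal.ofReal ((D⁻¹)^d) := by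
      unfold vk; rw [← ENNReal.ofReal_inv_of_pos (by positivity), inv_pow]
    rw [e]
    calc _ = ENNReal.ofReal ((D⁻¹)^d) * ‖g y‖ₑ^2 * wt d (D⁻¹ * ‖y - corner d k n‖) := by ring
      _ ≤ ENNReal.ofReal ((D⁻¹)^d) * ‖g y‖ₑ^2 * (ENNReal.ofReal ((1 + d)^(d+1)) * wt d (D⁻¹ * ‖x - y‖)) := mul_le_mul' le_rfl h1
      _ = _ := by ring
  calc bQ D (corner d k n) g = ∫⁻ x in cube d k n, (vk d k)⁻¹ * bQ D (corner d k n) g := by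
        rw [lintegral_const, Measure.restrict_apply_univ, cube_vol, mul_comm, ← mul_assoc, ENNReal.mul_inv_cancel (vk_ne_zero d k) (vk_ne_top d k), one_mul]
    _ ≤ ∫⁻ x in cube d k n, ENNReal.ofReal ((1 + d)^(d+1)) * hk D g x := setLIntegral_mono' (cube_meas d k n) pt
    _ = _ := lintegral_const_mul' _ _ (by finiteness)

lemma tl_bound (d : ℕ) : ∃ C : ℝ≥0∞, C ≠ ∞ ∧ ∀ L : ℝ, 1 ≤ L → tl d L ≤ C * ENNReal.ofReal (L^(-(1/2:ℝ))) := by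
  refine ⟨∫⁻ x : Euc d, ENNReal.ofReal ((1 + ‖x‖)^(-((d:ℝ)+1/2))), (finite_integral_one_add_norm (μ := (volume : Measure (Euc d))) (r := (d:ℝ)+1/2) (by simp)).ne, fun L hL => ?_⟩
  rw [← lintegral_mul_const' _ _ (by finiteness)]
  refine lintegral_mono fun z => ?_
  by_cases hz : L ≤ ‖z‖
  · rw [indicator_of_mem (by exact hz)]
    unfold wt
    rw [← ENNReal.ofReal_mul (by positivity)]
    refine ENNReal.ofReal_le_ofReal ?_
    have : ((1 + ‖z‖)^(d+1))⁻¹ = (1 + ‖z‖)^(-((d:ℝ)+1/2)) * (1 + ‖z‖)^(-(1/2:ℝ)) := by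
      rw [← Real.rpow_add (by positivity), ← Real.rpow_natCast, ← Real.rpow_neg (by positivity)]
      congr 1; push_cast; ring
    rw [this]
    refine mul_le_mul_of_nonneg_left ?_ (by positivity)
    exact Real.rpow_le_rpow_of_nonpos (by positivity) (by linarith) (by norm_num)
  · rw [indicator_of_notMem (by exact hz)]; exact zero_le

lemma tl_scale {d : ℕ} {R : ℝ} (hR : 0 < R) (D : ℝ) (x : Euc d) : 
    ∫⁻ y, {y : Euc d | D ≤ ‖x - y‖}.indicator (fun y => ENNReal.ofReal (R^d) * wt d (R * ‖x - y‖)) y = tl d (R * D) := by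
  have := lintegral_sub_left_eq_self (μ := (volume : Measure (Euc d))) (fun z => {z : Euc d | D ≤ ‖z‖}.indicator (fun z => ENNReal.ofReal (R^d) * wt d (R * ‖z‖)) z) x
  have e : ∀ y, {y : Euc d | D ≤ ‖x - y‖}.indicator (fun y => ENNReal.ofReal (R^d) * wt d (R * ‖x - y‖)) y = {z : Euc d | D ≤ ‖z‖}.indicator (fun z => ENNReal.ofReal (R^d) * wt d (R * ‖z‖)) (x - y) := by
    intro y; simp only [indicator]; rfl
  simp only [e]
  rw [this]
  unfold tl
  have h2 := lintegral_smul_comp (fun z : Euc d => {z : Euc d | R * D ≤ ‖z‖}.indicator (fun z => wt d ‖z‖) z) hR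
  have e2 : ∀ z : Euc d, {z : Euc d | D ≤ ‖z‖}.indicator (fun z => ENNReal.ofReal (R^d) * wt d (R * ‖z‖)) z = ENNReal.ofReal (R^d) * {z : Euc d | R * D ≤ ‖z‖}.indicator (fun z => wt d ‖z‖) (R • z) := by
    intro z
    simp only [indicator, mem_ofPred_eq, norm_smul, Real.norm_of_nonneg hR.le]
    by_cases h : D ≤ ‖z‖
    · rw [if_pos h, if_pos (by gcongr)]
    · rw [if_neg h, if_neg (by push Not at h ⊢; gcongr), mul_zero]
  simp only [e2]
  rw [lintegral_const_mul' _ _ (by finiteness), h2, ← mul_assoc, ← ENNReal.ofReal_mul (by positivity), mul_inv_cancel₀ (by positivity)]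
  simp

/-- overlap of the LP pieces -/
lemma lp_overlap {d : ℕ} {β₀ : ℝ → ℝ} (hβ : IsBump β₀) : ∃ C : ℝ≥0∞, C ≠ ∞ ∧ ∀ (j : ℤ) (f : Euc d → ℂ), Integrable f → MemLp f 2 →
    ∑' k : ℤ, ∫⁻ y, ‖homLP d β₀ (j - k) f y‖ₑ^2 ≤ C * ∫⁻ y, ‖f y‖ₑ^2 := by
  have hs := bs0_smooth (d := d) hβ one_pos two_pos
  have hc := bs0_cs (d := d) hβ one_pos one_lt_two
  obtain ⟨M, hM, hb⟩ := exists_ne_top_of_bdd hs.continuous hc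
  refine ⟨3 * M^2, by finiteness, fun j f hf hf2 => ?_⟩
  have hfc := fourier_continuous hf
  have e1 : ∀ k : ℤ, ∫⁻ y, ‖homLP d β₀ (j - k) f y‖ₑ^2 = ∫⁻ ξ, ‖bs0 d β₀ 1 2 (((2:ℝ)^(j-k))⁻¹ • ξ)‖ₑ^2 * ‖𝓕 f ξ‖ₑ^2 := by
    intro k
    rw [homLP_eq, symT_plancherel hs.continuous hc (by positivity) hf]
    simp only [enorm_mul, mul_pow]
  simp only [e1]
  rw [← lintegral_tsum (fun k => by
    have := hs.continuous
    exact Measurable.aemeasurable (by fun_prop)), ← plancherel hf hf2, ← lintegral_const_mul' _ _ (by finiteness)]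
  refine lintegral_mono fun ξ => ?_
  simp only [ENNReal.tsum_mul_right]
  refine mul_le_mul' ?_ le_rfl
  have hsupp : ∀ k : ℤ, bs0 d β₀ 1 2 (((2:ℝ)^(j-k))⁻¹ • ξ) ≠ 0 → ‖ξ‖ ≤ (2:ℝ)^(j-k) ∧ (2:ℝ)^(j-k) ≤ 4 * ‖ξ‖ := by
    intro k hk
    have h2 : (0:ℝ) < 2^(j-k) := by positivity
    have := bs0_supp hβ one_pos one_lt_two _ hk
    rw [norm_smul, norm_inv, Real.norm_of_nonneg h2.le, one_mul, inv_mul_le_iff₀ h2, ← div_eq_inv_mul, ← mul_div_assoc, le_div_iff₀ h2] at this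
    constructor <;> linarith [this.1, this.2]
  by_cases hξ : ξ = 0
  · have : ∀ k : ℤ, bs0 d β₀ 1 2 (((2:ℝ)^(j-k))⁻¹ • ξ) = 0 := by
      intro k; by_contra hne
      have h1 := (hsupp k hne).2
      rw [hξ, norm_zero, mul_zero] at h1
      have h2 : (0:ℝ) < 2^(j-k) := by positivity
      linarith
    simp [this]
  · obtain ⟨a, ha1, ha2⟩ := exists_mem_Ico_zpow (norm_pos_iff.2 hξ) (one_lt_two : (1:ℝ) < 2)
    rw [tsum_eq_sum (s := Finset.Ioc (j - a - 3) (j - a)) (fun k hk => by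
      by_contra hne
      have hne' : bs0 d β₀ 1 2 (((2:ℝ)^(j-k))⁻¹ • ξ) ≠ 0 := fun h0 => hne (by rw [h0]; simp)
      obtain ⟨h1, h2⟩ := hsupp k hne'
      have h3 : a ≤ j - k := (zpow_le_zpow_iff_right₀ (one_lt_two : (1:ℝ) < 2)).1 (ha1.trans h1)
      have h4 : (2:ℝ)^(j-k) < 2^(a+3) := by
        calc _ ≤ 4 * ‖ξ‖ := h2
          _ < 4 * 2^(a+1) := by linarith
          _ = 2^(a+3) := by rw [zpow_add₀ two_ne_zero, zpow_add₀ two_ne_zero]; norm_num; ring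
      have h5 : j - k < a + 3 := (zpow_lt_zpow_iff_right₀ (one_lt_two : (1:ℝ) < 2)).1 h4
      apply hk; rw [Finset.mem_Ioc]; constructor <;> omega)]
    refine (Finset.sum_le_card_nsmul _ _ (M^2) (fun k _ => pow_le_pow_left' (hb _) 2)).trans (le_of_eq ?_)
    rw [Int.card_Ioc, nsmul_eq_mul, show j - a - (j - a - 3) = 3 by ring]; rfl
end
end

section
open MeasureTheory Metric Set
open scoped ENNReal NNReal FourierTransform
noncomputable section

lemma hk_far {d : ℕ} {G : Euc d → ℂ} (hG : ContDiff ℝ (⊤ : ℕ∞) G) (hc : HasCompactSupport G) : ∃ C : ℝ≥0∞, C ≠ ∞ ∧ 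
    ∀ D₀ D R : ℝ, 0 < D₀ → D₀ ≤ D → 1 ≤ D₀ * R → 0 < R → ∀ f : Euc d → ℂ, Integrable f → (∀ y, ‖f y‖ₑ ≤ 1) → ∀ x, (∀ z, ‖x - z‖ ≤ 2 * D → f z = 0) →
    hk D₀ (symT G R f) x ≤ C * ENNReal.ofReal ((D₀⁻¹ * D)^(-(1/2:ℝ))) := by
  obtain ⟨C0, hC0, h0⟩ := symT_bound hG hc
  obtain ⟨C1, hC1, h1⟩ := symT_sup hG hc
  obtain ⟨Ct, hCt, ht⟩ := tl_bound d
  set I := ∫⁻ x : Euc d, wt d ‖x‖ with hI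
  have hI' : I ≠ ∞ := (wt_int d).ne
  have hw := wt_meas d
  refine ⟨Ct * C1^2 + I * (C0 * Ct)^2, by finiteness, fun D₀ D R hD₀ hD hDR hR f hf hf1 x hx => ?_⟩
  set L := D₀⁻¹ * D with hL
  have hL1 : 1 ≤ L := by rw [hL, ← div_eq_inv_mul, one_le_div hD₀]; exact hD
  set q := ENNReal.ofReal (L^(-(1/2:ℝ))) with hq
  have hq1 : q ≤ 1 := by
    rw [hq, ENNReal.ofReal_le_one]; exact Real.rpow_le_one_of_one_le_of_nonpos hL1 (by norm_num)
  have hLR : L ≤ R * D := by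
    rw [hL]
    refine mul_le_mul_of_nonneg_right ?_ (by linarith)
    rw [inv_le_iff_one_le_mul₀ hD₀]; linarith
  set w : Euc d → ℝ≥0∞ := fun y => ENNReal.ofReal ((D₀⁻¹)^d) * wt d (D₀⁻¹ * ‖x - y‖) with hwd
  have pt : ∀ y, w y * ‖symT G R f y‖ₑ^2 ≤ {y : Euc d | D ≤ ‖x - y‖}.indicator w y * C1^2 + w y * ((C0 * Ct)^2 * q) := by
    intro y
    by_cases hy : D ≤ ‖x - y‖
    · rw [indicator_of_mem (by exact hy)]
      refine le_add_right (mul_le_mul' le_rfl (pow_le_pow_left' ?_ 2))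
      simpa using h1 R hR f hf 1 hf1 y
    · refine le_add_left (mul_le_mul' le_rfl ?_)
      have : ‖symT G R f y‖ₑ ≤ C0 * (Ct * q) := by
        refine (h0 R hR f hf y).trans (mul_le_mul' le_rfl ?_)
        calc _ ≤ ∫⁻ z, {z : Euc d | D ≤ ‖y - z‖}.indicator (fun z => ENNReal.ofReal (R^d) * wt d (R * ‖y - z‖)) z := by
              refine lintegral_mono fun z => ?_
              by_cases hz : D ≤ ‖y - z‖
              · rw [indicator_of_mem (by exact hz)]
                calc _ ≤ ENNReal.ofReal (R^d) * wt d (R * ‖y - z‖) * 1 := mul_le_mul' (mul_le_mul' le_rfl (wt2_le R hR y z)) (hf1 z)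
                  _ = _ := mul_one _
              · rw [hx z]
                · simp
                · calc ‖x - z‖ = ‖(x - y) + (y - z)‖ := by congr 1; abel
                    _ ≤ ‖x - y‖ + ‖y - z‖ := norm_add_le _ _
                    _ ≤ 2 * D := by linarith
          _ = tl d (R * D) := tl_scale hR D y
          _ ≤ Ct * ENNReal.ofReal ((R * D)^(-(1/2:ℝ))) := ht _ (hL1.trans hLR)
          _ ≤ Ct * q := mul_le_mul' le_rfl (ENNReal.ofReal_le_ofReal (Real.rpow_le_rpow_of_nonpos (by positivity) hLR (by norm_num)))
      calc _ ≤ (C0 * (Ct * q))^2 := pow_le_pow_left' this 2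
        _ = (C0 * Ct)^2 * (q * q) := by ring
        _ ≤ (C0 * Ct)^2 * (q * 1) := mul_le_mul' le_rfl (mul_le_mul' le_rfl hq1)
        _ = _ := by rw [mul_one]
  have wm : Measurable w := by fun_prop
  have hDm : MeasurableSet {y : Euc d | D ≤ ‖x - y‖} := measurableSet_le measurable_const (by fun_prop)
  calc hk D₀ (symT G R f) x ≤ ∫⁻ y, ({y : Euc d | D ≤ ‖x - y‖}.indicator w y * C1^2 + w y * ((C0 * Ct)^2 * q)) := lintegral_mono pt
    _ = tl d L * C1^2 + I * ((C0 * Ct)^2 * q) := by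
      rw [lintegral_add_left ((wm.indicator hDm).mul_const _), lintegral_mul_const _ (wm.indicator hDm), lintegral_mul_const _ wm, tl_scale (inv_pos.2 hD₀), wt_int_one (inv_pos.2 hD₀)]
    _ ≤ Ct * q * C1^2 + I * ((C0 * Ct)^2 * q) := by
      refine add_le_add (mul_le_mul' (ht L hL1) le_rfl) le_rfl
    _ = _ := by ring

lemma hk_add {d : ℕ} (D : ℝ) {u v : Euc d → ℂ} (hu : Continuous u) (x : Euc d) :
    hk D (fun y => u y + v y) x ≤ 2 * hk D u x + 2 * hk D v x := by
  have hw := wt_meas d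
  unfold hk
  rw [← lintegral_const_mul' _ _ (by norm_num), ← lintegral_const_mul' _ _ (by norm_num), ← lintegral_add_left (by fun_prop)]
  refine lintegral_mono fun y => ?_
  calc _ ≤ ENNReal.ofReal (D⁻¹ ^ d) * wt d (D⁻¹ * ‖x - y‖) * (2 * (‖u y‖ₑ^2 + ‖v y‖ₑ^2)) := 
        mul_le_mul' le_rfl ((pow_le_pow_left' (enorm_add_le _ _) 2).trans (add_sq_le_enn _ _))
    _ = _ := by ring

lemma geo_le : ∃ C : ℝ≥0∞, C ≠ ∞ ∧ ∀ N : ℤ, ∑' k : ℤ, (if k ≤ N then ENNReal.ofReal ((((2:ℝ)^k)⁻¹ * 2^N)^(-(1/2:ℝ))) else 0) ≤ C := by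
  have hq : ENNReal.ofReal ((2:ℝ)^(-(1/2:ℝ))) < 1 := by
    rw [ENNReal.ofReal_lt_one]; exact Real.rpow_lt_one_of_one_lt_of_neg (by norm_num) (by norm_num)
  refine ⟨∑' e : ℕ, ENNReal.ofReal ((2:ℝ)^(-(1/2:ℝ)))^e, ?_, fun N => le_of_eq ?_⟩
  · rw [ENNReal.tsum_geometric]
    exact ENNReal.inv_ne_top.2 (tsub_pos_of_lt hq).ne'
  · have inj : Function.Injective (fun e : ℕ => N - (e:ℤ)) := fun a b h => by simpa using h
    rw [← inj.tsum_eq]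
    · refine tsum_congr fun e => ?_
      rw [if_pos (by omega), ← ENNReal.ofReal_pow (by positivity)]
      congr 1
      rw [← zpow_neg, ← zpow_add₀ two_ne_zero, show -(N - (e:ℤ)) + N = e by ring, zpow_natCast, ← Real.rpow_natCast, ← Real.rpow_natCast, ← Real.rpow_mul (by norm_num), ← Real.rpow_mul (by norm_num), mul_comm]
    · intro k hk
      by_cases h : k ≤ N
      · exact ⟨(N - k).toNat, by simp only; omega⟩
      · exact absurd (if_neg h) hk

lemma memLp2 {d : ℕ} {f : Euc d → ℂ} (hf : Integrable f) (h1 : ∀ y, ‖f y‖ₑ ≤ 1) : MemLp f 2 := by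
  refine ⟨hf.1, ?_⟩
  rw [eLpNorm_lt_top_iff_lintegral_rpow_enorm_lt_top (by norm_num) (by norm_num)]
  refine lt_of_le_of_lt (lintegral_mono (g := fun y => ‖f y‖ₑ) fun y => ?_) hf.2
  simp only [ENNReal.toReal_ofNat, ENNReal.rpow_two, pow_two]
  exact mul_le_of_le_one_right' (h1 y)

lemma carleson {d : ℕ} {β₀ : ℝ → ℝ} (hβ : IsBump β₀) : ∃ C : ℝ≥0∞, C ≠ ∞ ∧ ∀ (j : ℤ), 0 ≤ j → ∀ (f : Euc d → ℂ), Integrable f → (∀ y, ‖f y‖ₑ ≤ 1) → ∀ N n,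
    ∑' k : ℤ, (if k ≤ N then ∫⁻ x in cube d N n, hk ((2:ℝ)^k) (homLP d β₀ (j - k) f) x else 0) ≤ C * vk d N := by
  have hs := bs0_smooth (d := d) hβ one_pos two_pos
  have hc := bs0_cs (d := d) hβ one_pos one_lt_two
  obtain ⟨C1, hC1, h1⟩ := hk_far hs hc
  obtain ⟨C2, hC2, h2⟩ := geo_le
  obtain ⟨C3, hC3, h3⟩ := lp_overlap (d := d) hβ
  set I := ∫⁻ x : Euc d, wt d ‖x‖ with hI
  have hI' : I ≠ ∞ := (wt_int d).ne
  set Vb := ENNReal.ofReal (((d:ℝ)+2)^d) * volume (ball (0 : Euc d) 1) with hVb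
  have hVb' : Vb ≠ ∞ := ENNReal.mul_ne_top (by finiteness) measure_ball_lt_top.ne
  refine ⟨2 * I * C3 * Vb + 2 * C1 * C2, by finiteness, fun j hj f hf hf1 N n => ?_⟩
  set c := corner d N n
  set D := (2:ℝ)^N with hD
  have hD0 : 0 < D := by positivity
  set B := closedBall c ((d+2) * D) with hB
  have hBm : MeasurableSet B := measurableSet_closedBall
  have i1 := hf.indicator hBm
  have i2 := hf.indicator hBm.compl
  have b1 : ∀ y, ‖B.indicator f y‖ₑ ≤ 1 := fun y => (enorm_indicator_le_enorm_self _ _).trans (hf1 y)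
  have b2 : ∀ y, ‖Bᶜ.indicator f y‖ₑ ≤ 1 := fun y => (enorm_indicator_le_enorm_self _ _).trans (hf1 y)
  have hsplit : f = fun y => B.indicator f y + Bᶜ.indicator f y := by
    ext y; by_cases hy : y ∈ B <;> simp [hy]
  have hadd : ∀ k : ℤ, homLP d β₀ (j - k) f = fun x => homLP d β₀ (j-k) (B.indicator f) x + homLP d β₀ (j-k) (Bᶜ.indicator f) x := by
    intro k
    ext x
    rw [homLP_eq, homLP_eq, homLP_eq, ← symT_add hs.continuous hc (by positivity) i1 i2, ← hsplit]
  have hcont : ∀ k : ℤ, Continuous (homLP d β₀ (j-k) (B.indicator f)) := by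
    intro k; rw [homLP_eq]; exact symT_continuous hs.continuous hc (by positivity) i1
  have term : ∀ k : ℤ, (if k ≤ N then ∫⁻ x in cube d N n, hk ((2:ℝ)^k) (homLP d β₀ (j - k) f) x else 0) ≤
      2 * I * (∫⁻ y, ‖homLP d β₀ (j-k) (B.indicator f) y‖ₑ^2) + 2 * C1 * vk d N * (if k ≤ N then ENNReal.ofReal ((((2:ℝ)^k)⁻¹ * 2^N)^(-(1/2:ℝ))) else 0) := by
    intro k
    split_ifs with hkN
    · set q := ENNReal.ofReal ((((2:ℝ)^k)⁻¹ * 2^N)^(-(1/2:ℝ))) with hq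
      have far : ∀ x ∈ cube d N n, hk ((2:ℝ)^k) (homLP d β₀ (j-k) (Bᶜ.indicator f)) x ≤ C1 * q := by
        intro x hx
        rw [homLP_eq]
        refine h1 _ D _ (by positivity) (zpow_le_zpow_right₀ (by norm_num) hkN) ?_ (by positivity) _ i2 b2 x ?_
        · rw [← zpow_add₀ two_ne_zero]; exact one_le_zpow₀ (by norm_num) (by omega)
        · intro z hz
          refine indicator_of_notMem ?_ _
          rw [notMem_compl_iff, hB, mem_closedBall, dist_eq_norm]
          have hx' : ‖x - c‖ ≤ d * D := by rw [← dist_eq_norm]; exact cube_ball N n hx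
          calc ‖z - c‖ = ‖(x - c) - (x - z)‖ := by congr 1; abel
            _ ≤ ‖x - c‖ + ‖x - z‖ := norm_sub_le _ _
            _ ≤ _ := by linarith
      calc _ ≤ ∫⁻ x in cube d N n, (2 * hk ((2:ℝ)^k) (homLP d β₀ (j-k) (B.indicator f)) x + 2 * (C1 * q)) := by
            refine setLIntegral_mono' (cube_meas d N n) fun x hx => ?_
            rw [hadd]
            exact (hk_add _ (hcont k) x).trans (add_le_add le_rfl (mul_le_mul' le_rfl (far x hx)))
        _ = 2 * (∫⁻ x in cube d N n, hk ((2:ℝ)^k) (homLP d β₀ (j-k) (B.indicator f)) x) + 2 * (C1 * q) * vk d N := by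
            rw [lintegral_add_right _ measurable_const, lintegral_const_mul' _ _ (by norm_num), lintegral_const, Measure.restrict_apply_univ, cube_vol]
        _ ≤ 2 * (I * ∫⁻ y, ‖homLP d β₀ (j-k) (B.indicator f) y‖ₑ^2) + 2 * (C1 * q) * vk d N := by
            refine add_le_add (mul_le_mul' le_rfl ?_) le_rfl
            rw [← hk_int (D := (2:ℝ)^k) (by positivity) (hcont k)]
            exact setLIntegral_le_lintegral _ _
        _ = _ := by ring
    · exact zero_le
  have hvol : ∫⁻ y, ‖B.indicator f y‖ₑ^2 ≤ Vb * vk d N := by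
    calc _ ≤ ∫⁻ y, B.indicator (fun _ => 1) y := by
          refine lintegral_mono fun y => ?_
          by_cases hy : y ∈ B
          · simp only [indicator_of_mem hy]; exact pow_le_one' (hf1 y) 2
          · simp [hy]
      _ = volume B := by rw [lintegral_indicator hBm]; simp
      _ = Vb * vk d N := by
          rw [hB, Measure.addHaar_closedBall _ _ (by positivity), hVb, vk, mul_pow, ENNReal.ofReal_mul (by positivity)]
          simp only [finrank_euclideanSpace, Fintype.card_fin]
          ring
  calc _ ≤ ∑' k : ℤ, (2 * I * (∫⁻ y, ‖homLP d β₀ (j-k) (B.indicator f) y‖ₑ^2) + 2 * C1 * vk d N * (if k ≤ N then ENNReal.ofReal ((((2:ℝ)^k)⁻¹ * 2^N)^(-(1/2:ℝ))) else 0)) := ENNReal.tsum_le_tsum term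
    _ = 2 * I * (∑' k : ℤ, ∫⁻ y, ‖homLP d β₀ (j-k) (B.indicator f) y‖ₑ^2) + 2 * C1 * vk d N * ∑' k : ℤ, (if k ≤ N then ENNReal.ofReal ((((2:ℝ)^k)⁻¹ * 2^N)^(-(1/2:ℝ))) else 0) := by
        rw [ENNReal.tsum_add, ENNReal.tsum_mul_left, ENNReal.tsum_mul_left]
    _ ≤ 2 * I * (C3 * (Vb * vk d N)) + 2 * C1 * vk d N * C2 := by
        refine add_le_add (mul_le_mul' le_rfl ?_) (mul_le_mul' le_rfl (h2 N))
        exact (h3 j _ i1 (memLp2 i1 b1)).trans (mul_le_mul' le_rfl hvol)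
    _ = _ := by ring
end
end

section
open MeasureTheory Metric Set
open scoped ENNReal NNReal FourierTransform
noncomputable section

lemma geoZ {δ : ℝ} (hδ : 0 < δ) : ∃ C : ℝ≥0∞, C ≠ ∞ ∧ ∀ l : ℤ, ∑' i : ℤ, (2:ℝ≥0∞)^(-δ * |(i:ℝ) - l|) ≤ C := by
  have hq : (2:ℝ≥0∞)^(-δ) < 1 := ENNReal.rpow_lt_one_of_one_lt_of_neg (by norm_num) (by linarith)
  have hC : ∑' e : ℕ, ((2:ℝ≥0∞)^(-δ))^e ≠ ∞ := by
    rw [ENNReal.tsum_geometric]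
    exact ENNReal.inv_ne_top.2 (tsub_pos_of_lt hq).ne'
  refine ⟨2 * ∑' e : ℕ, ((2:ℝ≥0∞)^(-δ))^e, ENNReal.mul_ne_top (by norm_num) hC, fun l => ?_⟩
  have e1 : ∑' i : ℤ, (2:ℝ≥0∞)^(-δ * |(i:ℝ) - l|) = ∑' i : ℤ, (2:ℝ≥0∞)^(-δ * |(i:ℝ)|) := by
    rw [← (Equiv.addRight l).tsum_eq]
    refine tsum_congr fun i => ?_
    simp
  rw [e1]
  have key : ∀ e : ℕ, (2:ℝ≥0∞)^(-δ * e) = ((2:ℝ≥0∞)^(-δ))^e := fun e => by rw [ENNReal.rpow_mul, ENNReal.rpow_natCast]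
  have hs1 : HasSum (fun e : ℕ => (2:ℝ≥0∞)^(-δ * |(((e:ℕ):ℤ):ℝ)|)) (∑' e : ℕ, ((2:ℝ≥0∞)^(-δ))^e) := by
    have : (fun e : ℕ => (2:ℝ≥0∞)^(-δ * |(((e:ℕ):ℤ):ℝ)|)) = fun e : ℕ => ((2:ℝ≥0∞)^(-δ))^e := by
      ext e; rw [← key]; simp
    rw [this]; exact ENNReal.summable.hasSum
  have hs2 := ENNReal.summable.hasSum (f := fun e : ℕ => (2:ℝ≥0∞)^(-δ * |((-((e:ℕ)+1:ℤ):ℤ):ℝ)|))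
  rw [(HasSum.of_nat_of_neg_add_one (f := fun i : ℤ => (2:ℝ≥0∞)^(-δ * |(i:ℝ)|)) hs1 hs2).tsum_eq, two_mul]
  refine add_le_add le_rfl (ENNReal.tsum_le_tsum fun e => ?_)
  rw [← key]
  refine ENNReal.rpow_le_rpow_of_exponent_le (by norm_num) ?_
  have : |((-((e:ℕ)+1:ℤ):ℤ):ℝ)| = (e:ℝ) + 1 := by
    push_cast; rw [abs_neg, abs_of_nonneg (by positivity)]
  rw [this]; nlinarith

lemma ph_sum {d : ℕ} (hd : 2 ≤ d) {θ : ℝ} (h1 : 2 / ((d:ℝ)+1) < θ) (h2 : θ < 1) : ∃ C : ℝ≥0∞, C ≠ ∞ ∧ 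
    ∑' i : ℤ, ph d ((2:ℝ≥0∞)^(i+1)) * ((2:ℝ≥0∞)^(-i))^θ ≤ C := by
  have hd' : (2:ℝ) ≤ d := by exact_mod_cast hd
  set a := 2 / ((d:ℝ)+1) with ha
  have ha0 : 0 < a := by positivity
  have ha1 : a < 1 := h1.trans h2
  set δ := min (θ - a) (1 - θ) with hδ
  have hδ0 : 0 < δ := lt_min (by linarith) (by linarith)
  have hδ1 : δ ≤ θ - a := min_le_left _ _
  have hδ2 : δ ≤ 1 - θ := min_le_right _ _
  obtain ⟨C, hC, h⟩ := geoZ hδ0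
  refine ⟨4 * C, by finiteness, ?_⟩
  refine le_trans ?_ (mul_le_mul' le_rfl (h 0))
  rw [← ENNReal.tsum_mul_left]
  refine ENNReal.tsum_le_tsum fun i => ?_
  have z : ∀ m : ℤ, (2:ℝ≥0∞)^m = (2:ℝ≥0∞)^(m:ℝ) := fun m => (ENNReal.rpow_intCast _ _).symm
  have f4 : (4:ℝ≥0∞) = (2:ℝ≥0∞)^(2:ℝ) := by rw [ENNReal.rpow_two]; norm_num
  unfold ph
  rw [← ha, z, z, f4, ← ENNReal.rpow_mul, ← ENNReal.rpow_mul, ← ENNReal.rpow_add _ _ (by norm_num) (by norm_num)]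
  simp only [Int.cast_zero, sub_zero]
  push_cast
  rcases le_or_gt 0 i with hi | hi
  · have hi' : (0:ℝ) ≤ i := by exact_mod_cast hi
    refine (mul_le_mul' (min_le_right _ _) le_rfl).trans ?_
    rw [← ENNReal.rpow_add _ _ (by norm_num) (by norm_num), abs_of_nonneg hi']
    exact ENNReal.rpow_le_rpow_of_exponent_le (by norm_num) (by nlinarith)
  · have hi' : (i:ℝ) < 0 := by exact_mod_cast hi
    refine (mul_le_mul' (min_le_left _ _) le_rfl).trans ?_
    rw [← ENNReal.rpow_add _ _ (by norm_num) (by norm_num), abs_of_neg hi']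
    exact ENNReal.rpow_le_rpow_of_exponent_le (by norm_num) (by nlinarith)

lemma ph_layer {d : ℕ} {u : ℝ≥0∞} (hu : u ≠ ∞) : ph d u ≤ ∑' i : ℤ, ph d ((2:ℝ≥0∞)^(i+1)) * (if (2:ℝ≥0∞)^i < u then 1 else 0) := by
  rcases eq_or_ne u 0 with rfl | h0
  · unfold ph; simp
  · obtain ⟨i, h1, h2⟩ := ENNReal.exists_mem_Ioc_zpow h0 hu (y := 2) (by norm_num) (by norm_num)
    refine le_trans ?_ (ENNReal.le_tsum i)
    rw [if_pos h1, mul_one]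
    exact ph_mono d h2

lemma min_interp {a b : ℝ≥0∞} {θ : ℝ} (h0 : 0 ≤ θ) (h1 : θ ≤ 1) {x : ℝ≥0∞} (ha : x ≤ a) (hb : x ≤ b) : x ≤ a^(1-θ) * b^θ := by
  calc x = x^((1-θ)+θ) := by rw [show (1-θ)+θ = 1 by ring, ENNReal.rpow_one]
    _ = x^(1-θ) * x^θ := ENNReal.rpow_add_of_nonneg _ _ (by linarith) h0
    _ ≤ _ := mul_le_mul' (ENNReal.rpow_le_rpow ha (by linarith)) (ENNReal.rpow_le_rpow hb h0)

/-- square function piece -/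
def Gk (d : ℕ) (χ β₀ : ℝ → ℝ) (j : ℕ) (f : Euc d → ℂ) (k : ℤ) (x : Euc d) : ℝ≥0∞ := ∫⁻ t, ‖Ajk d χ β₀ j k f x t‖ₑ^2

lemma homLP_cont {d : ℕ} {β₀ : ℝ → ℝ} (hβ : IsBump β₀) (m : ℤ) {f : Euc d → ℂ} (hf : Integrable f) : Continuous (homLP d β₀ m f) := by
  rw [homLP_eq]; exact symT_continuous (bs0_smooth (d := d) hβ one_pos two_pos).continuous (bs0_cs (d := d) hβ one_pos one_lt_two) (by positivity) hf

lemma homLP_int {d : ℕ} {β₀ : ℝ → ℝ} (hβ : IsBump β₀) (m : ℤ) {f : Euc d → ℂ} (hf : Integrable f) : Integrable (homLP d β₀ m f) := by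
  rw [homLP_eq]; exact symT_integrable (bs0_smooth (d := d) hβ one_pos two_pos) (bs0_cs (d := d) hβ one_pos one_lt_two) (by positivity) hf

lemma homLP_bdd {d : ℕ} {β₀ : ℝ → ℝ} (hβ : IsBump β₀) (m : ℤ) {f : Euc d → ℂ} (hf : Integrable f) : ∃ M : ℝ, ∀ x, ‖homLP d β₀ m f x‖ ≤ M := by
  rw [homLP_eq]; exact symT_bdd (bs0_smooth (d := d) hβ one_pos two_pos).continuous (bs0_cs (d := d) hβ one_pos one_lt_two) (by positivity) hf

lemma Ajk_cont {d : ℕ} (hd : 2 ≤ d) {χ β₀ : ℝ → ℝ} (hχ : IsCutoff χ) (hβ : IsBump β₀) (j : ℕ) (k : ℤ) {f : Euc d → ℂ} (hf : Integrable f) : 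
    Continuous (fun z : Euc d × ℝ => Ajk d χ β₀ j k f z.1 z.2) := by
  obtain ⟨M, hM⟩ := homLP_bdd hβ ((j:ℤ) - k) hf
  have e := sphAvg_cont_D hd (homLP_cont hβ ((j:ℤ)-k) hf) hM ((2:ℝ)^k)
  have hcχ : Continuous χ := hχ.1.continuous
  have e2 : Continuous (fun z : Euc d × ℝ => (χ z.2 : ℂ)) := by fun_prop
  exact e2.mul e

lemma Gk_meas {d : ℕ} (hd : 2 ≤ d) {χ β₀ : ℝ → ℝ} (hχ : IsCutoff χ) (hβ : IsBump β₀) (j : ℕ) (k : ℤ) {f : Euc d → ℂ} (hf : Integrable f) : 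
    Measurable (Gk d χ β₀ j f k) := by
  have := ((Ajk_cont hd hχ hβ j k hf).measurable.enorm).pow_const 2
  exact this.lintegral_prod_right'
end
end

section
open MeasureTheory Metric Set
open scoped ENNReal NNReal FourierTransform
noncomputable section

lemma ph_meas (d : ℕ) : Measurable (ph d) := by
  unfold ph; exact measurable_id.min (by fun_prop)

lemma Gk_cube {d : ℕ} (hd : 2 ≤ d) {χ β₀ : ℝ → ℝ} (hχ : IsCutoff χ) (hβ : IsBump β₀) : ∃ C : ℝ≥0∞, C ≠ ∞ ∧
    ∀ j : ℕ, ∀ f : Euc d → ℂ, Integrable f → ∀ k : ℤ, ∀ A : Set (Euc d), MeasurableSet A → 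
    ∫⁻ x in A, Gk d χ β₀ j f k x ≤ C * (ENNReal.ofReal (((2:ℝ)^j)^d))⁻¹ * 
      ∫⁻ x, ph d (ENNReal.ofReal (((2:ℝ)^j)^d) * dn A k x) * hk ((2:ℝ)^k) (homLP d β₀ ((j:ℤ) - k) f) x := by
  obtain ⟨C, hC, h⟩ := local_est hd hχ hβ
  refine ⟨C * ENNReal.ofReal ((1 + d)^(d+1)), by finiteness, fun j f hf k A hA => ?_⟩
  set g := homLP d β₀ ((j:ℤ) - k) f with hg
  have hgc : Continuous g := homLP_cont hβ _ hf
  have hDR : (2:ℝ)^k * (2:ℝ)^((j:ℤ) - k) = 2^j := by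
    rw [← zpow_add₀ two_ne_zero, ← zpow_natCast]; congr 1; ring
  set W := ENNReal.ofReal (((2:ℝ)^j)^d) with hW
  have hWi : ENNReal.ofReal ((((2:ℝ)^k * (2:ℝ)^((j:ℤ) - k))^d)⁻¹) = W⁻¹ := by
    rw [hDR, ENNReal.ofReal_inv_of_pos (by positivity)]
  have hWv : ENNReal.ofReal (((2:ℝ)^((j:ℤ) - k))^d) = W * (vk d k)⁻¹ := by
    unfold vk
    rw [← ENNReal.ofReal_inv_of_pos (by positivity), hW, ← ENNReal.ofReal_mul (by positivity), ← hDR]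
    congr 1; rw [mul_pow]; field_simp
  have hWt : W⁻¹ ≠ ∞ := by rw [← hWi]; finiteness
  rw [lintegral_cubes k A hA, ← setLIntegral_univ (f := fun x => ph d (W * dn A k x) * hk ((2:ℝ)^k) g x), lintegral_cubes k univ MeasurableSet.univ, ← ENNReal.tsum_mul_left]
  refine ENNReal.tsum_le_tsum fun n => ?_
  have h1 := h ((2:ℝ)^k) ((2:ℝ)^((j:ℤ) - k)) (by positivity) (by positivity) (by rw [hDR]; exact one_le_pow₀ (by norm_num)) g (homLP_int hβ _ hf) hgc
    (homLP_reproduce hβ _ hf) (corner d k n) (A ∩ cube d k n) (hA.inter (cube_meas d k n)) (inter_subset_right.trans (cube_ball k n)) 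
    ((measure_mono inter_subset_right).trans (cube_vol d k n).le)
  refine h1.trans ?_
  rw [hWi, hWv, univ_inter]
  have e : ∫⁻ x in cube d k n, ph d (W * dn A k x) * hk ((2:ℝ)^k) g x = ph d (W * (vk d k)⁻¹ * volume (A ∩ cube d k n)) * ∫⁻ x in cube d k n, hk ((2:ℝ)^k) g x := by
    rw [← lintegral_const_mul _ (hk_meas _ hgc)]
    refine setLIntegral_congr_fun (cube_meas d k n) fun x hx => ?_
    have : cx k x = n := hx
    simp only [dn, this, mul_assoc]
  rw [e]
  calc _ ≤ C * W⁻¹ * ph d (W * (vk d k)⁻¹ * volume (A ∩ cube d k n)) * (ENNReal.ofReal ((1 + d)^(d+1)) * ∫⁻ x in cube d k n, hk ((2:ℝ)^k) g x) := 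
        mul_le_mul' le_rfl (bQ_le_hk k n g)
    _ = _ := by ring

lemma dn_ne_top {d : ℕ} (A : Set (Euc d)) (k : ℤ) (x : Euc d) : dn A k x ≠ ∞ := by
  unfold dn
  refine ENNReal.mul_ne_top (ENNReal.inv_ne_top.2 (vk_ne_zero d k)) ?_
  refine ne_top_of_le_ne_top ?_ (measure_mono inter_subset_right)
  rw [cube_vol]; exact vk_ne_top d k

lemma restricted {d : ℕ} (hd : 2 ≤ d) {χ β₀ : ℝ → ℝ} (hχ : IsCutoff χ) (hβ : IsBump β₀) {θ : ℝ} (h1 : 2 / ((d:ℝ)+1) < θ) (h2 : θ < 1) : 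
    ∃ C : ℝ≥0∞, C ≠ ∞ ∧ ∀ j : ℕ, ∀ f : Euc d → ℂ, Integrable f → (∀ y, ‖f y‖ₑ ≤ 1) → ∀ A : Set (Euc d), MeasurableSet A → volume A ≠ ∞ →
    ∫⁻ x in A, ∑' k : ℤ, Gk d χ β₀ j f k x ≤ C * ((ENNReal.ofReal (((2:ℝ)^j)^d))⁻¹ * ∫⁻ y, ‖f y‖ₑ^2)^(1-θ) * (volume A)^θ := by
  obtain ⟨C1, hC1, hcube⟩ := Gk_cube hd hχ hβ
  obtain ⟨C2, hC2, hcar⟩ := carleson (d := d) hβ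
  obtain ⟨C3, hC3, hlp⟩ := lp_overlap (d := d) hβ
  obtain ⟨C4, hC4, hph⟩ := ph_sum hd h1 h2
  set I := ∫⁻ x : Euc d, wt d ‖x‖ with hI
  have hI' : I ≠ ∞ := (wt_int d).ne
  have hθ0 : 0 < θ := lt_trans (by positivity) h1
  refine ⟨C1 * ((I * C3)^(1-θ) * C2^θ * C4), ?_, fun j f hf hf1 A hA hAf => ?_⟩
  · have a1 : (I * C3)^(1-θ) ≠ ∞ := ENNReal.rpow_ne_top_of_nonneg (by linarith) (by finiteness)
    have a2 : C2^θ ≠ ∞ := ENNReal.rpow_ne_top_of_nonneg (by linarith) (by finiteness)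
    finiteness
  set W := ENNReal.ofReal (((2:ℝ)^j)^d) with hW
  have hW0 : W ≠ 0 := by rw [hW, ENNReal.ofReal_ne_zero_iff]; positivity
  have hWt : W ≠ ∞ := by rw [hW]; finiteness
  set F := ∫⁻ y, ‖f y‖ₑ^2 with hF
  set h : ℤ → Euc d → ℝ≥0∞ := fun k => hk ((2:ℝ)^k) (homLP d β₀ ((j:ℤ) - k) f) with hh
  have hm : ∀ k, Measurable (h k) := fun k => hk_meas _ (homLP_cont hβ _ hf)
  have tot : ∑' k : ℤ, ∫⁻ x, h k x ≤ I * C3 * F := by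
    have : ∀ k, ∫⁻ x, h k x = I * ∫⁻ y, ‖homLP d β₀ ((j:ℤ) - k) f y‖ₑ^2 := fun k => hk_int (by positivity) (homLP_cont hβ _ hf)
    simp only [this]
    rw [ENNReal.tsum_mul_left, mul_assoc]
    exact mul_le_mul' le_rfl (hlp j f hf (memLp2 hf hf1))
  have level : ∀ i : ℤ, ∑' k : ℤ, ∫⁻ x in {x | W⁻¹ * (2:ℝ≥0∞)^i < dn A k x}, h k x ≤ (I * C3 * F)^(1-θ) * (C2 * (W * (2:ℝ≥0∞)^(-i) * volume A))^θ := by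
    intro i
    refine min_interp hθ0.le h2.le ?_ ?_
    · exact (ENNReal.tsum_le_tsum fun k => setLIntegral_le_lintegral _ _).trans tot
    · have z0 : (2:ℝ≥0∞)^i ≠ 0 := (ENNReal.zpow_pos (by norm_num) (by norm_num) i).ne'
      have zt : (2:ℝ≥0∞)^i ≠ ∞ := ENNReal.zpow_ne_top (by norm_num) (by norm_num) i
      have := stopping hd (h := h) (hcar j (by positivity) f hf hf1) hA hAf (lam := W⁻¹ * (2:ℝ≥0∞)^i) 
        (mul_ne_zero (ENNReal.inv_ne_zero.2 hWt) z0) (ENNReal.mul_ne_top (ENNReal.inv_ne_top.2 hW0) zt)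
      rw [ENNReal.mul_inv (Or.inr zt) (Or.inr z0), inv_inv, ← ENNReal.zpow_neg] at this
      exact this
  have hlv : ∀ i k : ℤ, MeasurableSet {x | W⁻¹ * (2:ℝ≥0∞)^i < dn A k x} := fun i k => measurableSet_lt measurable_const (dn_meas A k)
  have piece : ∀ k, ∫⁻ x, ph d (W * dn A k x) * h k x ≤ ∑' i : ℤ, ph d ((2:ℝ≥0∞)^(i+1)) * ∫⁻ x in {x | W⁻¹ * (2:ℝ≥0∞)^i < dn A k x}, h k x := by
    intro k
    calc _ ≤ ∫⁻ x, ∑' i : ℤ, ph d ((2:ℝ≥0∞)^(i+1)) * {x | W⁻¹ * (2:ℝ≥0∞)^i < dn A k x}.indicator (h k) x := by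
          refine lintegral_mono fun x => ?_
          refine (mul_le_mul' (ph_layer (ENNReal.mul_ne_top hWt (dn_ne_top A k x))) le_rfl).trans (le_of_eq ?_)
          rw [← ENNReal.tsum_mul_right]
          refine tsum_congr fun i => ?_
          rw [mul_assoc]; congr 1
          have : (2:ℝ≥0∞)^i < W * dn A k x ↔ W⁻¹ * (2:ℝ≥0∞)^i < dn A k x := by
            rw [← ENNReal.div_eq_inv_mul, ENNReal.div_lt_iff (Or.inl hW0) (Or.inl hWt), mul_comm]
          simp only [indicator, mem_ofPred_eq, this]
          split_ifs <;> simp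
      _ = _ := by
          rw [lintegral_tsum (fun i => (((hm k).indicator (hlv i k)).const_mul _).aemeasurable)]
          refine tsum_congr fun i => ?_
          rw [lintegral_const_mul _ ((hm k).indicator (hlv i k)), lintegral_indicator (hlv i k)]
  rw [lintegral_tsum (fun k => (Gk_meas hd hχ hβ j k hf).aemeasurable)]
  calc _ ≤ ∑' k : ℤ, C1 * W⁻¹ * ∑' i : ℤ, ph d ((2:ℝ≥0∞)^(i+1)) * ∫⁻ x in {x | W⁻¹ * (2:ℝ≥0∞)^i < dn A k x}, h k x :=
        ENNReal.tsum_le_tsum fun k => (hcube j f hf k A hA).trans (mul_le_mul' le_rfl (piece k))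
    _ = C1 * W⁻¹ * ∑' i : ℤ, ph d ((2:ℝ≥0∞)^(i+1)) * ∑' k : ℤ, ∫⁻ x in {x | W⁻¹ * (2:ℝ≥0∞)^i < dn A k x}, h k x := by
        rw [ENNReal.tsum_mul_left, ENNReal.tsum_comm]
        simp only [ENNReal.tsum_mul_left]
    _ ≤ C1 * W⁻¹ * ∑' i : ℤ, ph d ((2:ℝ≥0∞)^(i+1)) * ((I * C3 * F)^(1-θ) * (C2 * (W * (2:ℝ≥0∞)^(-i) * volume A))^θ) := 
        mul_le_mul' le_rfl (ENNReal.tsum_le_tsum fun i => mul_le_mul' le_rfl (level i))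
    _ = C1 * W⁻¹ * (((I * C3)^(1-θ) * F^(1-θ) * C2^θ * W^θ * (volume A)^θ) * ∑' i : ℤ, ph d ((2:ℝ≥0∞)^(i+1)) * ((2:ℝ≥0∞)^(-i))^θ) := by
        congr 1
        rw [← ENNReal.tsum_mul_left]
        refine tsum_congr fun i => ?_
        rw [ENNReal.mul_rpow_of_nonneg _ _ (by linarith : 0 ≤ 1 - θ), ENNReal.mul_rpow_of_nonneg _ _ hθ0.le, ENNReal.mul_rpow_of_nonneg _ _ hθ0.le, ENNReal.mul_rpow_of_nonneg _ _ hθ0.le]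
        ring
    _ ≤ C1 * W⁻¹ * (((I * C3)^(1-θ) * F^(1-θ) * C2^θ * W^θ * (volume A)^θ) * C4) := mul_le_mul' le_rfl (mul_le_mul' le_rfl hph)
    _ = C1 * ((I * C3)^(1-θ) * C2^θ * C4) * ((W⁻¹ * W^θ) * F^(1-θ)) * (volume A)^θ := by ring
    _ = _ := by
        congr 2
        rw [ENNReal.mul_rpow_of_nonneg _ _ (by linarith : 0 ≤ 1 - θ)]
        congr 1
        rw [ENNReal.inv_rpow, ← ENNReal.rpow_neg, ← ENNReal.rpow_neg_one, ← ENNReal.rpow_add _ _ hW0 hWt]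
        congr 1; ring

/-- restricted weak type bound -/
lemma weak_type {d : ℕ} (hd : 2 ≤ d) {χ β₀ : ℝ → ℝ} (hχ : IsCutoff χ) (hβ : IsBump β₀) {s : ℝ} (hs : ((d:ℝ)+1)/((d:ℝ)-1) < s) : 
    ∃ C : ℝ≥0∞, C ≠ ∞ ∧ ∀ j : ℕ, ∀ f : Euc d → ℂ, Integrable f → (∀ y, ‖f y‖ₑ ≤ 1) → ∀ lam : ℝ≥0∞, lam ≠ 0 → lam ≠ ∞ →
    volume {x | lam < ∑' k : ℤ, Gk d χ β₀ j f k x} ≤ C * (ENNReal.ofReal (((2:ℝ)^j)^d))⁻¹ * (∫⁻ y, ‖f y‖ₑ^2) * lam^(-s) := by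
  have hd' : (2:ℝ) ≤ d := by exact_mod_cast hd
  have hs0 : 1 < s := by
    refine lt_of_le_of_lt ?_ hs
    rw [one_le_div (by linarith)]; linarith
  obtain ⟨C, hC, h⟩ := restricted hd hχ hβ (θ := 1 - s⁻¹) (by
    rw [div_lt_iff₀ (by linarith)] at hs
    have : s⁻¹ < ((d:ℝ)-1)/((d:ℝ)+1) := by
      rw [inv_lt_comm₀ (by linarith) (by apply div_pos <;> linarith), inv_div, div_lt_iff₀ (by linarith)]; exact hs
    have e : ((d:ℝ)-1)/((d:ℝ)+1) = 1 - 2/((d:ℝ)+1) := by field_simp; ring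
    linarith) (by have : 0 < s⁻¹ := by positivity
                  linarith)
  refine ⟨C^s, ENNReal.rpow_ne_top_of_nonneg (by linarith) hC, fun j f hf hf1 lam hl0 hlt => ?_⟩
  set S : Euc d → ℝ≥0∞ := fun x => ∑' k : ℤ, Gk d χ β₀ j f k x with hS
  have hSm : Measurable S := Measurable.tsum fun k => Gk_meas hd hχ hβ j k hf
  have hLm : MeasurableSet {x | lam < S x} := measurableSet_lt measurable_const hSm
  set F := (ENNReal.ofReal (((2:ℝ)^j)^d))⁻¹ * ∫⁻ y, ‖f y‖ₑ^2 with hF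
  have key : ∀ B : Set (Euc d), MeasurableSet B → B ⊆ {x | lam < S x} → volume B ≠ ∞ → volume B ≤ C^s * F * lam^(-s) := by
    intro B hB hBs hBf
    rcases eq_or_ne (volume B) 0 with h0 | h0
    · rw [h0]; exact zero_le
    have h3 : lam * volume B ≤ C * F^s⁻¹ * (volume B)^(1 - s⁻¹) := by
      calc lam * volume B = ∫⁻ x in B, lam := by rw [setLIntegral_const]
        _ ≤ ∫⁻ x in B, S x := setLIntegral_mono hSm fun x hx => (hBs hx).le
        _ ≤ _ := by
            have := h j f hf hf1 B hB hBf
            rw [sub_sub_cancel] at this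
            exact this
    have h4 : volume B = (volume B)^s⁻¹ * (volume B)^(1 - s⁻¹) := by
      rw [← ENNReal.rpow_add _ _ h0 hBf]; simp
    rw [h4, ← mul_assoc] at h3
    have n0 : (volume B)^(1 - s⁻¹) ≠ 0 := by
      intro hz; rw [ENNReal.rpow_eq_zero_iff] at hz; tauto
    have nt : (volume B)^(1 - s⁻¹) ≠ ∞ := by
      intro hz; rw [ENNReal.rpow_eq_top_iff] at hz; tauto
    rw [← h4] at h3
    have h5 : lam * (volume B)^s⁻¹ ≤ C * F^s⁻¹ := (ENNReal.mul_le_mul_iff_left n0 nt).1 h3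
    have h6 := ENNReal.rpow_le_rpow h5 (by linarith : 0 ≤ s)
    rw [ENNReal.mul_rpow_of_nonneg _ _ (by linarith), ENNReal.mul_rpow_of_nonneg _ _ (by linarith), ← ENNReal.rpow_mul, ← ENNReal.rpow_mul, inv_mul_cancel₀ (by linarith), ENNReal.rpow_one, ENNReal.rpow_one] at h6
    have l0 : lam^s ≠ 0 := by
      intro hz; rw [ENNReal.rpow_eq_zero_iff] at hz; tauto
    have lt : lam^s ≠ ∞ := ENNReal.rpow_ne_top_of_nonneg (by linarith) hlt
    rw [ENNReal.rpow_neg, ← div_eq_mul_inv, ENNReal.le_div_iff_mul_le (Or.inl l0) (Or.inl lt), mul_comm]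
    exact h6
  rw [mul_assoc (C^s), ← hF]
  rw [← Measure.iSup_restrict_spanningSets]
  refine iSup_le fun i => ?_
  rw [Measure.restrict_apply hLm]
  refine key _ (hLm.inter (measurableSet_spanningSets _ _)) inter_subset_left ?_
  exact ne_top_of_le_ne_top (measure_spanningSets_lt_top _ i).ne (measure_mono inter_subset_right)
end
end

section
open MeasureTheory Metric Set
open scoped ENNReal NNReal FourierTransform
noncomputable section

/-- the r-th power of the inner norm -/
def Nr (d : ℕ) (χ β₀ : ℝ → ℝ) (r : ℝ) (j : ℕ) (f : Euc d → ℂ) (x : Euc d) : ℝ≥0∞ := ∑' k : ℤ, ∫⁻ t, ‖Ajk d χ β₀ j k f x t‖ₑ^r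

lemma Nr_meas {d : ℕ} (hd : 2 ≤ d) {χ β₀ : ℝ → ℝ} (hχ : IsCutoff χ) (hβ : IsBump β₀) (r : ℝ) (j : ℕ) {f : Euc d → ℂ} (hf : Integrable f) : 
    Measurable (Nr d χ β₀ r j f) := by
  refine Measurable.tsum fun k => ?_
  have := ((Ajk_cont hd hχ hβ j k hf).measurable.enorm).pow_const r
  exact this.lintegral_prod_right'

lemma Ajk_sup {d : ℕ} (hd : 2 ≤ d) {χ β₀ : ℝ → ℝ} (hχ : IsCutoff χ) (hβ : IsBump β₀) : ∃ C : ℝ≥0∞, C ≠ ∞ ∧ ∀ j : ℕ, ∀ f : Euc d → ℂ, Integrable f → (∀ y, ‖f y‖ₑ ≤ 1) →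
    ∀ k x t, ‖Ajk d χ β₀ j k f x t‖ₑ ≤ C := by
  obtain ⟨C, hC, h⟩ := symT_sup (bs0_smooth (d := d) hβ one_pos two_pos) (bs0_cs (d := d) hβ one_pos one_lt_two)
  obtain ⟨M, hM, hχM⟩ := cutoff_bdd hχ
  refine ⟨M * (C * 1), by finiteness, fun j f hf hf1 k x t => ?_⟩
  unfold Ajk
  rw [enorm_mul]
  refine mul_le_mul' (hχM t).1 (sphAvg_enorm_le hd fun z _ => ?_)
  rw [homLP_eq]
  exact h _ (by positivity) f hf 1 hf1 z

lemma weak_r {d : ℕ} (hd : 2 ≤ d) {χ β₀ : ℝ → ℝ} (hχ : IsCutoff χ) (hβ : IsBump β₀) {r : ℝ} (hr : 2 ≤ r) {s : ℝ} (hs : ((d:ℝ)+1)/((d:ℝ)-1) < s) : 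
    ∃ C : ℝ≥0∞, C ≠ ∞ ∧ ∀ j : ℕ, ∀ f : Euc d → ℂ, Integrable f → (∀ y, ‖f y‖ₑ ≤ 1) → ∀ lam : ℝ≥0∞, lam ≠ 0 → lam ≠ ∞ →
    volume {x | lam < Nr d χ β₀ r j f x} ≤ C * (ENNReal.ofReal (((2:ℝ)^j)^d))⁻¹ * (∫⁻ y, ‖f y‖ₑ^2) * lam^(-s) := by
  obtain ⟨C, hC, h⟩ := weak_type hd hχ hβ hs
  obtain ⟨M, hM, hA⟩ := Ajk_sup hd hχ hβ
  set K : ℝ≥0∞ := M^(r-2) + 1 with hK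
  have hMt : M^(r-2) ≠ ∞ := ENNReal.rpow_ne_top_of_nonneg (by linarith) hM
  have hKt : K ≠ ∞ := by rw [hK]; finiteness
  have hK0 : K ≠ 0 := by rw [hK]; simp
  have hs0 : 0 < s := by
    refine lt_of_le_of_lt ?_ hs
    have : (2:ℝ) ≤ d := by exact_mod_cast hd
    apply div_nonneg <;> linarith
  refine ⟨C * K^s, ENNReal.mul_ne_top hC (ENNReal.rpow_ne_top_of_nonneg hs0.le hKt), fun j f hf hf1 lam hl0 hlt => ?_⟩
  have e : {x | lam < Nr d χ β₀ r j f x} ⊆ {x | K⁻¹ * lam < ∑' k : ℤ, Gk d χ β₀ j f k x} := by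
    intro x hx
    have hx' : lam < Nr d χ β₀ r j f x := hx
    have h2 : Nr d χ β₀ r j f x ≤ K * ∑' k : ℤ, Gk d χ β₀ j f k x := by
      unfold Nr Gk
      rw [← ENNReal.tsum_mul_left]
      refine ENNReal.tsum_le_tsum fun k => ?_
      rw [← lintegral_const_mul' _ _ hKt]
      refine lintegral_mono fun t => ?_
      rw [show r = (r-2) + 2 by ring, ENNReal.rpow_add_of_nonneg _ _ (by linarith) (by norm_num), ENNReal.rpow_two]
      refine mul_le_mul' ?_ le_rfl
      rw [hK]
      exact (ENNReal.rpow_le_rpow (hA j f hf hf1 k x t) (by linarith)).trans le_self_add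
    show K⁻¹ * lam < _
    rw [← ENNReal.div_eq_inv_mul, ENNReal.div_lt_iff (Or.inl hK0) (Or.inl hKt), mul_comm]
    exact hx'.trans_le h2
  refine (measure_mono e).trans ((h j f hf hf1 (K⁻¹ * lam) (mul_ne_zero (ENNReal.inv_ne_zero.2 hKt) hl0) (ENNReal.mul_ne_top (ENNReal.inv_ne_top.2 hK0) hlt)).trans (le_of_eq ?_))
  rw [ENNReal.mul_rpow_of_ne_top (ENNReal.inv_ne_top.2 hK0) hlt, ENNReal.inv_rpow, ENNReal.rpow_neg K, inv_inv]
  ring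

lemma Ajk_smul {d : ℕ} {χ β₀ : ℝ → ℝ} (hβ : IsBump β₀) (j : ℕ) (k : ℤ) {f : Euc d → ℂ} (hf : Integrable f) (c : ℂ) (x : Euc d) (t : ℝ) :
    Ajk d χ β₀ j k (fun y => c * f y) x t = c * Ajk d χ β₀ j k f x t := by
  have : homLP d β₀ ((j:ℤ) - k) (fun y => c * f y) = fun z => c * homLP d β₀ ((j:ℤ) - k) f z := by
    ext z
    rw [homLP_eq, homLP_eq]
    exact symT_smul (bs0_smooth (d := d) hβ one_pos two_pos).continuous (bs0_cs (d := d) hβ one_pos one_lt_two) (by positivity) c hf z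
  unfold Ajk
  rw [this]
  unfold sphAvg
  rw [integral_const_mul]; ring

lemma Nr_smul {d : ℕ} {χ β₀ : ℝ → ℝ} (hβ : IsBump β₀) {r : ℝ} (hr : 2 ≤ r) (j : ℕ) {f : Euc d → ℂ} (hf : Integrable f) (c : ℂ) (x : Euc d) :
    Nr d χ β₀ r j (fun y => c * f y) x = ‖c‖ₑ^r * Nr d χ β₀ r j f x := by
  unfold Nr
  rw [← ENNReal.tsum_mul_left]
  refine tsum_congr fun k => ?_
  rw [← lintegral_const_mul' _ _ (ENNReal.rpow_ne_top_of_nonneg (by linarith) enorm_ne_top)]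
  congr 1; ext t
  rw [Ajk_smul hβ j k hf, enorm_mul, ENNReal.mul_rpow_of_nonneg _ _ (by linarith)]

/-- level sets -/
def El {d : ℕ} (f : Euc d → ℂ) (l : ℤ) : Set (Euc d) := {y | (2:ℝ≥0∞)^l ≤ ‖f y‖ₑ ∧ ‖f y‖ₑ < (2:ℝ≥0∞)^(l+1)}

lemma El_meas {d : ℕ} {f : Euc d → ℂ} (hf : Measurable f) (l : ℤ) : MeasurableSet (El f l) :=
  (measurableSet_le measurable_const hf.enorm).inter (measurableSet_lt hf.enorm measurable_const)

lemma El_uniq {d : ℕ} {f : Euc d → ℂ} {y : Euc d} {l m : ℤ} (h1 : y ∈ El f l) (h2 : y ∈ El f m) : l = m := by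
  have key : ∀ a b : ℤ, y ∈ El f a → y ∈ El f b → a ≤ b := fun a b ha hb => by
    by_contra h
    have : (2:ℝ≥0∞)^(b+1) ≤ (2:ℝ≥0∞)^a := ENNReal.zpow_le_of_le (by norm_num) (by omega)
    exact absurd (hb.2.trans_le this) (not_lt.2 ha.1)
  exact le_antisymm (key _ _ h1 h2) (key _ _ h2 h1)

lemma El_sum {d : ℕ} (f : Euc d → ℂ) (y : Euc d) : HasSum (fun l : ℤ => (El f l).indicator f y) (f y) := by
  rcases eq_or_ne (f y) 0 with h0 | h0
  · have : (fun l : ℤ => (El f l).indicator f y) = fun _ => 0 := by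
      ext l; by_cases h : y ∈ El f l <;> simp [h, h0]
    rw [this, h0]; exact hasSum_zero
  · obtain ⟨l, hl⟩ := ENNReal.exists_mem_Ico_zpow (enorm_ne_zero.2 h0) enorm_ne_top (y := 2) (by norm_num) (by norm_num)
    have hl' : y ∈ El f l := hl
    have := hasSum_single (f := fun l : ℤ => (El f l).indicator f y) l (fun m hm => indicator_of_notMem (fun h => hm (El_uniq h hl')) f)
    simpa [indicator_of_mem hl'] using this

lemma El_sum_pow {d : ℕ} (f : Euc d → ℂ) {p : ℝ} (hp : 0 < p) (y : Euc d) : ∑' l : ℤ, (El f l).indicator (fun _ => ((2:ℝ≥0∞)^l)^p) y ≤ ‖f y‖ₑ^p := by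
  by_cases h : ∃ l, y ∈ El f l
  · obtain ⟨l, hl⟩ := h
    rw [tsum_eq_single l (fun m hm => indicator_of_notMem (fun h => hm (El_uniq h hl)) _), indicator_of_mem hl]
    exact ENNReal.rpow_le_rpow hl.1 hp.le
  · push Not at h
    simp [h]

lemma enorm_tsum_le' (f : ℤ → ℂ) : ‖∑' i, f i‖ₑ ≤ ∑' i, ‖f i‖ₑ := enorm_tsum_le_tsum_enorm

lemma kerBd {d : ℕ} {G : Euc d → ℂ} {R : ℝ} (hG : Continuous G) (hc : HasCompactSupport G) (hR : 0 < R) : 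
    ∃ B : ℝ≥0∞, B ≠ ∞ ∧ ∀ z : Euc d, ‖𝓕⁻ (fun ξ => G (R⁻¹ • ξ)) z‖ₑ ≤ B := by
  have hGi : Integrable (fun ξ => G (R⁻¹ • ξ)) := (by fun_prop : Continuous (fun ξ => G (R⁻¹ • ξ))).integrable_of_hasCompactSupport (dil_cs hc hR)
  exact ⟨_, hGi.2.ne, fun z => enorm_fourierInv_le _ z⟩

lemma Ajk_tsum {d : ℕ} (hd : 2 ≤ d) {χ β₀ : ℝ → ℝ} (hβ : IsBump β₀) (j : ℕ) (k : ℤ) {f : Euc d → ℂ} (hfm : Measurable f) (hf : Integrable f) (x : Euc d) (t : ℝ) :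
    ‖Ajk d χ β₀ j k f x t‖ₑ ≤ ∑' l : ℤ, ‖Ajk d χ β₀ j k ((El f l).indicator f) x t‖ₑ := by
  have := sphereMeasure_prob hd
  have hG := (bs0_smooth (d := d) hβ one_pos two_pos).continuous
  have hc := (bs0_cs (d := d) hβ one_pos one_lt_two)
  have hR : (0:ℝ) < (2:ℝ)^((j:ℤ)-k) := by positivity
  obtain ⟨B, hB, hBk⟩ := kerBd hG hc hR
  have hi : ∀ l, Integrable ((El f l).indicator f) := fun l => hf.indicator (El_meas hfm l)
  have tot : ∑' l : ℤ, ∫⁻ y, ‖(El f l).indicator f y‖ₑ ≠ ∞ := by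
    rw [← lintegral_tsum (fun l => (hi l).1.enorm)]
    refine ne_top_of_le_ne_top hf.2.ne (lintegral_mono fun y => ?_)
    by_cases h : ∃ l, y ∈ El f l
    · obtain ⟨l, hl⟩ := h
      rw [tsum_eq_single l (fun m hm => by rw [indicator_of_notMem (fun h => hm (El_uniq h hl)), enorm_zero]), indicator_of_mem hl]
    · push Not at h
      simp [h]
  have b1 : ∀ l z, ‖homLP d β₀ ((j:ℤ)-k) ((El f l).indicator f) z‖ₑ ≤ B * ∫⁻ y, ‖(El f l).indicator f y‖ₑ := by
    intro l z
    rw [homLP_eq, symT_eq hG hc hR (hi l)]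
    refine (enorm_integral_le_lintegral_enorm _).trans ?_
    rw [← lintegral_const_mul' _ _ hB]
    refine lintegral_mono fun y => ?_
    rw [enorm_mul]
    exact mul_le_mul' (hBk _) le_rfl
  have h1 : homLP d β₀ ((j:ℤ)-k) f = fun z => ∑' l : ℤ, homLP d β₀ ((j:ℤ)-k) ((El f l).indicator f) z := by
    ext z
    simp only [homLP_eq]
    rw [symT_eq hG hc hR hf]
    simp only [symT_eq hG hc hR (hi _)]
    rw [← integral_tsum (fun l => (ker_int hG hc hR (hi l) z).1)]
    · congr 1; ext y
      exact ((El_sum f y).mul_left _).tsum_eq.symm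
    · refine ne_top_of_le_ne_top (ENNReal.mul_ne_top hB tot) ?_
      rw [← ENNReal.tsum_mul_left]
      refine ENNReal.tsum_le_tsum fun l => ?_
      rw [← lintegral_const_mul' _ _ hB]
      refine lintegral_mono fun y => ?_
      rw [enorm_mul]
      exact mul_le_mul' (hBk _) le_rfl
  have h2 : Ajk d χ β₀ j k f x t = ∑' l : ℤ, Ajk d χ β₀ j k ((El f l).indicator f) x t := by
    unfold Ajk
    rw [tsum_mul_left, h1]
    congr 1
    unfold sphAvg
    rw [integral_tsum (fun l => ?_)]
    · refine ne_top_of_le_ne_top (ENNReal.mul_ne_top hB tot) ?_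
      rw [← ENNReal.tsum_mul_left]
      refine ENNReal.tsum_le_tsum fun l => ?_
      refine (lintegral_mono fun y => b1 l _).trans ?_
      rw [lintegral_const, measure_univ, mul_one]
    · have := homLP_cont hβ ((j:ℤ)-k) (hi l)
      exact Continuous.aestronglyMeasurable (by fun_prop)
  rw [h2]
  exact enorm_tsum_le' _
end
end

section
open MeasureTheory Metric Set
open scoped ENNReal NNReal FourierTransform
noncomputable section

lemma sum_sup {ε : ℝ} (hε : 0 < ε) : ∃ C : ℝ≥0∞, C ≠ ∞ ∧ ∀ (a : ℤ → ℝ≥0∞) (n : ℤ), ∑' l : ℤ, a l ≤ C * ⨆ l : ℤ, (2:ℝ≥0∞)^(ε * |(l:ℝ) - n|) * a l := by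
  obtain ⟨C, hC, h⟩ := geoZ hε
  refine ⟨C, hC, fun a n => le_trans ?_ (mul_le_mul' (h n) le_rfl)⟩
  rw [← ENNReal.tsum_mul_right]
  refine ENNReal.tsum_le_tsum fun l => ?_
  refine le_trans ?_ (mul_le_mul' le_rfl (le_iSup (fun l : ℤ => (2:ℝ≥0∞)^(ε * |(l:ℝ) - n|) * a l) l))
  rw [← mul_assoc, ← ENNReal.rpow_add _ _ (by norm_num) (by norm_num)]
  simp

lemma pow_sum {ω r : ℝ} (hω : 0 < ω) (hr : 0 < r) : ∃ C : ℝ≥0∞, C ≠ ∞ ∧ ∀ (a : ℤ → ℝ≥0∞) (n : ℤ), (∑' l : ℤ, a l)^r ≤ C * ∑' l : ℤ, (2:ℝ≥0∞)^(ω * |(l:ℝ) - n|) * (a l)^r := by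
  obtain ⟨C, hC, h⟩ := sum_sup (div_pos hω hr)
  refine ⟨C^r, ENNReal.rpow_ne_top_of_nonneg hr.le hC, fun a n => (ENNReal.rpow_le_rpow (h a n) hr.le).trans ?_⟩
  rw [ENNReal.mul_rpow_of_nonneg _ _ hr.le]
  refine mul_le_mul' le_rfl ?_
  rw [← ENNReal.le_rpow_inv_iff hr]
  refine iSup_le fun l => ?_
  rw [ENNReal.le_rpow_inv_iff hr]
  refine le_trans (le_of_eq ?_) (ENNReal.le_tsum l)
  rw [ENNReal.mul_rpow_of_nonneg _ _ hr.le, ← ENNReal.rpow_mul]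
  congr 2; field_simp

lemma Ajk_meas_t {d : ℕ} (hd : 2 ≤ d) {χ β₀ : ℝ → ℝ} (hχ : IsCutoff χ) (hβ : IsBump β₀) (r : ℝ) (j : ℕ) (k : ℤ) {f : Euc d → ℂ} (hf : Integrable f) (x : Euc d) : 
    Measurable fun t => ‖Ajk d χ β₀ j k f x t‖ₑ^r := by
  obtain ⟨M, hM⟩ := homLP_bdd hβ ((j:ℤ) - k) hf
  have e := sphAvg_cont_Dt hd (homLP_cont hβ ((j:ℤ)-k) hf) hM ((2:ℝ)^k) x
  have hcχ : Continuous χ := hχ.1.continuous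
  have e2 : Continuous (fun t : ℝ => (χ t : ℂ)) := by fun_prop
  have e3 : Continuous (fun t : ℝ => Ajk d χ β₀ j k f x t) := e2.mul e
  exact e3.measurable.enorm.pow_const r

lemma Nr_decomp {d : ℕ} (hd : 2 ≤ d) {χ β₀ : ℝ → ℝ} (hχ : IsCutoff χ) (hβ : IsBump β₀) {r : ℝ} (hr : 2 ≤ r) {ω : ℝ} (hω : 0 < ω) :
    ∃ K : ℝ≥0∞, K ≠ 0 ∧ K ≠ ∞ ∧ ∀ (j : ℕ) (f : Euc d → ℂ), Measurable f → Integrable f → ∀ (n : ℤ) x, 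
    Nr d χ β₀ r j f x ≤ K * ⨆ l : ℤ, (2:ℝ≥0∞)^(2 * ω * |(l:ℝ) - n|) * Nr d χ β₀ r j ((El f l).indicator f) x := by
  obtain ⟨C1, hC1, h1⟩ := pow_sum hω (by linarith : 0 < r)
  obtain ⟨C2, hC2, h2⟩ := sum_sup hω
  refine ⟨C1 * C2 + 1, by simp, by finiteness, fun j f hfm hf n x => ?_⟩
  have hi : ∀ l, Integrable ((El f l).indicator f) := fun l => hf.indicator (El_meas hfm l)
  have hm : ∀ k l, Measurable fun t => ‖Ajk d χ β₀ j k ((El f l).indicator f) x t‖ₑ^r := fun k l => 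
    Ajk_meas_t hd hχ hβ r j k (hi l) x
  calc Nr d χ β₀ r j f x ≤ ∑' k : ℤ, ∫⁻ t, C1 * ∑' l : ℤ, (2:ℝ≥0∞)^(ω * |(l:ℝ) - n|) * ‖Ajk d χ β₀ j k ((El f l).indicator f) x t‖ₑ^r := by
        refine ENNReal.tsum_le_tsum fun k => lintegral_mono fun t => ?_
        exact (ENNReal.rpow_le_rpow (Ajk_tsum hd hβ j k hfm hf x t) (by linarith)).trans (h1 _ n)
    _ = C1 * ∑' l : ℤ, (2:ℝ≥0∞)^(ω * |(l:ℝ) - n|) * Nr d χ β₀ r j ((El f l).indicator f) x := by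
        unfold Nr
        simp only [← ENNReal.tsum_mul_left]
        rw [ENNReal.tsum_comm]
        refine tsum_congr fun k => ?_
        rw [lintegral_tsum (fun l => (((hm k l).const_mul _).const_mul _).aemeasurable)]
        refine tsum_congr fun l => ?_
        rw [lintegral_const_mul _ ((hm k l).const_mul _), lintegral_const_mul _ (hm k l)]
    _ ≤ C1 * (C2 * ⨆ l : ℤ, (2:ℝ≥0∞)^(ω * |(l:ℝ) - n|) * ((2:ℝ≥0∞)^(ω * |(l:ℝ) - n|) * Nr d χ β₀ r j ((El f l).indicator f) x)) :=
        mul_le_mul' le_rfl (h2 _ n)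
    _ = C1 * C2 * ⨆ l : ℤ, (2:ℝ≥0∞)^(2 * ω * |(l:ℝ) - n|) * Nr d χ β₀ r j ((El f l).indicator f) x := by
        rw [mul_assoc]; congr 2
        refine iSup_congr fun l => ?_
        rw [← mul_assoc, ← ENNReal.rpow_add _ _ (by norm_num) (by norm_num)]
        congr 2; ring
    _ ≤ _ := mul_le_mul' le_self_add le_rfl

lemma piece_bound {d : ℕ} (hd : 2 ≤ d) {χ β₀ : ℝ → ℝ} (hχ : IsCutoff χ) (hβ : IsBump β₀) {r : ℝ} (hr : 2 ≤ r) {s : ℝ} (hs : ((d:ℝ)+1)/((d:ℝ)-1) < s) {K : ℝ≥0∞} (hK0 : K ≠ 0) (hK : K ≠ ∞) : 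
    ∃ C : ℝ≥0∞, C ≠ ∞ ∧ ∀ j : ℕ, ∀ f : Euc d → ℂ, Measurable f → Integrable f → ∀ (l : ℤ) (a : ℝ),
    volume {x | K⁻¹ * (2:ℝ≥0∞)^a < Nr d χ β₀ r j ((El f l).indicator f) x} ≤ C * ((ENNReal.ofReal (((2:ℝ)^j)^d))⁻¹ * volume (El f l)) * (2:ℝ≥0∞)^(s * (l * r - a)) := by
  obtain ⟨C, hC, h⟩ := weak_r hd hχ hβ hr hs
  have hs0 : 0 < s := by
    refine lt_of_le_of_lt ?_ hs
    have : (2:ℝ) ≤ d := by exact_mod_cast hd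
    apply div_nonneg <;> linarith
  refine ⟨C * K^s * (2:ℝ≥0∞)^(s * r), ENNReal.mul_ne_top (ENNReal.mul_ne_top hC (ENNReal.rpow_ne_top_of_nonneg hs0.le hK)) (ENNReal.rpow_ne_top_of_nonneg (by nlinarith) (by norm_num)), fun j f hfm hf l a => ?_⟩
  set c : ℂ := (2:ℂ)^(-(l+1)) with hc
  have hce : ‖c‖ₑ = (2:ℝ≥0∞)^(-((l:ℝ)+1)) := by
    rw [hc, ← ofReal_norm, norm_zpow, Complex.norm_ofNat, ← Real.rpow_intCast, ← ENNReal.ofReal_rpow_of_pos (by norm_num)]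
    push_cast; simp
  have hi : Integrable ((El f l).indicator f) := hf.indicator (El_meas hfm l)
  have hb : ∀ y, ‖c * (El f l).indicator f y‖ₑ ≤ (El f l).indicator (fun _ => 1) y := by
    intro y
    by_cases hy : y ∈ El f l
    · rw [indicator_of_mem hy, indicator_of_mem hy, enorm_mul, hce]
      refine (mul_le_mul' le_rfl hy.2.le).trans (le_of_eq ?_)
      rw [← ENNReal.rpow_intCast, ← ENNReal.rpow_add _ _ (by norm_num) (by norm_num)]
      push_cast
      simp
    · simp [hy]
  have hb1 : ∀ y, ‖c * (El f l).indicator f y‖ₑ ≤ 1 := fun y => (hb y).trans (indicator_le_self' (fun _ _ => zero_le) y)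
  have hb2 : ∫⁻ y, ‖c * (El f l).indicator f y‖ₑ^2 ≤ volume (El f l) := by
    rw [← lintegral_indicator_one (El_meas hfm l)]
    refine lintegral_mono fun y => ?_
    refine (pow_le_pow_left' (hb y) 2).trans ?_
    by_cases hy : y ∈ El f l <;> simp [hy]
  have t0 : ∀ b : ℝ, (2:ℝ≥0∞)^b ≠ 0 := fun b => (ENNReal.rpow_pos (by norm_num) (by norm_num)).ne'
  have tt : ∀ b : ℝ, (2:ℝ≥0∞)^b ≠ ∞ := fun b => ENNReal.rpow_ne_top_of_ne_zero (by norm_num) (by norm_num)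
  have e : {x | K⁻¹ * (2:ℝ≥0∞)^a < Nr d χ β₀ r j ((El f l).indicator f) x} ⊆ {x | K⁻¹ * (2:ℝ≥0∞)^(a - (l+1) * r) < Nr d χ β₀ r j (fun y => c * (El f l).indicator f y) x} := by
    intro x hx
    have hx' : K⁻¹ * (2:ℝ≥0∞)^a < Nr d χ β₀ r j ((El f l).indicator f) x := hx
    show K⁻¹ * (2:ℝ≥0∞)^(a - (l+1) * r) < _
    rw [Nr_smul hβ hr j hi, hce, ← ENNReal.rpow_mul]
    have : K⁻¹ * (2:ℝ≥0∞)^(a - (l+1) * r) = (2:ℝ≥0∞)^(-((l:ℝ)+1) * r) * (K⁻¹ * (2:ℝ≥0∞)^a) := by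
      rw [mul_left_comm, ← ENNReal.rpow_add _ _ (by norm_num) (by norm_num)]
      congr 2; ring
    rw [this]
    exact ENNReal.mul_lt_mul_right (t0 _) (tt _) hx'
  refine (measure_mono e).trans ((h j _ (hi.const_mul c) hb1 (K⁻¹ * (2:ℝ≥0∞)^(a - (l+1) * r)) (mul_ne_zero (ENNReal.inv_ne_zero.2 hK) (t0 _)) (ENNReal.mul_ne_top (ENNReal.inv_ne_top.2 hK0) (tt _))).trans ?_)
  refine (mul_le_mul' (mul_le_mul' le_rfl hb2) le_rfl).trans (le_of_eq ?_)
  rw [ENNReal.mul_rpow_of_ne_top (ENNReal.inv_ne_top.2 hK0) (tt _), ENNReal.inv_rpow, ENNReal.rpow_neg K, inv_inv, ← ENNReal.rpow_mul,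
    show (a - (l+1)*r) * -s = s * r + s * (l * r - a) by ring, ENNReal.rpow_add _ _ (by norm_num) (by norm_num)]
  ring

lemma layer {r p : ℝ} (hr : 0 < r) (hp : 0 < p) (u : ℝ≥0∞) : u^(p/r) ≤ ∑' n : ℤ, (2:ℝ≥0∞)^(((n:ℝ)+1) * p) * (if (2:ℝ≥0∞)^((n:ℝ)*r) < u then 1 else 0) := by
  rcases eq_or_ne u 0 with rfl | h0
  · rw [ENNReal.zero_rpow_of_pos (by positivity)]; exact zero_le
  rcases eq_or_ne u ∞ with rfl | ht
  · have tt : ∀ b : ℝ, (2:ℝ≥0∞)^b < ∞ := fun b => (ENNReal.rpow_ne_top_of_ne_zero (by norm_num) (by norm_num)).lt_top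
    simp only [tt, if_true, mul_one]
    have h1 : ∀ n : ℕ, (1:ℝ≥0∞) ≤ (2:ℝ≥0∞)^((((n:ℤ):ℝ)+1) * p) := fun n => ENNReal.one_le_rpow (by norm_num) (by positivity)
    have h2 : ∑' n : ℕ, (1:ℝ≥0∞) ≤ ∑' n : ℤ, (2:ℝ≥0∞)^(((n:ℝ)+1) * p) := 
      (ENNReal.tsum_le_tsum h1).trans (ENNReal.tsum_comp_le_tsum_of_injective (f := fun n : ℕ => (n:ℤ)) Nat.cast_injective (fun n : ℤ => (2:ℝ≥0∞)^(((n:ℝ)+1) * p)))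
    rw [ENNReal.tsum_const_eq_top_of_ne_zero one_ne_zero] at h2
    exact le_top.trans h2
  · obtain ⟨n, h1, h2⟩ := ENNReal.exists_mem_Ioc_zpow h0 ht (y := (2:ℝ≥0∞)^r) (ENNReal.one_lt_rpow (by norm_num) hr) (ENNReal.rpow_ne_top_of_nonneg hr.le (by norm_num))
    rw [← ENNReal.rpow_intCast, ← ENNReal.rpow_mul, mul_comm] at h1 h2
    refine le_trans ?_ (ENNReal.le_tsum n)
    rw [if_pos h1, mul_one]
    refine (ENNReal.rpow_le_rpow h2 (by positivity)).trans (le_of_eq ?_)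
    rw [← ENNReal.rpow_mul]
    congr 1; push_cast; field_simp

lemma strong {d : ℕ} (hd : 2 ≤ d) {χ β₀ : ℝ → ℝ} (hχ : IsCutoff χ) (hβ : IsBump β₀) {r p : ℝ} (hr : 2 ≤ r) (hp : r * (((d:ℝ)+1)/((d:ℝ)-1)) < p) :
    ∃ C : ℝ≥0∞, C ≠ ∞ ∧ ∀ j : ℕ, ∀ f : Euc d → ℂ, Measurable f → Integrable f → 
    ∫⁻ x, (Nr d χ β₀ r j f x)^(p/r) ≤ C * (ENNReal.ofReal (((2:ℝ)^j)^d))⁻¹ * ∫⁻ y, ‖f y‖ₑ^p := by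
  have hd' : (2:ℝ) ≤ d := by exact_mod_cast hd
  have hr0 : 0 < r := by linarith
  set s0 := p / r with hs0
  have hps : p = r * s0 := by rw [hs0]; field_simp
  have q0 : 0 < ((d:ℝ)+1)/((d:ℝ)-1) := by apply div_pos <;> linarith
  have hq : ((d:ℝ)+1)/((d:ℝ)-1) < s0 := by rw [hs0, lt_div_iff₀ hr0]; linarith
  have hp0 : 0 < p := by rw [hps]; exact mul_pos hr0 (q0.trans hq)
  set η := (s0 - ((d:ℝ)+1)/((d:ℝ)-1)) / 2 with hη
  have hη0 : 0 < η := by rw [hη]; linarith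
  have hs1 : ((d:ℝ)+1)/((d:ℝ)-1) < s0 - η := by rw [hη]; linarith
  have hs2 : ((d:ℝ)+1)/((d:ℝ)-1) < s0 + η := by linarith
  set ω := r * η / (4 * (s0 + η)) with hω
  have hω0 : 0 < ω := by rw [hω]; apply div_pos <;> nlinarith
  have hωs : 2 * ω * (s0 + η) = r * η / 2 := by
    have : s0 + η ≠ 0 := by linarith
    rw [hω]; field_simp; norm_num
  obtain ⟨K, hK0, hKt, hdec⟩ := Nr_decomp hd hχ hβ hr hω0
  obtain ⟨C1, hC1, h1⟩ := piece_bound hd hχ hβ hr hs1 hK0 hKt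
  obtain ⟨C2, hC2, h2⟩ := piece_bound hd hχ hβ hr hs2 hK0 hKt
  obtain ⟨C3, hC3, h3⟩ := geoZ (δ := r * η / 2) (by positivity)
  have t2 : (2:ℝ≥0∞)^p ≠ ∞ := ENNReal.rpow_ne_top_of_nonneg hp0.le (by norm_num)
  refine ⟨(2:ℝ≥0∞)^p * (C1 + C2) * C3, by finiteness, fun j f hfm hf => ?_⟩
  set W := ENNReal.ofReal (((2:ℝ)^j)^d) with hW
  have lev : ∀ n : ℤ, (2:ℝ≥0∞)^(((n:ℝ)+1) * p) * volume {x | (2:ℝ≥0∞)^((n:ℝ)*r) < Nr d χ β₀ r j f x} ≤ 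
      ∑' l : ℤ, ((2:ℝ≥0∞)^p * (C1 + C2) * W⁻¹) * (((2:ℝ≥0∞)^((l:ℝ)*p) * volume (El f l)) * (2:ℝ≥0∞)^(-(r*η/2) * |(n:ℝ) - l|)) := by
    intro n
    have sub : {x | (2:ℝ≥0∞)^((n:ℝ)*r) < Nr d χ β₀ r j f x} ⊆ ⋃ l : ℤ, {x | K⁻¹ * (2:ℝ≥0∞)^((n:ℝ)*r - 2 * ω * |(l:ℝ)-n|) < Nr d χ β₀ r j ((El f l).indicator f) x} := by
      intro x hx
      have hx' : (2:ℝ≥0∞)^((n:ℝ)*r) < _ := lt_of_lt_of_le hx (hdec j f hfm hf n x)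
      by_contra hcon
      rw [mem_iUnion] at hcon
      push Not at hcon
      refine absurd hx' (not_lt.2 ?_)
      rw [ENNReal.mul_iSup]
      refine iSup_le fun l => ?_
      have hl : Nr d χ β₀ r j ((El f l).indicator f) x ≤ K⁻¹ * (2:ℝ≥0∞)^((n:ℝ)*r - 2 * ω * |(l:ℝ)-n|) := not_lt.1 (hcon l)
      refine (mul_le_mul' le_rfl (mul_le_mul' le_rfl hl)).trans (le_of_eq ?_)
      rw [mul_left_comm ((2:ℝ≥0∞)^(2 * ω * |(l:ℝ)-n|)), ← mul_assoc K, ENNReal.mul_inv_cancel hK0 hKt, one_mul, ← ENNReal.rpow_add _ _ (by norm_num) (by norm_num)]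
      congr 1; ring
    refine (mul_le_mul' le_rfl ((measure_mono sub).trans (measure_iUnion_le _))).trans ?_
    rw [← ENNReal.tsum_mul_left]
    refine ENNReal.tsum_le_tsum fun l => ?_
    have fin : ∀ (Ci : ℝ≥0∞) (si : ℝ), Ci ≤ C1 + C2 → ((n:ℝ)+1) * p + si * (l * r - ((n:ℝ)*r - 2 * ω * |(l:ℝ)-n|)) ≤ p + (l * p + -(r*η/2) * |(n:ℝ) - l|) → 
        volume {x | K⁻¹ * (2:ℝ≥0∞)^((n:ℝ)*r - 2 * ω * |(l:ℝ)-n|) < Nr d χ β₀ r j ((El f l).indicator f) x} ≤ Ci * (W⁻¹ * volume (El f l)) * (2:ℝ≥0∞)^(si * (l * r - ((n:ℝ)*r - 2 * ω * |(l:ℝ)-n|))) →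
        (2:ℝ≥0∞)^(((n:ℝ)+1) * p) * volume {x | K⁻¹ * (2:ℝ≥0∞)^((n:ℝ)*r - 2 * ω * |(l:ℝ)-n|) < Nr d χ β₀ r j ((El f l).indicator f) x} ≤ ((2:ℝ≥0∞)^p * (C1 + C2) * W⁻¹) * (((2:ℝ≥0∞)^((l:ℝ)*p) * volume (El f l)) * (2:ℝ≥0∞)^(-(r*η/2) * |(n:ℝ) - l|)) := by
      intro Ci si hCi hsi hv
      calc _ ≤ (2:ℝ≥0∞)^(((n:ℝ)+1) * p) * (Ci * (W⁻¹ * volume (El f l)) * (2:ℝ≥0∞)^(si * (l * r - ((n:ℝ)*r - 2 * ω * |(l:ℝ)-n|)))) := mul_le_mul' le_rfl hv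
        _ = Ci * (W⁻¹ * volume (El f l)) * ((2:ℝ≥0∞)^(((n:ℝ)+1) * p) * (2:ℝ≥0∞)^(si * (l * r - ((n:ℝ)*r - 2 * ω * |(l:ℝ)-n|)))) := by ring
        _ ≤ (C1 + C2) * (W⁻¹ * volume (El f l)) * (2:ℝ≥0∞)^(p + (l * p + -(r*η/2) * |(n:ℝ) - l|)) := by
            rw [← ENNReal.rpow_add _ _ (by norm_num) (by norm_num)]
            exact mul_le_mul' (mul_le_mul' hCi le_rfl) (ENNReal.rpow_le_rpow_of_exponent_le (by norm_num) hsi)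
        _ = _ := by
            rw [ENNReal.rpow_add _ _ (by norm_num) (by norm_num), ENNReal.rpow_add _ _ (by norm_num) (by norm_num)]
            ring
    rw [abs_sub_comm (n:ℝ)] at fin ⊢
    rcases le_total (n:ℝ) l with hnl | hnl
    · refine fin C1 (s0 - η) le_self_add ?_ (h1 j f hfm hf l _)
      rw [abs_of_nonneg (by linarith)]
      have : 0 ≤ ω * η * ((l:ℝ) - n) := by have := sub_nonneg.2 hnl; positivity
      have e : 2 * ω * (s0 + η) * ((l:ℝ)-n) = r * η / 2 * ((l:ℝ)-n) := by rw [hωs]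
      rw [hps]
      linarith
    · refine fin C2 (s0 + η) le_add_self ?_ (h2 j f hfm hf l _)
      rw [abs_of_nonpos (by linarith)]
      have e : 2 * ω * (s0 + η) * ((l:ℝ)-n) = r * η / 2 * ((l:ℝ)-n) := by rw [hωs]
      rw [hps]
      linarith
  have hNm := Nr_meas hd hχ hβ r j hf
  have hlv : ∀ n : ℤ, MeasurableSet {x | (2:ℝ≥0∞)^((n:ℝ)*r) < Nr d χ β₀ r j f x} := fun n => measurableSet_lt measurable_const hNm
  calc ∫⁻ x, (Nr d χ β₀ r j f x)^s0 ≤ ∫⁻ x, ∑' n : ℤ, (2:ℝ≥0∞)^(((n:ℝ)+1) * p) * {x | (2:ℝ≥0∞)^((n:ℝ)*r) < Nr d χ β₀ r j f x}.indicator 1 x := by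
        refine lintegral_mono fun x => ?_
        refine (layer hr0 hp0 _).trans (le_of_eq (tsum_congr fun n => ?_))
        simp only [indicator, mem_ofPred_eq, Pi.one_apply]
    _ = ∑' n : ℤ, (2:ℝ≥0∞)^(((n:ℝ)+1) * p) * volume {x | (2:ℝ≥0∞)^((n:ℝ)*r) < Nr d χ β₀ r j f x} := by
        rw [lintegral_tsum (fun n => ((measurable_one.indicator (hlv n)).const_mul _).aemeasurable)]
        refine tsum_congr fun n => ?_
        rw [lintegral_const_mul _ (measurable_one.indicator (hlv n)), lintegral_indicator_one (hlv n)]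
    _ ≤ _ := ENNReal.tsum_le_tsum lev
    _ = ((2:ℝ≥0∞)^p * (C1 + C2) * W⁻¹) * ∑' l : ℤ, ((2:ℝ≥0∞)^((l:ℝ)*p) * volume (El f l)) * ∑' n : ℤ, (2:ℝ≥0∞)^(-(r*η/2) * |(n:ℝ) - l|) := by
        rw [ENNReal.tsum_comm]
        simp only [ENNReal.tsum_mul_left]
    _ ≤ ((2:ℝ≥0∞)^p * (C1 + C2) * W⁻¹) * ∑' l : ℤ, ((2:ℝ≥0∞)^((l:ℝ)*p) * volume (El f l)) * C3 := 
        mul_le_mul' le_rfl (ENNReal.tsum_le_tsum fun l => mul_le_mul' le_rfl (h3 l))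
    _ = (2:ℝ≥0∞)^p * (C1 + C2) * C3 * W⁻¹ * ∑' l : ℤ, ((2:ℝ≥0∞)^((l:ℝ)*p) * volume (El f l)) := by
        rw [ENNReal.tsum_mul_right]; ring
    _ ≤ _ := by
        refine mul_le_mul' le_rfl ?_
        refine le_trans (le_of_eq ?_) (lintegral_mono (El_sum_pow f hp0))
        rw [lintegral_tsum (fun l => (measurable_const.indicator (El_meas hfm l)).aemeasurable)]
        refine tsum_congr fun l => ?_
        rw [lintegral_indicator_const (El_meas hfm l), ← ENNReal.rpow_intCast, ← ENNReal.rpow_mul]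
end
end

section
open MeasureTheory Metric Set
open scoped ENNReal NNReal FourierTransform
noncomputable section

lemma fourier_congr_ae {d : ℕ} {f g : Euc d → ℂ} (h : f =ᵐ[volume] g) : 𝓕 f = 𝓕 g := by
  ext ξ
  rw [Real.fourier_eq', Real.fourier_eq']
  refine integral_congr_ae ?_
  filter_upwards [h] with y hy
  rw [hy]

lemma fourier_not_int {d : ℕ} {f : Euc d → ℂ} (h : ¬ Integrable f) : 𝓕 f = fun _ => 0 := by
  ext ξ
  rw [Real.fourier_eq']
  refine integral_undef fun hi => h ?_
  have hc : Continuous (fun v : Euc d => Complex.exp (((2 * Real.pi * inner ℝ v ξ : ℝ) : ℂ) * Complex.I)) := by fun_prop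
  have := hi.bdd_mul (c := 1) hc.aestronglyMeasurable (Filter.Eventually.of_forall fun v => by
    rw [Complex.norm_exp_ofReal_mul_I])
  refine this.congr (Filter.Eventually.of_forall fun v => ?_)
  simp only [smul_eq_mul, ← mul_assoc, ← Complex.exp_add]
  rw [← add_mul, ← Complex.ofReal_add]
  simp

lemma Ajk_congr {d : ℕ} {χ β₀ : ℝ → ℝ} (j : ℕ) (k : ℤ) {f g : Euc d → ℂ} (h : 𝓕 f = 𝓕 g) : Ajk d χ β₀ j k f = Ajk d χ β₀ j k g := by
  ext x t
  unfold Ajk homLP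
  rw [h]

lemma Ajk_zero {d : ℕ} {χ β₀ : ℝ → ℝ} (j : ℕ) (k : ℤ) {f : Euc d → ℂ} (h : 𝓕 f = fun _ => 0) (x : Euc d) (t : ℝ) : Ajk d χ β₀ j k f x t = 0 := by
  unfold Ajk homLP sphAvg
  rw [h]
  have : ∀ z : Euc d, 𝓕⁻ (fun _ : Euc d => (0:ℂ)) z = 0 := fun z => by rw [Real.fourierInv_eq']; simp
  simp [this]

end
end

/-- Proposition 7.2: for `2 ≤ r < ∞` and `r(d+1)/(d-1) < p < ∞`,
`‖(Σ_{k ∈ ℤ} ‖𝒜_j^k f‖_{L^r(ℝ)}^r)^{1/r}‖_{L^p(ℝ^d)} ≲ 2^{-jd/p} ‖f‖_{L^p}`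
uniformly in `j ≥ 1`. -/
theorem global_scales_fixed_j (d : ℕ) (hd : 2 ≤ d) (χ β₀ : ℝ → ℝ)
    (hχ : IsCutoff χ) (hβ : IsBump β₀) (r p : ℝ) (hr1 : 2 ≤ r)
    (hp : r * ((d : ℝ) + 1) / ((d : ℝ) - 1) < p) :
    ∃ C : ℝ≥0, ∀ j : ℕ, 1 ≤ j → ∀ f : Euc d → ℂ,
      lqNorm (ENNReal.ofReal p)
          (fun x => (∑' k : ℤ,
            ∫⁻ t, (‖Ajk d χ β₀ j k f x t‖₊ : ℝ≥0∞) ^ r ∂volume) ^ (1 / r))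
          volume ≤
        C * (2 : ℝ≥0∞) ^ (-((j : ℝ) * d) / p) * eLpNorm f (ENNReal.ofReal p) volume := by
  have hd' : (2:ℝ) ≤ d := by exact_mod_cast hd
  have hr0 : 0 < r := by linarith
  rw [mul_div_assoc] at hp
  have hp0 : 0 < p := lt_trans (mul_pos hr0 (by apply div_pos <;> linarith)) hp
  obtain ⟨C, hC, h⟩ := strong hd hχ hβ hr1 hp
  have hCp : C^(1/p) ≠ ∞ := ENNReal.rpow_ne_top_of_nonneg (by positivity) hC
  refine ⟨(C^(1/p)).toNNReal, fun j _ f => ?_⟩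
  rw [ENNReal.coe_toNNReal hCp]
  unfold lqNorm
  rw [if_neg ENNReal.ofReal_ne_top, ENNReal.toReal_ofReal hp0.le]
  by_cases hf : Integrable f
  · obtain ⟨g, hgm, hfg⟩ := hf.1
    have hgm' : Measurable g := hgm.measurable
    have hg : Integrable g := hf.congr hfg
    have hF : ∀ k, Ajk d χ β₀ j k f = Ajk d χ β₀ j k g := fun k => Ajk_congr j k (fourier_congr_ae hfg)
    rw [eLpNorm_congr_ae hfg]
    simp only [hF]
    have e1 : ∀ x, ((∑' k : ℤ, ∫⁻ t, (‖Ajk d χ β₀ j k g x t‖₊ : ℝ≥0∞) ^ r ∂volume) ^ (1 / r))^p = (Nr d χ β₀ r j g x)^(p/r) := by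
      intro x
      rw [← ENNReal.rpow_mul, one_div_mul_eq_div]
      rfl
    simp only [e1]
    refine (ENNReal.rpow_le_rpow (h j g hgm' hg) (by positivity)).trans (le_of_eq ?_)
    rw [ENNReal.mul_rpow_of_nonneg _ _ (by positivity), ENNReal.mul_rpow_of_nonneg _ _ (by positivity)]
    rw [eLpNorm_eq_lintegral_rpow_enorm_toReal (by simpa using hp0) ENNReal.ofReal_ne_top, ENNReal.toReal_ofReal hp0.le]
    congr 2
    rw [← pow_mul, ENNReal.ofReal_pow (by norm_num), ENNReal.ofReal_ofNat, ← ENNReal.rpow_natCast, ← ENNReal.rpow_neg, ← ENNReal.rpow_mul]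
    congr 1
    push_cast; ring
  · have hz : ∀ k x t, Ajk d χ β₀ j k f x t = 0 := fun k x t => Ajk_zero j k (fourier_not_int hf) x t
    simp only [hz, nnnorm_zero, ENNReal.coe_zero, ENNReal.zero_rpow_of_pos hr0, lintegral_zero, tsum_zero]
    rw [ENNReal.zero_rpow_of_pos (by positivity), ENNReal.zero_rpow_of_pos hp0, lintegral_zero, ENNReal.zero_rpow_of_pos (by positivity)]
    exact zero_le
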